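/- Let φ(x,y) = a₁x² + a₂xy + a₃y² be a non-degenerate rational quadratic form (a₁,a₂,a₃ ∈ ℚ, a₂² − 4a₁a₃ ≠ 0), let 0 < s < 1 and C₁, C₂, c > 0. There exist a constant ε = ε(φ, s) > 0 (which, when φ is diagonal, i.e. a₂ = 0, can be chosen to depend only on s) and an integer N = N(φ, s, C₁, C₂, c) such that: for every bivariate real random variable (X, Y) with range contained in [-c, c]² that is conditionally (s₁, C₁; s₂, C₂)-Frostman, where 0 ≤ s₁, s₂ ≤ 1 and s₁ + s₂ ≥ 2s, one has max{ (1/2)·Hₙ(X, Y), Hₙ(X + Y), Hₙ(φ(X, Y)) } ≥ n(s + ε) for all integers n > N. -/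

import Mathlib

open MeasureTheory ProbabilityTheory Real

/-- The dyadic discretization map `D_n(x) = 2^{-n} ⌊2^n x⌋`. -/
noncomputable def Dn (n : ℕ) (x : ℝ) : ℝ := (⌊(2 : ℝ) ^ n * x⌋ : ℝ) / (2 : ℝ) ^ n

/-- Shannon entropy (base 2) of the discrete random variable `f` under `P`. -/
noncomputable def entOf {Ω : Type*} [MeasurableSpace Ω] {S : Type*}
    (P : Measure Ω) (f : Ω → S) : ℝ :=
  ∑' s : S, -((P (f ⁻¹' {s})).toReal * Real.logb 2 (P (f ⁻¹' {s})).toReal)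

/-- `H_n(X)`: entropy of `D_n(X)`. -/
noncomputable def Hn {Ω : Type*} [MeasurableSpace Ω] (P : Measure Ω) (n : ℕ) (X : Ω → ℝ) : ℝ :=
  entOf P (fun ω => Dn n (X ω))

/-- `H_n(X,Y)`: entropy of `(D_n(X), D_n(Y))`. -/
noncomputable def Hn2 {Ω : Type*} [MeasurableSpace Ω] (P : Measure Ω) (n : ℕ)
    (X Y : Ω → ℝ) : ℝ :=
  entOf P (fun ω => (Dn n (X ω), Dn n (Y ω)))

/-- `X` is `(s,C)`-Frostman given `Y`:
`P(X ∈ B(x,r), Y ∈ E) ≤ C r^s P(Y ∈ E)` for all balls and Borel sets. -/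
def FrostmanGiven {Ω : Type*} [MeasurableSpace Ω] (P : Measure Ω) (X Y : Ω → ℝ)
    (s C : ℝ) : Prop :=
  ∀ (x r : ℝ), 0 < r → ∀ E : Set ℝ, MeasurableSet E →
    (P (X ⁻¹' Metric.ball x r ∩ Y ⁻¹' E)).toReal ≤ C * r ^ s * (P (Y ⁻¹' E)).toReal

namespace CF
open Classical Finset

/-- probability vectors on a finite type -/
structure IsP {Ω : Type*} [Fintype Ω] (p : Ω → ℝ) : Prop where
  nn : ∀ ω, 0 ≤ p ω
  sum : ∑ ω, p ω = 1

/-- law of `f` -/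
noncomputable def Pr {Ω S : Type*} [Fintype Ω] (p : Ω → ℝ) (f : Ω → S) (s : S) : ℝ :=
  ∑ ω, if f ω = s then p ω else 0

/-- Shannon entropy in nats -/
noncomputable def H {Ω S : Type*} [Fintype Ω] (p : Ω → ℝ) (f : Ω → S) : ℝ :=
  -∑ ω, p ω * Real.log (Pr p f (f ω))

section lib
variable {Ω Ω' Ω'' S S' S'' T : Type*} [Fintype Ω] [Fintype Ω'] [Fintype Ω'']

theorem Pr_def (p : Ω → ℝ) (f : Ω → S) (s : S) :
    Pr p f s = ∑ ω, @ite _ (f ω = s) (Classical.propDecidable _) (p ω) 0 := rfl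

theorem Pr_nn {p : Ω → ℝ} (hp : ∀ ω, 0 ≤ p ω) (f : Ω → S) (s : S) : 0 ≤ Pr p f s := by
  unfold Pr
  exact Finset.sum_nonneg fun ω _ => by split_ifs; exacts [hp ω, le_rfl]

theorem le_Pr {p : Ω → ℝ} (hp : ∀ ω, 0 ≤ p ω) (f : Ω → S) (ω : Ω) : p ω ≤ Pr p f (f ω) := by
  unfold Pr
  have := Finset.single_le_sum (f := fun ω' => if f ω' = f ω then p ω' else 0)
    (fun ω' _ => by split_ifs; exacts [hp ω', le_rfl]) (Finset.mem_univ ω)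
  simpa using this

theorem Pr_pos {p : Ω → ℝ} (hp : ∀ ω, 0 ≤ p ω) (f : Ω → S) {ω : Ω} (h : p ω ≠ 0) :
    0 < Pr p f (f ω) :=
  lt_of_lt_of_le (lt_of_le_of_ne (hp ω) (Ne.symm h)) (le_Pr hp f ω)

theorem Pr_le_one {p : Ω → ℝ} (hp : IsP p) (f : Ω → S) (s : S) : Pr p f s ≤ 1 := by
  unfold Pr
  rw [← hp.sum]
  exact Finset.sum_le_sum fun ω _ => by split_ifs; exacts [le_rfl, hp.nn ω]

theorem Pr_mono {p : Ω → ℝ} (hp : ∀ ω, 0 ≤ p ω) (f : Ω → S) (g : Ω → S') (s : S) (t : S')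
    (h : ∀ ω, p ω ≠ 0 → f ω = s → g ω = t) : Pr p f s ≤ Pr p g t := by
  unfold Pr
  refine Finset.sum_le_sum fun ω _ => ?_
  by_cases h0 : p ω = 0
  · simp [h0]
  · by_cases h1 : f ω = s
    · simp [h1, h ω h0 h1]
    · simp only [h1, if_false]; split_ifs; exacts [hp ω, le_rfl]

theorem H_nonneg {p : Ω → ℝ} (hp : IsP p) (f : Ω → S) : 0 ≤ H p f := by
  unfold H
  rw [neg_nonneg]
  refine Finset.sum_nonpos fun ω _ => mul_nonpos_of_nonneg_of_nonpos (hp.nn ω) ?_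
  exact Real.log_nonpos (Pr_nn hp.nn f _) (Pr_le_one hp f _)

theorem gibbs_sum {p : Ω → ℝ} (hp : ∀ ω, 0 ≤ p ω) (f : Ω → S) {q : Ω' → ℝ}
    (hq : ∀ ω, 0 ≤ q ω) (g : Ω' → S) :
    ∑ ω, p ω * (Pr q g (f ω) / Pr p f (f ω)) ≤ ∑ ω', q ω' := by
  have e : ∀ ω, p ω * (Pr q g (f ω) / Pr p f (f ω)) =
      ∑ ω', q ω' * (if f ω = g ω' then p ω / Pr p f (g ω') else 0) := by
    intro ω
    unfold Pr
    rw [Finset.sum_div, Finset.mul_sum]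
    refine Finset.sum_congr rfl fun ω' _ => ?_
    by_cases h : f ω = g ω'
    · simp [h]; ring
    · have h' : ¬ g ω' = f ω := fun h2 => h h2.symm
      simp [h, h']
  rw [Finset.sum_congr rfl fun ω _ => e ω, Finset.sum_comm]
  refine Finset.sum_le_sum fun ω' _ => ?_
  rw [← Finset.mul_sum]
  have : ∑ ω, (if f ω = g ω' then p ω / Pr p f (g ω') else 0) = Pr p f (g ω') / Pr p f (g ω') := by
    conv_rhs => rw [Pr, Finset.sum_div]
    refine Finset.sum_congr rfl fun ω _ => ?_
    split_ifs <;> simp [Pr]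
  rw [this]
  exact mul_le_of_le_one_right (hq ω') (div_self_le_one _)

/-- Gibbs inequality -/
theorem gibbs {p : Ω → ℝ} (hp : IsP p) (f : Ω → S) {q : Ω' → ℝ}
    (hq : ∀ ω, 0 ≤ q ω) (hq1 : ∑ ω, q ω ≤ 1) (g : Ω' → S)
    (hpos : ∀ ω, p ω ≠ 0 → 0 < Pr q g (f ω)) :
    H p f ≤ -∑ ω, p ω * Real.log (Pr q g (f ω)) := by
  unfold H
  rw [neg_le_neg_iff]
  have h1 := gibbs_sum hp.nn f hq g
  have h2 : ∑ ω, p ω * Real.log (Pr q g (f ω)) - ∑ ω, p ω * Real.log (Pr p f (f ω)) ≤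
      ∑ ω, p ω * (Pr q g (f ω) / Pr p f (f ω)) - ∑ ω, p ω := by
    rw [← Finset.sum_sub_distrib, ← Finset.sum_sub_distrib]
    refine Finset.sum_le_sum fun ω _ => ?_
    by_cases h0 : p ω = 0
    · simp [h0]
    · have a := hpos ω h0
      have b := Pr_pos hp.nn f h0
      have := Real.log_le_sub_one_of_pos (div_pos a b)
      rw [Real.log_div a.ne' b.ne'] at this
      nlinarith [hp.nn ω]
  have := hp.sum
  linarith

theorem H_le_of_imp {p : Ω → ℝ} (hp : IsP p) (f : Ω → S) (g : Ω → S')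
    (h : ∀ ω ω', p ω ≠ 0 → p ω' ≠ 0 → g ω = g ω' → f ω = f ω') : H p f ≤ H p g := by
  unfold H
  rw [neg_le_neg_iff]
  refine Finset.sum_le_sum fun ω _ => ?_
  by_cases h0 : p ω = 0
  · simp [h0]
  · refine mul_le_mul_of_nonneg_left ?_ (hp.nn ω)
    refine Real.log_le_log (Pr_pos hp.nn g h0) ?_
    exact Pr_mono hp.nn _ _ _ _ fun ω' h1 h2 => h ω' ω h1 h0 h2

theorem H_eq_of_iff {p : Ω → ℝ} (hp : IsP p) (f : Ω → S) (g : Ω → S')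
    (h : ∀ ω ω', p ω ≠ 0 → p ω' ≠ 0 → (f ω = f ω' ↔ g ω = g ω')) : H p f = H p g :=
  le_antisymm (H_le_of_imp hp f g fun a b ha hb hab => (h a b ha hb).2 hab)
    (H_le_of_imp hp g f fun a b ha hb hab => (h a b ha hb).1 hab)

/-- fibre bound -/
theorem H_fiber {p : Ω → ℝ} (hp : IsP p) (f : Ω → S) (g : Ω → S') (K : ℝ) (hK : 0 < K)
    (h : ∀ ω0, p ω0 ≠ 0 → ∃ T : Finset S, (T.card : ℝ) ≤ K ∧
      ∀ ω, p ω ≠ 0 → g ω = g ω0 → f ω ∈ T) :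
    H p (fun ω => (f ω, g ω)) ≤ H p g + Real.log K := by
  have key : ∑ ω, p ω * (Pr p g (g ω) / Pr p (fun ω => (f ω, g ω)) (f ω, g ω)) ≤ K := by
    have e : ∀ ω, p ω * (Pr p g (g ω) / Pr p (fun ω => (f ω, g ω)) (f ω, g ω)) =
        ∑ ω', p ω' * (if g ω = g ω' then p ω / Pr p (fun ω => (f ω, g ω)) (f ω, g ω') else 0) := by
      intro ω
      conv_lhs => rw [show Pr p g (g ω) = ∑ ω', if g ω' = g ω then p ω' else 0 from rfl]
      rw [Finset.sum_div, Finset.mul_sum]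
      refine Finset.sum_congr rfl fun ω' _ => ?_
      by_cases h : g ω = g ω'
      · simp [h]; ring
      · have h' : ¬ g ω' = g ω := fun h2 => h h2.symm
        simp [h, h']
    rw [Finset.sum_congr rfl fun ω _ => e ω, Finset.sum_comm]
    have : ∀ ω' ∈ Finset.univ, ∑ ω, p ω' * (if g ω = g ω' then p ω / Pr p (fun ω => (f ω, g ω)) (f ω, g ω') else 0) ≤ p ω' * K := by
      intro ω' _
      by_cases h0 : p ω' = 0
      · simp [h0]
      rw [← Finset.mul_sum]
      refine mul_le_mul_of_nonneg_left ?_ (hp.nn ω')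
      obtain ⟨T, hT, hT2⟩ := h ω' h0
      refine le_trans ?_ hT
      calc ∑ ω, (if g ω = g ω' then p ω / Pr p (fun ω => (f ω, g ω)) (f ω, g ω') else 0)
          ≤ ∑ ω, ∑ t ∈ T, (if (f ω, g ω) = (t, g ω') then p ω / Pr p (fun ω => (f ω, g ω)) (t, g ω') else 0) := by
            refine Finset.sum_le_sum fun ω _ => ?_
            have nn : ∀ t ∈ T, 0 ≤ (if (f ω, g ω) = (t, g ω') then p ω / Pr p (fun ω => (f ω, g ω)) (t, g ω') else 0) := by
              intro t _
              split_ifs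
              · exact div_nonneg (hp.nn ω) (Pr_nn hp.nn _ _)
              · exact le_rfl
            by_cases h1 : g ω = g ω'
            · by_cases h2 : p ω = 0
              · simp [h2]
              · have := Finset.single_le_sum nn (hT2 ω h2 h1)
                refine le_trans (le_of_eq ?_) this
                simp [h1]
            · simp only [h1, if_false]
              exact Finset.sum_nonneg nn
        _ = ∑ t ∈ T, Pr p (fun ω => (f ω, g ω)) (t, g ω') / Pr p (fun ω => (f ω, g ω)) (t, g ω') := by
            rw [Finset.sum_comm]
            refine Finset.sum_congr rfl fun t _ => ?_
            conv_rhs => rw [Pr, Finset.sum_div]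
            refine Finset.sum_congr rfl fun ω _ => ?_
            split_ifs <;> simp [Pr]
        _ ≤ ∑ t ∈ T, (1:ℝ) := Finset.sum_le_sum fun t _ => div_self_le_one _
        _ = T.card := by simp
    refine (Finset.sum_le_sum this).trans ?_
    rw [← Finset.sum_mul, hp.sum, one_mul]
  unfold H
  have h2 : ∑ ω, p ω * Real.log (Pr p g (g ω)) - ∑ ω, p ω * Real.log (Pr p (fun ω => (f ω, g ω)) (f ω, g ω)) ≤
      ∑ ω, p ω * (Pr p g (g ω) / Pr p (fun ω => (f ω, g ω)) (f ω, g ω)) / K - ∑ ω, p ω + ∑ ω, p ω * Real.log K := by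
    rw [← Finset.sum_sub_distrib, ← Finset.sum_sub_distrib, ← Finset.sum_add_distrib]
    refine Finset.sum_le_sum fun ω _ => ?_
    by_cases h0 : p ω = 0
    · simp [h0]
    · have a := Pr_pos hp.nn g h0
      have b := Pr_pos hp.nn (fun ω => (f ω, g ω)) h0
      have := Real.log_le_sub_one_of_pos (div_pos (div_pos a b) hK)
      rw [Real.log_div (div_pos a b).ne' hK.ne', Real.log_div a.ne' b.ne'] at this
      have := mul_le_mul_of_nonneg_left this (hp.nn ω)
      rw [mul_div_assoc]
      linarith
  rw [← Finset.sum_div, ← Finset.sum_mul, hp.sum] at h2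
  have h3 : (∑ ω, p ω * (Pr p g (g ω) / Pr p (fun ω => (f ω, g ω)) (f ω, g ω))) / K ≤ 1 := by
    rw [div_le_one hK]; exact key
  linarith

theorem H_fiber' {p : Ω → ℝ} (hp : IsP p) (f : Ω → S) (g : Ω → S') (K : ℝ) (hK : 0 < K)
    (h : ∀ ω0, p ω0 ≠ 0 → ∃ T : Finset S, (T.card : ℝ) ≤ K ∧
      ∀ ω, p ω ≠ 0 → g ω = g ω0 → f ω ∈ T) :
    H p f ≤ H p g + Real.log K :=
  (H_le_of_imp hp f (fun ω => (f ω, g ω)) (by intro a b _ _ h; simp at h; exact h.1)).trans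
    (H_fiber hp f g K hK h)

/-- integer-valued version -/
theorem H_near {p : Ω → ℝ} (hp : IsP p) (f : Ω → ℤ) (g : Ω → S') (k : ℕ)
    (h : ∀ ω ω', p ω ≠ 0 → p ω' ≠ 0 → g ω = g ω' → |f ω - f ω'| ≤ k) :
    H p (fun ω => (f ω, g ω)) ≤ H p g + Real.log (2 * k + 1) := by
  refine H_fiber hp f g _ (by positivity) fun ω0 h0 => ⟨Finset.Icc (f ω0 - k) (f ω0 + k), ?_, ?_⟩
  · rw [Int.card_Icc]
    have : (f ω0 + k + 1 - (f ω0 - k)).toNat = 2 * k + 1 := by omega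
    rw [this]; push_cast; exact le_rfl
  · intro ω h1 h2
    have := abs_le.1 (h ω ω0 h1 h0 h2)
    rw [Finset.mem_Icc]; omega

theorem H_near' {p : Ω → ℝ} (hp : IsP p) (f : Ω → ℤ) (g : Ω → S') (k : ℕ)
    (h : ∀ ω ω', p ω ≠ 0 → p ω' ≠ 0 → g ω = g ω' → |f ω - f ω'| ≤ k) :
    H p f ≤ H p g + Real.log (2 * k + 1) :=
  (H_le_of_imp hp f (fun ω => (f ω, g ω)) (by intro a b _ _ h; simp at h; exact h.1)).trans
    (H_near hp f g k h)

theorem H_lower {p : Ω → ℝ} (hp : IsP p) (f : Ω → S) (M : ℝ)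
    (h : ∀ s, Pr p f s ≤ Real.exp (-M)) : M ≤ H p f := by
  unfold H
  have : ∑ ω, p ω * Real.log (Pr p f (f ω)) ≤ ∑ ω, p ω * (-M) := by
    refine Finset.sum_le_sum fun ω _ => ?_
    by_cases h0 : p ω = 0
    · simp [h0]
    · refine mul_le_mul_of_nonneg_left ?_ (hp.nn ω)
      have := Real.log_le_log (Pr_pos hp.nn f h0) (h _)
      rwa [Real.log_exp] at this
  rw [← Finset.sum_mul, hp.sum] at this
  linarith

/-- measure preserving maps -/
def MP (p : Ω → ℝ) (pr : Ω → Ω') (p' : Ω' → ℝ) : Prop :=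
  ∀ φ : Ω' → ℝ, ∑ ω, p ω * φ (pr ω) = ∑ ω', p' ω' * φ ω'

theorem MP.Pr_eq {p : Ω → ℝ} {pr : Ω → Ω'} {p' : Ω' → ℝ} (h : MP p pr p') (f : Ω' → S) (s : S) :
    Pr p (fun ω => f (pr ω)) s = Pr p' f s := by
  have := h fun ω' => if f ω' = s then 1 else 0
  simpa [Pr] using this

theorem MP.H_eq {p : Ω → ℝ} {pr : Ω → Ω'} {p' : Ω' → ℝ} (h : MP p pr p') (f : Ω' → S) :
    H p (fun ω => f (pr ω)) = H p' f := by
  unfold H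
  rw [← h fun ω' => Real.log (Pr p' f (f ω'))]
  congr 1
  refine Finset.sum_congr rfl fun ω _ => ?_
  rw [h.Pr_eq]

/-- product law -/
def prd (p : Ω → ℝ) (q : Ω' → ℝ) : Ω × Ω' → ℝ := fun w => p w.1 * q w.2

theorem prd_isP {p : Ω → ℝ} {q : Ω' → ℝ} (hp : IsP p) (hq : IsP q) : IsP (prd p q) := by
  refine ⟨fun w => mul_nonneg (hp.nn _) (hq.nn _), ?_⟩
  unfold prd
  rw [Fintype.sum_prod_type]
  simp only [← Finset.mul_sum, hq.sum, mul_one, hp.sum]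

theorem MP_fst {p : Ω → ℝ} {q : Ω' → ℝ} (hq : IsP q) : MP (prd p q) Prod.fst p := by
  intro φ
  unfold prd
  rw [Fintype.sum_prod_type]
  refine Finset.sum_congr rfl fun a _ => ?_
  simp only
  rw [← Finset.sum_mul, ← Finset.mul_sum, hq.sum, mul_one]

theorem MP_snd {p : Ω → ℝ} {q : Ω' → ℝ} (hp : IsP p) : MP (prd p q) Prod.snd q := by
  intro φ
  unfold prd
  rw [Fintype.sum_prod_type, Finset.sum_comm]
  refine Finset.sum_congr rfl fun a _ => ?_
  simp only
  rw [← Finset.sum_mul, ← Finset.sum_mul, hp.sum, one_mul]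

theorem MP_swap {p : Ω → ℝ} {q : Ω' → ℝ} : MP (prd p q) Prod.swap (prd q p) := by
  intro φ
  unfold prd
  rw [Fintype.sum_prod_type, Finset.sum_comm, Fintype.sum_prod_type]
  refine Finset.sum_congr rfl fun a _ => Finset.sum_congr rfl fun b _ => ?_
  simp only [Prod.swap_prod_mk]; ring

theorem MP_id {p : Ω → ℝ} : MP p (fun ω => ω) p := fun _ => rfl

theorem MP.comp {p : Ω → ℝ} {pr : Ω → Ω'} {p' : Ω' → ℝ} {σ : Ω' → Ω''} {p'' : Ω'' → ℝ}
    (h : MP p pr p') (h' : MP p' σ p'') : MP p (fun ω => σ (pr ω)) p'' := by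
  intro φ
  rw [← h' φ, ← h fun ω' => φ (σ ω')]

theorem MP.prd {Ξ Ξ' : Type*} [Fintype Ξ] [Fintype Ξ'] {p : Ω → ℝ} {pr : Ω → Ω'} {p' : Ω' → ℝ}
    {q : Ξ → ℝ} {σ : Ξ → Ξ'} {q' : Ξ' → ℝ} (h : MP p pr p') (h' : MP q σ q') :
    MP (prd p q) (fun w => (pr w.1, σ w.2)) (prd p' q') := by
  intro φ
  unfold CF.prd
  rw [Fintype.sum_prod_type, Fintype.sum_prod_type]
  simp only [mul_assoc, ← Finset.mul_sum]
  rw [h fun a => ∑ ξ, q ξ * φ (a, σ ξ)]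
  refine Finset.sum_congr rfl fun a _ => ?_
  rw [h' fun b => φ (a, b)]

/-- two factors, with a common function of the first one as a parameter -/
theorem H_prd_cond {p : Ω → ℝ} {q : Ω' → ℝ} (hp : IsP p) (hq : IsP q) (e : Ω → S')
    (h : S' → Ω' → S) :
    H (prd p q) (fun w => (h (e w.1) w.2, e w.1)) = H p e + ∑ ω, p ω * H q (h (e ω)) := by
  have e1 : ∀ w : Ω × Ω', Pr (prd p q) (fun w => (h (e w.1) w.2, e w.1)) (h (e w.1) w.2, e w.1) =
      Pr p e (e w.1) * Pr q (h (e w.1)) (h (e w.1) w.2) := by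
    intro w
    unfold Pr prd
    rw [Fintype.sum_prod_type, Finset.sum_mul_sum]
    refine Finset.sum_congr rfl fun a _ => Finset.sum_congr rfl fun b _ => ?_
    by_cases h1 : e a = e w.1
    · simp [h1]
    · simp [h1]
  unfold H
  simp only [mul_neg, Finset.sum_neg_distrib]
  rw [← neg_add, neg_inj]
  rw [← (MP_fst hq (p := p)) (fun a => Real.log (Pr p e (e a)))]
  have e2 : ∑ ω, p ω * ∑ ω', q ω' * Real.log (Pr q (h (e ω)) (h (e ω) ω')) =
      ∑ w, prd p q w * Real.log (Pr q (h (e w.1)) (h (e w.1) w.2)) := by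
    unfold prd
    rw [Fintype.sum_prod_type]
    refine Finset.sum_congr rfl fun a _ => ?_
    rw [Finset.mul_sum]
    exact Finset.sum_congr rfl fun b _ => by ring
  rw [e2, ← Finset.sum_add_distrib]
  refine Finset.sum_congr rfl fun w _ => ?_
  rw [e1]
  by_cases h0 : prd p q w = 0
  · simp [h0]
  · have ha : p w.1 ≠ 0 := fun h => h0 (by simp [prd, h])
    have hb : q w.2 ≠ 0 := fun h => h0 (by simp [prd, h])
    rw [Real.log_mul (Pr_pos hp.nn e ha).ne' (Pr_pos hq.nn _ hb).ne', mul_add]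

theorem H_prd {p : Ω → ℝ} {q : Ω' → ℝ} (hp : IsP p) (hq : IsP q) (f : Ω → S) (g : Ω' → S') :
    H (prd p q) (fun w => (f w.1, g w.2)) = H p f + H q g := by
  have := H_prd_cond hp hq f (fun _ => g)
  rw [← Finset.sum_mul, hp.sum, one_mul] at this
  rw [← this]
  refine H_eq_of_iff (prd_isP hp hq) _ _ fun a b _ _ => ?_
  simp only [Prod.mk.injEq]; tauto

/-- conditionally independent copies -/
noncomputable def cop (p : Ω → ℝ) (c : Ω → S) : Ω × Ω → ℝ := fun w =>
  if c w.1 = c w.2 then p w.1 * p w.2 / Pr p c (c w.1) else 0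

theorem cop_nn {p : Ω → ℝ} (hp : IsP p) (c : Ω → S) (w) : 0 ≤ cop p c w := by
  unfold cop
  split_ifs
  · exact div_nonneg (mul_nonneg (hp.nn _) (hp.nn _)) (Pr_nn hp.nn _ _)
  · exact le_rfl

theorem cop_ne {p : Ω → ℝ} {c : Ω → S} {w} (h : cop p c w ≠ 0) :
    c w.1 = c w.2 ∧ p w.1 ≠ 0 ∧ p w.2 ≠ 0 := by
  unfold cop at h
  split_ifs at h with h1
  · refine ⟨h1, ?_, ?_⟩ <;> intro h2 <;> simp [h2] at h
  · simp at h

theorem cop_swap (p : Ω → ℝ) (c : Ω → S) (a b) : cop p c (a, b) = cop p c (b, a) := by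
  unfold cop
  by_cases h : c a = c b
  · simp [h]; ring
  · have : ¬ c b = c a := fun h' => h h'.symm
    simp [h, this]

theorem MP_cop_fst {p : Ω → ℝ} (hp : IsP p) (c : Ω → S) : MP (cop p c) Prod.fst p := by
  intro φ
  rw [Fintype.sum_prod_type]
  refine Finset.sum_congr rfl fun a _ => ?_
  simp only
  rw [← Finset.sum_mul]
  congr 1
  have : ∀ b, cop p c (a, b) = p a / Pr p c (c a) * (if c b = c a then p b else 0) := by
    intro b
    unfold cop
    by_cases h : c a = c b
    · simp [h]; ring
    · have : ¬ c b = c a := fun h' => h h'.symm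
      simp [h, this]
  simp only [this]
  rw [← Finset.mul_sum]
  change p a / Pr p c (c a) * Pr p c (c a) = p a
  by_cases h0 : p a = 0
  · simp [h0]
  · exact div_mul_cancel₀ _ (Pr_pos hp.nn c h0).ne'

theorem MP_cop_snd {p : Ω → ℝ} (hp : IsP p) (c : Ω → S) : MP (cop p c) Prod.snd p := by
  intro φ
  rw [← MP_cop_fst hp c φ, Fintype.sum_prod_type, Fintype.sum_prod_type, Finset.sum_comm]
  refine Finset.sum_congr rfl fun a _ => Finset.sum_congr rfl fun b _ => ?_
  rw [cop_swap]

theorem cop_isP {p : Ω → ℝ} (hp : IsP p) (c : Ω → S) : IsP (cop p c) := by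
  refine ⟨cop_nn hp c, ?_⟩
  have := MP_cop_fst hp c (fun _ => 1)
  simp only [mul_one] at this
  rw [this, hp.sum]

theorem Pr_cop (p : Ω → ℝ) (A : Ω → S) (B : Ω → S') (c : Ω → S'') (a b d) :
    Pr (cop p c) (fun w => (A w.1, B w.2, c w.1)) (a, b, d) =
      Pr p (fun ω => (A ω, c ω)) (a, d) * Pr p (fun ω => (B ω, c ω)) (b, d) / Pr p c d := by
  conv_lhs => unfold Pr cop
  rw [Pr_def p (fun ω => (A ω, c ω)) (a, d), Pr_def p (fun ω => (B ω, c ω)) (b, d)]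
  rw [Finset.sum_mul_sum, Fintype.sum_prod_type, Finset.sum_div]
  refine Finset.sum_congr rfl fun x _ => ?_
  rw [Finset.sum_div]
  refine Finset.sum_congr rfl fun y _ => ?_
  simp only [Prod.mk.injEq]
  by_cases h1 : A x = a <;> by_cases h2 : c x = d <;> by_cases h3 : B y = b <;>
    by_cases h4 : c y = d <;> simp [h1, h2, h3, h4]
  intro h; exact absurd h.symm h4

theorem H_submod {p : Ω → ℝ} (hp : IsP p) (A : Ω → S) (B : Ω → S') (c : Ω → S'') :
    H p (fun ω => (A ω, B ω, c ω)) + H p c ≤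
      H p (fun ω => (A ω, c ω)) + H p (fun ω => (B ω, c ω)) := by
  have hc := cop_isP hp c
  have pos : ∀ ω, p ω ≠ 0 → 0 < Pr p (fun ω => (A ω, c ω)) (A ω, c ω) ∧
      0 < Pr p (fun ω => (B ω, c ω)) (B ω, c ω) ∧ 0 < Pr p c (c ω) := fun ω h =>
    ⟨Pr_pos hp.nn (fun ω => (A ω, c ω)) h, Pr_pos hp.nn (fun ω => (B ω, c ω)) h, Pr_pos hp.nn c h⟩
  have := gibbs hp (fun ω => (A ω, B ω, c ω)) hc.nn hc.sum.le (fun w => (A w.1, B w.2, c w.1))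
    (fun ω h => by
      rw [Pr_cop]; obtain ⟨h1, h2, h3⟩ := pos ω h; positivity)
  refine le_trans (add_le_add_left this _) (le_of_eq ?_)
  unfold H
  rw [← neg_add, ← neg_add, neg_inj, ← Finset.sum_add_distrib, ← Finset.sum_add_distrib]
  refine Finset.sum_congr rfl fun ω _ => ?_
  by_cases h0 : p ω = 0
  · simp [h0]
  · obtain ⟨h1, h2, h3⟩ := pos ω h0
    rw [Pr_cop, Real.log_div (mul_pos h1 h2).ne' h3.ne', Real.log_mul h1.ne' h2.ne']
    ring

theorem H_cop {p : Ω → ℝ} (hp : IsP p) (A : Ω → S) (B : Ω → S') (c : Ω → S'') :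
    H (cop p c) (fun w => (A w.1, B w.2, c w.1)) =
      H p (fun ω => (A ω, c ω)) + H p (fun ω => (B ω, c ω)) - H p c := by
  have pos : ∀ ω, p ω ≠ 0 → 0 < Pr p (fun ω => (A ω, c ω)) (A ω, c ω) ∧
      0 < Pr p (fun ω => (B ω, c ω)) (B ω, c ω) ∧ 0 < Pr p c (c ω) := fun ω h =>
    ⟨Pr_pos hp.nn (fun ω => (A ω, c ω)) h, Pr_pos hp.nn (fun ω => (B ω, c ω)) h, Pr_pos hp.nn c h⟩
  unfold H
  rw [← MP_cop_fst hp c (fun ω => Real.log (Pr p (fun ω => (A ω, c ω)) (A ω, c ω))),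
    ← MP_cop_snd hp c (fun ω => Real.log (Pr p (fun ω => (B ω, c ω)) (B ω, c ω))),
    ← MP_cop_fst hp c (fun ω => Real.log (Pr p c (c ω)))]
  rw [← neg_add, ← neg_sub', neg_inj, ← Finset.sum_add_distrib, ← Finset.sum_sub_distrib]
  refine Finset.sum_congr rfl fun w _ => ?_
  by_cases h0 : cop p c w = 0
  · simp [h0]
  · obtain ⟨e, ha, hb⟩ := cop_ne h0
    obtain ⟨h1, h2, h3⟩ := pos _ ha
    obtain ⟨h4, h5, h6⟩ := pos _ hb
    rw [Pr_cop]
    rw [← e] at h5 ⊢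
    rw [Real.log_div (mul_pos h1 h5).ne' h3.ne', Real.log_mul h1.ne' h5.ne']
    ring

theorem H_sub {p : Ω → ℝ} (hp : IsP p) (A : Ω → S) (B : Ω → S') :
    H p (fun ω => (A ω, B ω)) ≤ H p A + H p B := by
  have := H_submod hp A B (fun _ => ())
  have e0 : 0 ≤ H p (fun _ => ()) := H_nonneg hp _
  have e1 : H p (fun ω => (A ω, B ω, ())) = H p (fun ω => (A ω, B ω)) :=
    H_eq_of_iff hp _ _ (by simp)
  have e2 : H p (fun ω => (A ω, ())) = H p A := H_eq_of_iff hp _ _ (by simp)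
  have e3 : H p (fun ω => (B ω, ())) = H p B := H_eq_of_iff hp _ _ (by simp)
  rw [e1, e2, e3] at this
  linarith

/-- main submodularity tool: `R` is `K`-determined by `F`, determined by `G`. -/
theorem H_SM {p : Ω → ℝ} (hp : IsP p) (R : Ω → T) (F : Ω → S) (G : Ω → S') (L : ℝ)
    (hF : H p (fun ω => (R ω, F ω)) ≤ H p F + L)
    (hG : ∀ ω ω', p ω ≠ 0 → p ω' ≠ 0 → G ω = G ω' → R ω = R ω') :
    H p R + H p (fun ω => (F ω, G ω)) ≤ H p F + H p G + L := by
  have h1 := H_submod hp F G R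
  have h2 : H p (fun ω => (F ω, G ω)) ≤ H p (fun ω => (F ω, G ω, R ω)) :=
    H_le_of_imp hp _ _ (by intro a b _ _ h; simp only [Prod.mk.injEq] at h ⊢; tauto)
  have h3 : H p (fun ω => (F ω, R ω)) ≤ H p (fun ω => (R ω, F ω)) :=
    H_le_of_imp hp _ _ (by intro a b _ _ h; simp only [Prod.mk.injEq] at h ⊢; tauto)
  have h4 : H p (fun ω => (G ω, R ω)) ≤ H p G :=
    H_le_of_imp hp _ _ (by intro a b ha hb h; simp only [Prod.mk.injEq]; exact ⟨h, hG a b ha hb h⟩)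
  linarith

/-- mixtures -/
theorem H_mix {ι : Type*} [Fintype ι] {p : Ω → ℝ} (hp : IsP p) (f : Ω → S) (w : ι → ℝ)
    (hw : ∀ i, 0 ≤ w i) (q : ι → Ω → ℝ) (hq : ∀ i, w i ≠ 0 → IsP (q i))
    (h : ∀ ω, ∑ i, w i * q i ω ≤ p ω) :
    ∑ i, w i * H (q i) f ≤ H p f := by
  have nnq : ∀ i ω, 0 ≤ w i * q i ω := fun i ω => by
    by_cases h0 : w i = 0
    · simp [h0]
    · exact mul_nonneg (hw i) ((hq i h0).nn ω)
  have h1 : ∀ i, w i * H (q i) f ≤ w i * -∑ ω, q i ω * Real.log (Pr p f (f ω)) := by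
    intro i
    by_cases h0 : w i = 0
    · simp [h0]
    · refine mul_le_mul_of_nonneg_left ?_ (hw i)
      refine gibbs (hq i h0) f hp.nn hp.sum.le f fun ω hω => Pr_pos hp.nn f ?_
      intro h2
      have := h ω
      rw [h2] at this
      have h3 := Finset.single_le_sum (fun i _ => nnq i ω) (Finset.mem_univ i)
      have : w i * q i ω ≤ 0 := h3.trans this
      have : 0 < w i * q i ω := mul_pos (lt_of_le_of_ne (hw i) (Ne.symm h0))
        (lt_of_le_of_ne ((hq i h0).nn ω) (Ne.symm hω))
      linarith
  refine (Finset.sum_le_sum fun i _ => h1 i).trans ?_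
  unfold H
  simp only [mul_neg, Finset.sum_neg_distrib, neg_le_neg_iff, Finset.mul_sum]
  rw [Finset.sum_comm]
  refine Finset.sum_le_sum fun ω _ => ?_
  have : ∑ i, w i * (q i ω * Real.log (Pr p f (f ω))) = (∑ i, w i * q i ω) * Real.log (Pr p f (f ω)) := by
    rw [Finset.sum_mul]; exact Finset.sum_congr rfl fun i _ => by ring
  rw [this]
  exact mul_le_mul_of_nonpos_right (h ω) (Real.log_nonpos (Pr_nn hp.nn f _) (Pr_le_one hp f _))

theorem H_restrict {p q : Ω → ℝ} (hp : IsP p) (hq : IsP q) (f : Ω → S) (w : ℝ) (hw : 0 ≤ w)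
    (h : ∀ ω, w * q ω ≤ p ω) : w * H q f ≤ H p f := by
  have := H_mix hp f (fun _ : Unit => w) (fun _ => hw) (fun _ => q) (fun _ _ => hq) (by simpa using h)
  simpa using this

theorem exists_le_avg {p : Ω → ℝ} (hp : IsP p) (f : Ω → ℝ) (M : ℝ) (h : ∑ ω, p ω * f ω ≤ M) :
    ∃ ω, p ω ≠ 0 ∧ f ω ≤ M := by
  by_contra hcon
  push Not at hcon
  have h1 : ∃ ω, p ω ≠ 0 := by
    by_contra h2
    push Not at h2
    have := hp.sum
    simp [h2] at this
  obtain ⟨ω0, h0⟩ := h1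
  have : ∑ ω, p ω * M < ∑ ω, p ω * f ω := by
    refine Finset.sum_lt_sum (fun ω _ => ?_) ⟨ω0, Finset.mem_univ _, ?_⟩
    · by_cases h2 : p ω = 0
      · simp [h2]
      · exact mul_le_mul_of_nonneg_left (hcon ω h2).le (hp.nn ω)
    · exact mul_lt_mul_of_pos_left (hcon ω0 h0) (lt_of_le_of_ne (hp.nn _) (Ne.symm h0))
  rw [← Finset.sum_mul, hp.sum, one_mul] at this
  linarith

end lib
end CF

namespace CF
open Classical Finset

/-- entropy of the integer part -/
noncomputable def Hf {Ω : Type*} [Fintype Ω] (p : Ω → ℝ) (f : Ω → ℝ) : ℝ :=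
  H p (fun ω => ⌊f ω⌋)

section tools
variable {Ω Ω' Ω'' S S' S'' T : Type*} [Fintype Ω] [Fintype Ω'] [Fintype Ω'']

theorem H_SM' {p : Ω → ℝ} (hp : IsP p) (R : Ω → T) (F : Ω → S) (G : Ω → S') (L L' : ℝ)
    (hF : H p (fun ω => (R ω, F ω)) ≤ H p F + L)
    (hG : H p (fun ω => (R ω, G ω)) ≤ H p G + L') :
    H p R + H p (fun ω => (F ω, G ω)) ≤ H p F + H p G + L + L' := by
  have h1 := H_submod hp F G R
  have h2 : H p (fun ω => (F ω, G ω)) ≤ H p (fun ω => (F ω, G ω, R ω)) :=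
    H_le_of_imp hp _ _ (by intro a b _ _ h; simp only [Prod.mk.injEq] at h ⊢; tauto)
  have h3 : H p (fun ω => (F ω, R ω)) ≤ H p (fun ω => (R ω, F ω)) :=
    H_le_of_imp hp _ _ (by intro a b _ _ h; simp only [Prod.mk.injEq] at h ⊢; tauto)
  have h4 : H p (fun ω => (G ω, R ω)) ≤ H p (fun ω => (R ω, G ω)) :=
    H_le_of_imp hp _ _ (by intro a b _ _ h; simp only [Prod.mk.injEq] at h ⊢; tauto)
  linarith

theorem floor_near {a b : ℝ} {k : ℕ} (h : |a - b| ≤ k) : |⌊a⌋ - ⌊b⌋| ≤ (k : ℤ) + 1 := by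
  rw [abs_le] at h ⊢
  have h1 := Int.floor_le a
  have h2 := Int.lt_floor_add_one a
  have h3 := Int.floor_le b
  have h4 := Int.lt_floor_add_one b
  constructor
  · have : (-((k:ℤ) + 1) : ℤ) < ⌊a⌋ - ⌊b⌋ + 1 := by
      have : ((-((k:ℤ) + 1) : ℤ) : ℝ) < ((⌊a⌋ - ⌊b⌋ + 1 : ℤ) : ℝ) := by push_cast; linarith
      exact_mod_cast this
    omega
  · have : ⌊a⌋ - ⌊b⌋ < (k:ℤ) + 1 + 1 := by
      have : ((⌊a⌋ - ⌊b⌋ : ℤ) : ℝ) < (((k:ℤ) + 1 + 1 : ℤ) : ℝ) := by push_cast; linarith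
      exact_mod_cast this
    omega

theorem abs_lt_of_floor {a b : ℝ} (h : ⌊a⌋ = ⌊b⌋) : |a - b| < 1 := Int.abs_sub_lt_one_of_floor_eq_floor h

theorem Hf_near_k {p : Ω → ℝ} (hp : IsP p) (f : Ω → ℝ) (g : Ω → S') (k : ℕ)
    (h : ∀ ω ω', p ω ≠ 0 → p ω' ≠ 0 → g ω = g ω' → |f ω - f ω'| ≤ k) :
    H p (fun ω => (⌊f ω⌋, g ω)) ≤ H p g + Real.log (2 * k + 3) := by
  have := H_near hp (fun ω => ⌊f ω⌋) g (k+1) (fun a b ha hb hab => by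
    have := floor_near (h a b ha hb hab); push_cast; exact this)
  push_cast at this
  convert this using 3
  ring

theorem log7 : Real.log 7 ≤ 2 := by
  rw [Real.log_le_iff_le_exp (by norm_num)]
  have := Real.exp_one_gt_d9
  have h2 : Real.exp 2 = Real.exp 1 * Real.exp 1 := by rw [← Real.exp_add]; norm_num
  rw [h2]; nlinarith

theorem Hf_near {p : Ω → ℝ} (hp : IsP p) (f : Ω → ℝ) (g : Ω → S')
    (h : ∀ ω ω', p ω ≠ 0 → p ω' ≠ 0 → g ω = g ω' → |f ω - f ω'| ≤ 2) :
    H p (fun ω => (⌊f ω⌋, g ω)) ≤ H p g + 2 := by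
  have := Hf_near_k hp f g 2 (by exact_mod_cast h)
  have h7 := log7
  norm_num at this
  linarith

theorem Hf_near' {p : Ω → ℝ} (hp : IsP p) (f : Ω → ℝ) (g : Ω → S')
    (h : ∀ ω ω', p ω ≠ 0 → p ω' ≠ 0 → g ω = g ω' → |f ω - f ω'| ≤ 2) :
    Hf p f ≤ H p g + 2 :=
  (H_le_of_imp hp _ (fun ω => (⌊f ω⌋, g ω)) (by intro a b _ _ h; simp at h; exact h.1)).trans
    (Hf_near hp f g h)

theorem H_pair_le_l {p : Ω → ℝ} (hp : IsP p) (f : Ω → S) (g : Ω → S') :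
    H p f ≤ H p (fun ω => (f ω, g ω)) :=
  H_le_of_imp hp _ _ (by intro a b _ _ h; simp at h; exact h.1)

theorem H_pair_le_r {p : Ω → ℝ} (hp : IsP p) (f : Ω → S) (g : Ω → S') :
    H p g ≤ H p (fun ω => (f ω, g ω)) :=
  H_le_of_imp hp _ _ (by intro a b _ _ h; simp at h; exact h.2)

/-- Kaimanovich and Vershik with rounding -/
theorem KV {p : Ω → ℝ} {q : Ω' → ℝ} {r : Ω'' → ℝ} (hp : IsP p) (hq : IsP q) (hr : IsP r)
    (X : Ω → ℝ) (Y : Ω' → ℝ) (W : Ω'' → ℝ) :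
    Hf (prd p (prd q r)) (fun w => X w.1 + Y w.2.1 + W w.2.2) + Hf p X ≤
      Hf (prd p q) (fun w => X w.1 + Y w.2) + Hf (prd p r) (fun w => X w.1 + W w.2) + 6 := by
  have hqr := prd_isP hq hr
  have hP := prd_isP hp hqr
  have := H_SM' hP (fun w => ⌊X w.1 + Y w.2.1 + W w.2.2⌋)
    (fun w => (⌊X w.1 + Y w.2.1⌋, W w.2.2)) (fun w => (⌊X w.1 + W w.2.2⌋, Y w.2.1)) 2 2
    (Hf_near hP _ _ (by
      intro a b _ _ h
      simp only [Prod.mk.injEq] at h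
      have := abs_lt_of_floor h.1
      rw [show X a.1 + Y a.2.1 + W a.2.2 - (X b.1 + Y b.2.1 + W b.2.2) =
        X a.1 + Y a.2.1 - (X b.1 + Y b.2.1) by rw [h.2]; ring]
      linarith))
    (Hf_near hP _ _ (by
      intro a b _ _ h
      simp only [Prod.mk.injEq] at h
      have := abs_lt_of_floor h.1
      rw [show X a.1 + Y a.2.1 + W a.2.2 - (X b.1 + Y b.2.1 + W b.2.2) =
        X a.1 + W a.2.2 - (X b.1 + W b.2.2) by rw [h.2]; ring]
      linarith))
  -- bounds
  have e1 : H (prd p (prd q r)) (fun w => (⌊X w.1 + Y w.2.1⌋, W w.2.2)) ≤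
      Hf (prd p q) (fun w => X w.1 + Y w.2) + H r W := by
    refine (H_sub hP _ _).trans (le_of_eq ?_)
    have a1 := (MP.prd (MP_id (p := p)) (MP_fst hr (p := q))).H_eq (fun w => ⌊X w.1 + Y w.2⌋)
    have a2 := ((MP_snd hp (q := prd q r)).comp (MP_snd hq (q := r))).H_eq W
    exact congrArg₂ (· + ·) a1 a2
  have e2 : H (prd p (prd q r)) (fun w => (⌊X w.1 + W w.2.2⌋, Y w.2.1)) ≤
      Hf (prd p r) (fun w => X w.1 + W w.2) + H q Y := by
    refine (H_sub hP _ _).trans (le_of_eq ?_)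
    have a1 := (MP.prd (MP_id (p := p)) (MP_snd hq (q := r))).H_eq (fun w => ⌊X w.1 + W w.2⌋)
    have a2 := ((MP_snd hp (q := prd q r)).comp (MP_fst hr (p := q))).H_eq Y
    exact congrArg₂ (· + ·) a1 a2
  have e3 : H (prd p (prd q r)) (fun w => (⌊X w.1⌋, (Y w.2.1, W w.2.2))) =
      Hf p X + (H q Y + H r W) := by
    rw [← H_prd hq hr Y W]
    exact H_prd hp hqr (fun a => ⌊X a⌋) (fun b => (Y b.1, W b.2))
  have e4 : H (prd p (prd q r)) (fun w => (⌊X w.1⌋, (Y w.2.1, W w.2.2))) ≤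
      H (prd p (prd q r)) (fun w => ((⌊X w.1 + Y w.2.1⌋, W w.2.2), (⌊X w.1 + W w.2.2⌋, Y w.2.1))) + 2 := by
    refine le_trans ?_ (Hf_near hP (fun w => X w.1) _ ?_)
    · refine H_le_of_imp hP _ _ ?_
      intro a b _ _ h; simp only [Prod.mk.injEq] at h ⊢; tauto
    · intro a b _ _ h
      simp only [Prod.mk.injEq] at h
      have := abs_lt_of_floor h.1.1
      rw [show X a.1 + Y a.2.1 - (X b.1 + Y b.2.1) = X a.1 - X b.1 by rw [h.2.2]; ring] at this
      linarith
  unfold Hf at *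
  linarith

theorem Hf_ge {p : Ω → ℝ} {q : Ω' → ℝ} (hp : IsP p) (hq : IsP q) (X : Ω → ℝ) (Y : Ω' → ℝ) :
    Hf p X ≤ Hf (prd p q) (fun w => X w.1 + Y w.2) + 2 := by
  have hP := prd_isP hp hq
  have h1 := H_prd hp hq (fun a => ⌊X a⌋) Y
  have h2 := H_sub hP (fun w => ⌊X w.1 + Y w.2⌋) (fun w => Y w.2)
  have h3 := (MP_snd hp (q := q)).H_eq Y
  have h4 : H (prd p q) (fun w => (⌊X w.1⌋, Y w.2)) ≤ H (prd p q) (fun w => (⌊X w.1 + Y w.2⌋, Y w.2)) + 2 := by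
    refine le_trans ?_ (Hf_near hP (fun w => X w.1) _ ?_)
    · refine H_le_of_imp hP _ _ ?_
      intro a b _ _ h; simp only [Prod.mk.injEq] at h ⊢; tauto
    · intro a b _ _ h
      simp only [Prod.mk.injEq] at h
      have := abs_lt_of_floor h.1
      rw [show X a.1 + Y a.2 - (X b.1 + Y b.2) = X a.1 - X b.1 by rw [h.2]; ring] at this
      linarith
  unfold Hf at *
  linarith

/-- exact version -/
theorem H_ge_l {p : Ω → ℝ} {q : Ω' → ℝ} (hp : IsP p) (hq : IsP q) (X : Ω → ℝ) (Y : Ω' → ℝ) :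
    H p X ≤ H (prd p q) (fun w => X w.1 + Y w.2) := by
  have hP := prd_isP hp hq
  have h1 := H_prd hp hq X Y
  have h2 := H_sub hP (fun w => X w.1 + Y w.2) (fun w => Y w.2)
  have h3 := (MP_snd hp (q := q)).H_eq Y
  have h4 : H (prd p q) (fun w => (X w.1, Y w.2)) ≤ H (prd p q) (fun w => (X w.1 + Y w.2, Y w.2)) := by
    refine H_le_of_imp hP _ _ ?_
    intro a b _ _ h; simp only [Prod.mk.injEq] at h ⊢
    refine ⟨?_, h.2⟩; linarith [h.1, h.2]
  linarith

theorem MP_swap12 {p : Ω → ℝ} {q : Ω' → ℝ} {r : Ω'' → ℝ} :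
    MP (prd p (prd q r)) (fun w => (w.2.1, (w.1, w.2.2))) (prd q (prd p r)) := by
  intro φ
  unfold prd
  simp only [Fintype.sum_prod_type]
  rw [Finset.sum_comm]
  refine Finset.sum_congr rfl fun a _ => Finset.sum_congr rfl fun b _ =>
    Finset.sum_congr rfl fun c _ => by ring

/-- stabilizer additivity -/
theorem Stab {p : Ω → ℝ} {q : Ω' → ℝ} (hp : IsP p) (hq : IsP q) (Z : Ω → ℝ) (U : Ω' → ℝ) (c d : ℝ) :
    Hf (prd p q) (fun w => Z w.1 + (c + d) * U w.2) + Hf p Z + H q U ≤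
      Hf (prd p q) (fun w => Z w.1 + c * U w.2) + Hf (prd p q) (fun w => Z w.1 + d * U w.2)
       + H (prd q q) (fun w => U w.1 - U w.2) + 8 := by
  have hqq := prd_isP hq hq
  have hP := prd_isP hp hqq
  have kv := KV hp hq hq Z (fun b => c * U b) (fun b => d * U b)
  have := H_SM' hP (fun w => ⌊Z w.1 + (c + d) * U w.2.1⌋)
    (fun w => (⌊Z w.1 + c * U w.2.1 + d * U w.2.2⌋, U w.2.1 - U w.2.2))
    (fun w => (Z w.1, U w.2.1)) 2 0
    (Hf_near hP _ _ (by
      intro a b _ _ h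
      simp only [Prod.mk.injEq] at h
      have h1 := abs_lt_of_floor h.1
      rw [show Z a.1 + (c + d) * U a.2.1 - (Z b.1 + (c + d) * U b.2.1) =
        (Z a.1 + c * U a.2.1 + d * U a.2.2 - (Z b.1 + c * U b.2.1 + d * U b.2.2))
         + d * ((U a.2.1 - U a.2.2) - (U b.2.1 - U b.2.2)) by ring, h.2]
      simp only [sub_self, mul_zero, add_zero]
      linarith))
    (by
      rw [add_zero]
      refine H_le_of_imp hP _ _ ?_
      intro a b _ _ h
      simp only [Prod.mk.injEq] at h ⊢
      rw [h.1, h.2]; simp)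
  have e1 : H (prd p (prd q q)) (fun w => (⌊Z w.1 + c * U w.2.1 + d * U w.2.2⌋, U w.2.1 - U w.2.2)) ≤
      Hf (prd p (prd q q)) (fun w => Z w.1 + c * U w.2.1 + d * U w.2.2) + H (prd q q) (fun w => U w.1 - U w.2) := by
    refine (H_sub hP _ _).trans (le_of_eq ?_)
    have a2 := (MP_snd hp (q := prd q q)).H_eq (fun w => U w.1 - U w.2)
    exact congrArg₂ (· + ·) rfl a2
  have e2 : H (prd p (prd q q)) (fun w => (Z w.1, U w.2.1)) = H p Z + H q U := by
    rw [← H_prd hp hq]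
    exact (MP.prd (MP_id (p := p)) (MP_fst hq (p := q))).H_eq (fun w => (Z w.1, U w.2))
  have e3 : H (prd p (prd q q)) (fun w => (Z w.1, (U w.2.1, U w.2.2))) = H p Z + (H q U + H q U) := by
    rw [← H_prd hq hq U U]
    exact H_prd hp hqq Z (fun b => (U b.1, U b.2))
  have e4 : H (prd p (prd q q)) (fun w => (Z w.1, (U w.2.1, U w.2.2))) ≤
      H (prd p (prd q q)) (fun w => ((⌊Z w.1 + c * U w.2.1 + d * U w.2.2⌋, U w.2.1 - U w.2.2), (Z w.1, U w.2.1))) := by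
    refine H_le_of_imp hP _ _ ?_
    intro a b _ _ h
    simp only [Prod.mk.injEq] at h ⊢
    refine ⟨h.2.1, h.2.2, ?_⟩
    linarith [h.1.2, h.2.2]
  have e5 : H (prd p (prd q q)) (fun w => ⌊Z w.1 + (c + d) * U w.2.1⌋) =
      Hf (prd p q) (fun w => Z w.1 + (c + d) * U w.2) :=
    (MP.prd (MP_id (p := p)) (MP_fst hq (p := q))).H_eq (fun w => ⌊Z w.1 + (c + d) * U w.2⌋)
  linarith

/-- multi-scale lower bound -/
theorem Hf_scale {p : Ω → ℝ} {q : Ω' → ℝ} (hp : IsP p) (hq : IsP q) (Z : Ω → ℝ) (V : Ω' → ℝ)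
    (B : ℝ) (hB : 1 ≤ B) (hV : ∀ b, q b ≠ 0 → |V b| ≤ B) :
    Hf p (fun a => Z a / B) + Hf q V ≤ Hf (prd p q) (fun w => Z w.1 + V w.2) + 5 := by
  have hP := prd_isP hp hq
  have h1 := H_submod hP (fun w => ⌊Z w.1 + V w.2⌋) (fun w => Z w.1) (fun w => ⌊Z w.1 / B⌋)
  have e1 : H (prd p q) (fun w => ⌊Z w.1 / B⌋) = Hf p (fun a => Z a / B) :=
    (MP_fst hq (p := p)).H_eq (fun a => ⌊Z a / B⌋)
  have e2 : H (prd p q) (fun w => (Z w.1, ⌊Z w.1 / B⌋)) ≤ H p Z := by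
    rw [← (MP_fst hq (p := p)).H_eq Z]
    refine H_le_of_imp hP _ _ ?_
    intro a b _ _ h
    simp only [Prod.mk.injEq]
    rw [h]; simp
  have e3 : H (prd p q) (fun w => (Z w.1, ⌊V w.2⌋)) = H p Z + Hf q V := H_prd hp hq Z (fun b => ⌊V b⌋)
  have e4 : H (prd p q) (fun w => (Z w.1, ⌊V w.2⌋)) ≤
      H (prd p q) (fun w => (⌊Z w.1 + V w.2⌋, Z w.1, ⌊Z w.1 / B⌋)) + 2 := by
    refine le_trans ?_ (Hf_near hP (fun w => V w.2) _ ?_)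
    · refine H_le_of_imp hP _ _ ?_
      intro a b _ _ h; simp only [Prod.mk.injEq] at h ⊢; tauto
    · intro a b _ _ h
      simp only [Prod.mk.injEq] at h
      have := abs_lt_of_floor h.1
      rw [show Z a.1 + V a.2 - (Z b.1 + V b.2) = V a.2 - V b.2 by rw [h.2.1]; ring] at this
      linarith
  have e5 : H (prd p q) (fun w => (⌊Z w.1 + V w.2⌋, ⌊Z w.1 / B⌋)) ≤
      H (prd p q) (fun w => ⌊Z w.1 + V w.2⌋) + Real.log 9 := by
    have := Hf_near_k hP (fun w => Z w.1 / B) (fun w => ⌊Z w.1 + V w.2⌋) 3 (by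
      intro a b ha hb h
      have h1 := (abs_lt_of_floor h).le
      have ha2 : q a.2 ≠ 0 := fun h => ha (by simp [prd, h])
      have hb2 : q b.2 ≠ 0 := fun h => hb (by simp [prd, h])
      have h2 := hV _ ha2
      have h3 := hV _ hb2
      rw [← sub_div, abs_div, abs_of_pos (by linarith : 0 < B), div_le_iff₀ (by linarith)]
      rw [abs_le] at *
      push_cast
      constructor <;> linarith)
    norm_num at this
    refine le_trans ?_ this
    refine H_le_of_imp hP _ _ ?_
    intro a b _ _ h; simp only [Prod.mk.injEq] at h ⊢; tauto
  have h9 : Real.log 9 ≤ 3 := by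
    have : Real.log 9 = Real.log 3 + Real.log 3 := by
      rw [← Real.log_mul (by norm_num) (by norm_num)]; norm_num
    have h3 : Real.log 3 ≤ 1.5 := by
      rw [Real.log_le_iff_le_exp (by norm_num)]
      have := Real.quadratic_le_exp_of_nonneg (by norm_num : (0:ℝ) ≤ 1.5)
      norm_num at this ⊢; linarith
    linarith
  unfold Hf at *
  linarith

/-- collision probability -/
theorem collision {p : Ω → ℝ} (hp : IsP p) (f : Ω → S) (M : ℝ) (h : H p f ≤ M) :
    Real.exp (-M) ≤ ∑ w, if f w.1 = f w.2 then prd p p w else 0 := by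
  have e : ∑ w : Ω × Ω, (if f w.1 = f w.2 then prd p p w else 0) = ∑ ω, p ω * Pr p f (f ω) := by
    rw [Fintype.sum_prod_type]
    refine Finset.sum_congr rfl fun a _ => ?_
    rw [Pr_def, Finset.mul_sum]
    refine Finset.sum_congr rfl fun b _ => ?_
    by_cases h : f a = f b
    · simp [h, prd]
    · have h' : ¬ f b = f a := fun h2 => h h2.symm
      simp [h, h']
  rw [e]
  set A := ∑ ω, p ω * Pr p f (f ω) with hA
  have hApos : 0 < A := by
    obtain ⟨ω, h0, -⟩ := exists_le_avg hp (fun _ => 0) 0 (by simp)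
    refine lt_of_lt_of_le ?_ (Finset.single_le_sum (f := fun ω => p ω * Pr p f (f ω))
      (fun ω _ => mul_nonneg (hp.nn ω) (Pr_nn hp.nn f _)) (Finset.mem_univ ω))
    exact mul_pos (lt_of_le_of_ne (hp.nn ω) (Ne.symm h0)) (Pr_pos hp.nn f h0)
  have key : ∑ ω, p ω * Real.log (Pr p f (f ω)) ≤ ∑ ω, (p ω * (Real.log A - 1) + p ω * Pr p f (f ω) / A) := by
    refine Finset.sum_le_sum fun ω _ => ?_
    by_cases h0 : p ω = 0
    · simp [h0]
    · have b := Pr_pos hp.nn f h0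
      have := Real.log_le_sub_one_of_pos (div_pos b hApos)
      rw [Real.log_div b.ne' hApos.ne'] at this
      have := mul_le_mul_of_nonneg_left this (hp.nn ω)
      rw [mul_div_assoc]
      linarith
  rw [Finset.sum_add_distrib, ← Finset.sum_mul, hp.sum, ← Finset.sum_div, ← hA, div_self hApos.ne'] at key
  unfold H at h
  rw [← Real.le_log_iff_exp_le hApos]
  linarith

/-- doubling argument for the set of slopes -/
theorem slopes {Q : Type*} [Fintype Q] (m : Q → ℝ) (hm : ∀ q, 0 ≤ m q) (hm1 : ∑ q, m q ≤ 1)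
    (T : Q → ℝ) (η β : ℝ) (hη : 0 < η) (hη4 : η ≤ 1/4) (hβ : 0 < β)
    (q0 : Q) (hq0 : m q0 ≠ 0) (hT0 : T q0 = 0)
    (hstep : ∀ q, m q ≠ 0 → |T q| ≤ 3 → ∀ b : ℝ, (b = 0 ∨ b = 1) →
      β ≤ ∑ q', if |T q' - (T q + b) / 2| ≤ η then m q' else 0) : β ≤ 8 * η := by
  have bin : ∀ y : ℝ, 0 ≤ y → y ≤ 1 → ∃ b y' : ℝ, (b = 0 ∨ b = 1) ∧ 0 ≤ y' ∧ y' ≤ 1 ∧ y = (y' + b) / 2 := by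
    intro y h0 h1
    by_cases h : y ≤ 1/2
    · exact ⟨0, 2 * y, Or.inl rfl, by linarith, by linarith, by ring⟩
    · exact ⟨1, 2 * y - 1, Or.inr rfl, by linarith, by linarith, by ring⟩
  have ind : ∀ j : ℕ, ∀ y : ℝ, 0 ≤ y → y ≤ 1 → ∃ q, m q ≠ 0 ∧ |T q - y| ≤ (1/2)^j + 2 * η := by
    intro j
    induction j with
    | zero =>
      intro y h0 h1
      refine ⟨q0, hq0, ?_⟩
      rw [hT0, abs_le]; norm_num; constructor <;> linarith
    | succ j ih =>
      intro y h0 h1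
      obtain ⟨b, y', hb, h0', h1', rfl⟩ := bin y h0 h1
      obtain ⟨q, hq, hqy⟩ := ih y' h0' h1'
      have hp1 : (1/2:ℝ)^j ≤ 1 := pow_le_one₀ (by norm_num) (by norm_num)
      have hT3 : |T q| ≤ 3 := by
        rw [abs_le] at hqy ⊢; constructor <;> linarith [hqy.1, hqy.2]
      have hs := hstep q hq hT3 b hb
      obtain ⟨q', hq'⟩ : ∃ q', (if |T q' - (T q + b) / 2| ≤ η then m q' else 0) ≠ 0 := by
        by_contra hcon
        push Not at hcon
        rw [Finset.sum_eq_zero (fun q' _ => hcon q')] at hs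
        linarith
      split_ifs at hq' with h5
      · refine ⟨q', hq', ?_⟩
        rw [abs_le] at hqy h5 ⊢
        rw [pow_succ]
        constructor <;> linarith [hqy.1, hqy.2, h5.1, h5.2]
      · simp at hq'
  have dense : ∀ y : ℝ, 0 ≤ y → y ≤ 1 → β ≤ ∑ q', if |T q' - y| ≤ 3 * η then m q' else 0 := by
    intro y h0 h1
    obtain ⟨b, y', hb, h0', h1', rfl⟩ := bin y h0 h1
    obtain ⟨j, hj⟩ := exists_pow_lt_of_lt_one hη (by norm_num : (1/2:ℝ) < 1)
    obtain ⟨q, hq, hqy⟩ := ind j y' h0' h1'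
    have hT3 : |T q| ≤ 3 := by
        rw [abs_le] at hqy ⊢; constructor <;> linarith [hqy.1, hqy.2]
    refine (hstep q hq hT3 b hb).trans (Finset.sum_le_sum fun q' _ => ?_)
    by_cases h5 : |T q' - (T q + b) / 2| ≤ η
    · have : |T q' - (y' + b) / 2| ≤ 3 * η := by
        rw [abs_le] at hqy h5 ⊢
        constructor <;> linarith [hqy.1, hqy.2, h5.1, h5.2]
      simp [h5, this]
    · simp only [h5, if_false]; split_ifs; exacts [hm q', le_rfl]
  set K := ⌊1 / (8 * η)⌋₊ with hK
  have hKle : (K : ℝ) ≤ 1 / (8 * η) := Nat.floor_le (by positivity)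
  have hKlt : 1 / (8 * η) < K + 1 := Nat.lt_floor_add_one _
  have h1 : ((K : ℝ) + 1) * β ≤ 1 := by
    calc ((K : ℝ) + 1) * β = ∑ k ∈ Finset.range (K+1), β := by simp
      _ ≤ ∑ k ∈ Finset.range (K+1), ∑ q', if |T q' - 8 * η * k| ≤ 3 * η then m q' else 0 := by
          refine Finset.sum_le_sum fun k hk => dense _ (by positivity) ?_
          have : (k : ℝ) ≤ K := by
            have := Finset.mem_range.1 hk
            exact_mod_cast Nat.lt_succ_iff.1 this
          have : (k : ℝ) ≤ 1 / (8 * η) := this.trans hKle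
          rw [le_div_iff₀ (by positivity)] at this
          linarith
      _ = ∑ q', ∑ k ∈ Finset.range (K+1), if |T q' - 8 * η * k| ≤ 3 * η then m q' else 0 := Finset.sum_comm
      _ ≤ ∑ q', m q' := by
          refine Finset.sum_le_sum fun q' _ => ?_
          by_cases hex : ∃ k ∈ Finset.range (K+1), |T q' - 8 * η * k| ≤ 3 * η
          · obtain ⟨k, hk, hk2⟩ := hex
            rw [Finset.sum_eq_single_of_mem k hk]
            · simp [hk2]
            · intro k' _ hne
              rw [if_neg]
              intro h6
              have hdist : (1:ℝ) ≤ |(k:ℝ) - k'| := by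
                have : (1:ℤ) ≤ |(k:ℤ) - k'| := Int.one_le_abs (by omega)
                exact_mod_cast this
              have : 8 * η * |(k:ℝ) - k'| ≤ 6 * η := by
                rw [← abs_of_pos (by positivity : 0 < 8 * η), ← abs_mul]
                rw [abs_le] at *
                constructor <;> linarith [h6.1, h6.2, hk2.1, hk2.2]
              nlinarith
          · push Not at hex
            rw [Finset.sum_eq_zero]
            · exact hm q'
            · intro k hk
              rw [if_neg (not_le.2 (hex k hk))]
      _ ≤ 1 := hm1
  have h2 : 1 / (8 * η) * β ≤ 1 := le_trans (mul_le_mul_of_nonneg_right hKlt.le hβ.le) h1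
  rw [div_mul_eq_mul_div, div_le_iff₀ (by positivity)] at h2
  linarith

end tools
end CF

namespace CF
open Classical Finset

/-- probability of an event -/
noncomputable def Pb {Ω : Type*} [Fintype Ω] (p : Ω → ℝ) (E : Ω → Prop) : ℝ :=
  ∑ ω, if E ω then p ω else 0

section propD
variable {Ω Ω' Ω'' S S' S'' T : Type*} [Fintype Ω] [Fintype Ω'] [Fintype Ω'']

theorem Pb_nn {p : Ω → ℝ} (hp : ∀ ω, 0 ≤ p ω) (E : Ω → Prop) : 0 ≤ Pb p E := by
  unfold Pb
  exact Finset.sum_nonneg fun ω _ => by split_ifs; exacts [hp ω, le_rfl]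

theorem Pb_mono {p : Ω → ℝ} (hp : ∀ ω, 0 ≤ p ω) (E E' : Ω → Prop)
    (h : ∀ ω, p ω ≠ 0 → E ω → E' ω) : Pb p E ≤ Pb p E' := by
  unfold Pb
  refine Finset.sum_le_sum fun ω _ => ?_
  by_cases h0 : p ω = 0
  · simp [h0]
  · by_cases h1 : E ω
    · simp [h1, h ω h0 h1]
    · simp only [h1, if_false]; split_ifs; exacts [hp ω, le_rfl]

theorem Pb_or {p : Ω → ℝ} (hp : ∀ ω, 0 ≤ p ω) (E E' : Ω → Prop) :
    Pb p (fun ω => E ω ∨ E' ω) ≤ Pb p E + Pb p E' := by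
  unfold Pb
  rw [← Finset.sum_add_distrib]
  refine Finset.sum_le_sum fun ω _ => ?_
  have := hp ω
  by_cases h1 : E ω <;> by_cases h2 : E' ω <;> simp [h1, h2, this]

theorem Pb_compl {p : Ω → ℝ} (hp : IsP p) (E : Ω → Prop) : Pb p E + Pb p (fun ω => ¬ E ω) = 1 := by
  unfold Pb
  rw [← Finset.sum_add_distrib, ← hp.sum]
  refine Finset.sum_congr rfl fun ω _ => ?_
  by_cases h1 : E ω <;> simp [h1]

theorem Pr_eq_Pb (p : Ω → ℝ) (f : Ω → S) (s : S) : Pr p f s = Pb p (fun ω => f ω = s) := rfl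

theorem Pb_prd_le {p : Ω → ℝ} {q : Ω' → ℝ} (hq : IsP q) (E : Ω × Ω' → Prop) (K : ℝ)
    (h : ∀ b, q b ≠ 0 → Pb p (fun a => E (a, b)) ≤ K) : Pb (prd p q) E ≤ K := by
  have : Pb (prd p q) E = ∑ b, q b * Pb p (fun a => E (a, b)) := by
    unfold Pb prd
    rw [Fintype.sum_prod_type, Finset.sum_comm]
    refine Finset.sum_congr rfl fun b _ => ?_
    rw [Finset.mul_sum]
    refine Finset.sum_congr rfl fun a _ => ?_
    by_cases h1 : E (a, b) <;> simp [h1, mul_comm]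
  rw [this]
  calc ∑ b, q b * Pb p (fun a => E (a, b)) ≤ ∑ b, q b * K := by
        refine Finset.sum_le_sum fun b _ => ?_
        by_cases h0 : q b = 0
        · simp [h0]
        · exact mul_le_mul_of_nonneg_left (h b h0) (hq.nn b)
    _ = K := by rw [← Finset.sum_mul, hq.sum, one_mul]

theorem MP_assoc {p : Ω → ℝ} {q : Ω' → ℝ} {r : Ω'' → ℝ} :
    MP (prd (prd p q) r) (fun w => (w.1.1, (w.1.2, w.2))) (prd p (prd q r)) := by
  intro φ
  unfold prd
  simp only [Fintype.sum_prod_type]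
  refine Finset.sum_congr rfl fun a _ => Finset.sum_congr rfl fun b _ =>
    Finset.sum_congr rfl fun c _ => by ring

theorem MP_q1 {p : Ω → ℝ} (hp : IsP p) :
    MP (prd (prd p p) (prd p p)) (fun w => (w.1.1, (w.1.2, w.2.1))) (prd p (prd p p)) := by
  have h1 : MP (prd (prd p p) (prd p p)) (fun w => (w.1, w.2.1)) (prd (prd p p) p) :=
    MP.prd MP_id (MP_fst hp)
  exact h1.comp MP_assoc

theorem MP_q2 {p : Ω → ℝ} (hp : IsP p) :
    MP (prd (prd p p) (prd p p)) (fun w => (w.2.2, w.1.1)) (prd p p) := by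
  have h1 : MP (prd (prd p p) (prd p p)) (fun w => (w.1.1, w.2.2)) (prd p p) :=
    MP.prd (MP_fst hp) (MP_snd hp)
  exact h1.comp MP_swap

/-- basic hypotheses -/
structure DHyp {I : Type*} [Fintype I] (ν : I → ℝ) (u : I → ℝ) (s κ ℓ c : ℝ) : Prop where
  prob : IsP ν
  lo : ∀ i, ν i ≠ 0 → exp (ℓ - κ * ℓ) ≤ |u i|
  hi : ∀ i, ν i ≠ 0 → |u i| ≤ c * exp ℓ
  fr : ∀ z ρ : ℝ, 1 ≤ ρ → Pb ν (fun i => |u i - z| ≤ ρ) ≤ exp (κ * ℓ + s * (log ρ - ℓ))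
  hE : H (prd ν ν) (fun w => u w.1 - u w.2) ≤ (s + κ) * ℓ
  hQ : Hf (prd ν ν) (fun w => (u w.1 ^ 2 - u w.2 ^ 2) / exp ℓ) ≤ (s + κ) * ℓ
  s0 : 0 < s
  s1 : s < 1
  κ0 : 0 < κ
  c1 : 1 ≤ c
  big : 100 + 10 * log (8 * c) ≤ κ * ℓ

variable {I : Type*} [Fintype I] {ν : I → ℝ} {u : I → ℝ} {s κ ℓ c : ℝ}

theorem DHyp.log_nn (h : DHyp ν u s κ ℓ c) : 0 ≤ log (8 * c) := log_nonneg (by linarith [h.c1])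

theorem DHyp.ℓ0 (h : DHyp ν u s κ ℓ c) : 0 < ℓ := by
  have := h.big
  have := h.log_nn
  have := h.κ0
  by_contra hc
  push Not at hc
  nlinarith

/-- the part of the hypotheses needed for lower bounds -/
structure BHyp (ν : I → ℝ) (u : I → ℝ) (s κ ℓ : ℝ) : Prop where
  prob : IsP ν
  lo : ∀ i, ν i ≠ 0 → exp (ℓ - κ * ℓ) ≤ |u i|
  fr : ∀ z ρ : ℝ, 1 ≤ ρ → Pb ν (fun i => |u i - z| ≤ ρ) ≤ exp (κ * ℓ + s * (log ρ - ℓ))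
  s1 : s < 1
  κ0 : 0 < κ
  ℓ0 : 0 < ℓ
  big : 1 ≤ κ * ℓ

theorem DHyp.toB (h : DHyp ν u s κ ℓ c) : BHyp ν u s κ ℓ :=
  ⟨h.prob, h.lo, h.fr, h.s1, h.κ0, h.ℓ0, by linarith [h.big, h.log_nn]⟩

theorem BHyp.sq (h : BHyp ν u s κ ℓ) (w B : ℝ) (hB : 1 ≤ B) :
    Pb ν (fun i => |u i ^ 2 / exp ℓ - w| ≤ B) ≤ exp (3 * κ * ℓ + s * (log B - ℓ)) := by
  have hκ := h.κ0
  have hℓ := h.ℓ0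
  have hκℓ : 0 < κ * ℓ := mul_pos hκ hℓ
  have hη : 0 < exp (κ * ℓ) := exp_pos _
  have hr : 1 ≤ B * exp (κ * ℓ) := by
    have : 1 ≤ exp (κ * ℓ) := one_le_exp hκℓ.le
    nlinarith
  have side : ∀ σ : ℝ, σ = 1 ∨ σ = -1 → Pb ν (fun i => 0 ≤ σ * u i ∧ |u i ^ 2 / exp ℓ - w| ≤ B) ≤
      exp (κ * ℓ + s * (log (B * exp (κ * ℓ)) - ℓ)) := by
    intro σ hσ
    by_cases hex : ∃ i, ν i ≠ 0 ∧ 0 ≤ σ * u i ∧ |u i ^ 2 / exp ℓ - w| ≤ B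
    · obtain ⟨j, hj0, hj1, hj2⟩ := hex
      refine le_trans (Pb_mono h.prob.nn _ _ ?_) (h.fr (u j) _ hr)
      rintro i hi0 ⟨hi1, hi2⟩
      have a1 := h.lo i hi0
      have a2 := h.lo j hj0
      have a3 : |u i ^ 2 / exp ℓ - u j ^ 2 / exp ℓ| ≤ 2 * B := by
        rw [abs_le] at *; constructor <;> linarith [hi2.1, hi2.2, hj2.1, hj2.2]
      have a4 : |u i + u j| = |u i| + |u j| := by
        rcases hσ with rfl | rfl
        · rw [abs_of_nonneg (by linarith), abs_of_nonneg (by linarith), abs_of_nonneg (by linarith)]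
        · rw [abs_of_nonpos (by linarith), abs_of_nonpos (by linarith), abs_of_nonpos (by linarith)]; ring
      rw [← sub_div, abs_div, abs_of_pos (exp_pos ℓ), div_le_iff₀ (exp_pos ℓ),
        show u i ^ 2 - u j ^ 2 = (u i - u j) * (u i + u j) by ring, abs_mul, a4] at a3
      have a5 : |u i - u j| * (2 * exp (ℓ - κ * ℓ)) ≤ 2 * B * exp ℓ :=
        le_trans (mul_le_mul_of_nonneg_left (by linarith) (abs_nonneg _)) a3
      have a6 : exp ℓ = exp (κ * ℓ) * exp (ℓ - κ * ℓ) := by rw [← exp_add]; ring_nf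
      rw [a6] at a5
      have a7 := exp_pos (ℓ - κ * ℓ)
      by_contra hcon
      push Not at hcon
      nlinarith
    · push Not at hex
      have : Pb ν (fun i => 0 ≤ σ * u i ∧ |u i ^ 2 / exp ℓ - w| ≤ B) = 0 := by
        unfold Pb
        refine Finset.sum_eq_zero fun i _ => ?_
        by_cases h0 : ν i = 0
        · simp [h0]
        · rw [if_neg]
          rintro ⟨b1, b2⟩
          exact absurd b2 (not_le.2 (hex i h0 b1))
      rw [this]; exact (exp_pos _).le
  have h1 : Pb ν (fun i => |u i ^ 2 / exp ℓ - w| ≤ B) ≤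
      Pb ν (fun i => (0 ≤ 1 * u i ∧ |u i ^ 2 / exp ℓ - w| ≤ B) ∨ (0 ≤ -1 * u i ∧ |u i ^ 2 / exp ℓ - w| ≤ B)) := by
    refine Pb_mono h.prob.nn _ _ fun i _ hi => ?_
    rcases le_total 0 (u i) with h2 | h2
    · left; exact ⟨by linarith, hi⟩
    · right; exact ⟨by linarith, hi⟩
  refine h1.trans ((Pb_or h.prob.nn _ _).trans ((add_le_add (side 1 (Or.inl rfl)) (side (-1) (Or.inr rfl))).trans ?_))
  rw [log_mul (by linarith) hη.ne', log_exp, ← two_mul]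
  have h2 : (2:ℝ) ≤ exp (κ * ℓ) := by
    have := add_one_le_exp (κ * ℓ)
    have := h.big
    linarith
  calc 2 * exp (κ * ℓ + s * (log B + κ * ℓ - ℓ)) ≤ exp (κ * ℓ) * exp (κ * ℓ + s * (log B + κ * ℓ - ℓ)) :=
        mul_le_mul_of_nonneg_right h2 (exp_pos _).le
    _ = exp (κ * ℓ + (κ * ℓ + s * (log B + κ * ℓ - ℓ))) := by rw [← exp_add]
    _ ≤ _ := by
        rw [exp_le_exp]
        nlinarith [h.s1]

theorem BHyp.Hsq (h : BHyp ν u s κ ℓ) (σ : ℝ) (hσ : σ = 1 ∨ σ = -1) (B : ℝ) (hB : 1 ≤ B) :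
    s * (ℓ - log B) - 3 * κ * ℓ ≤ Hf ν (fun i => σ * (u i ^ 2 / exp ℓ) / B) := by
  refine H_lower h.prob _ _ fun k => ?_
  rw [Pr_eq_Pb]
  refine le_trans (Pb_mono h.prob.nn _ _ ?_) ((h.sq (σ * (B * k)) B hB).trans (le_of_eq ?_))
  · intro i _ hi
    have h1 := Int.floor_le (σ * (u i ^ 2 / exp ℓ) / B)
    have h2 := Int.lt_floor_add_one (σ * (u i ^ 2 / exp ℓ) / B)
    rw [hi] at h1 h2
    have hBp : 0 < B := by linarith
    rw [le_div_iff₀ hBp] at h1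
    rw [div_lt_iff₀ hBp] at h2
    rw [abs_le]
    rcases hσ with rfl | rfl
    · constructor <;> nlinarith
    · constructor <;> nlinarith
  · congr 1; ring

theorem BHyp.hu_lo (h : BHyp ν u s κ ℓ) : (s - κ) * ℓ ≤ H ν u := by
  refine H_lower h.prob _ _ fun k => ?_
  rw [Pr_eq_Pb]
  refine le_trans (Pb_mono h.prob.nn _ _ ?_) ((h.fr k 1 le_rfl).trans (le_of_eq ?_))
  · intro i _ hi; simp [hi]
  · simp; ring

theorem BHyp.hz_lo (h : BHyp ν u s κ ℓ) (σ : ℝ) (hσ : σ = 1 ∨ σ = -1) :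
    (s - 3 * κ) * ℓ ≤ Hf ν (fun i => σ * (u i ^ 2 / exp ℓ)) := by
  have := h.Hsq σ hσ 1 le_rfl
  simp only [log_one, div_one] at this
  linarith

/-- the base variable -/
theorem DHyp.sq (h : DHyp ν u s κ ℓ c) (w B : ℝ) (hB : 1 ≤ B) :
    Pb ν (fun i => |u i ^ 2 / exp ℓ - w| ≤ B) ≤ exp (3 * κ * ℓ + s * (log B - ℓ)) := h.toB.sq w B hB
theorem DHyp.Hsq (h : DHyp ν u s κ ℓ c) (σ : ℝ) (hσ : σ = 1 ∨ σ = -1) (B : ℝ) (hB : 1 ≤ B) :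
    s * (ℓ - log B) - 3 * κ * ℓ ≤ Hf ν (fun i => σ * (u i ^ 2 / exp ℓ) / B) := h.toB.Hsq σ hσ B hB
theorem DHyp.hu_lo (h : DHyp ν u s κ ℓ c) : (s - κ) * ℓ ≤ H ν u := h.toB.hu_lo
theorem DHyp.hz_lo (h : DHyp ν u s κ ℓ c) (σ : ℝ) (hσ : σ = 1 ∨ σ = -1) :
    (s - 3 * κ) * ℓ ≤ Hf ν (fun i => σ * (u i ^ 2 / exp ℓ)) := h.toB.hz_lo σ hσ

noncomputable def Zf (u : I → ℝ) (ℓ : ℝ) (i : I) : ℝ := -1 * (u i ^ 2 / exp ℓ)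

theorem DHyp.hz_hi (h : DHyp ν u s κ ℓ c) : Hf ν (Zf u ℓ) ≤ (s + κ) * ℓ + 2 := by
  have := Hf_ge h.prob h.prob (Zf u ℓ) (fun i => u i ^ 2 / exp ℓ)
  have e : Hf (prd ν ν) (fun w => Zf u ℓ w.1 + u w.2 ^ 2 / exp ℓ) = Hf (prd ν ν) (fun w => (u w.1 ^ 2 - u w.2 ^ 2) / exp ℓ) := by
    have := (MP_swap (p := ν) (q := ν)).H_eq (fun w => ⌊Zf u ℓ w.2 + u w.1 ^ 2 / exp ℓ⌋)
    unfold Hf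
    refine Eq.trans this ?_
    congr 1; funext w; congr 1; unfold Zf; ring
  rw [e] at this
  linarith [h.hQ]

/-- entropy of `Z + c U` -/
noncomputable def gD (ν u : I → ℝ) (ℓ : ℝ) (a : ℝ) : ℝ :=
  Hf (prd ν ν) (fun w => Zf u ℓ w.1 + a * u w.2)

theorem DHyp.g_lo (h : DHyp ν u s κ ℓ c) (a : ℝ) : Hf ν (Zf u ℓ) ≤ gD ν u ℓ a + 2 :=
  Hf_ge h.prob h.prob (Zf u ℓ) (fun i => a * u i)

theorem DHyp.g_add (h : DHyp ν u s κ ℓ c) (a b : ℝ) :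
    gD ν u ℓ (a + b) - Hf ν (Zf u ℓ) ≤ (gD ν u ℓ a - Hf ν (Zf u ℓ)) + (gD ν u ℓ b - Hf ν (Zf u ℓ)) + 3 * κ * ℓ := by
  have h1 := Stab h.prob h.prob (Zf u ℓ) u a b
  have h2 := h.hE
  have h3 := h.hu_lo
  have := h.big
  have := h.log_nn
  unfold gD
  linarith

theorem DHyp.triple (h : DHyp ν u s κ ℓ c) :
    Hf (prd ν (prd ν ν)) (fun w => u w.1 ^ 2 / exp ℓ + Zf u ℓ w.2.1 + Zf u ℓ w.2.2) ≤ (s + 6 * κ) * ℓ := by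
  have h1 := KV h.prob h.prob h.prob (fun i => u i ^ 2 / exp ℓ) (Zf u ℓ) (Zf u ℓ)
  have e : Hf (prd ν ν) (fun w => u w.1 ^ 2 / exp ℓ + Zf u ℓ w.2) = Hf (prd ν ν) (fun w => (u w.1 ^ 2 - u w.2 ^ 2) / exp ℓ) := by
    unfold Hf
    congr 1; funext w; congr 1; unfold Zf; ring
  rw [e] at h1
  have h2 := h.hQ
  have h3 := h.hz_lo 1 (Or.inl rfl)
  simp only [one_mul] at h3
  have := h.big
  have := h.log_nn
  linarith

set_option maxHeartbeats 1000000 in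
theorem DHyp.avg (h : DHyp ν u s κ ℓ c) :
    ∑ w, prd ν ν w * gD ν u ℓ (2 * (u w.1 - u w.2) / exp ℓ) ≤ (s + 11 * κ) * ℓ := by
  have hν := h.prob
  have hνν := prd_isP hν hν
  have hP := prd_isP hνν hνν
  have cond := H_prd_cond hνν hνν (fun w : I × I => u w.1 - u w.2)
    (fun (e : ℝ) (w : I × I) => ⌊Zf u ℓ w.1 + (2 * e / exp ℓ) * u w.2⌋)
  have sm := H_SM' hP (fun w : (I × I) × (I × I) => (⌊Zf u ℓ w.2.1 + (2 * (u w.1.1 - u w.1.2) / exp ℓ) * u w.2.2⌋, u w.1.1 - u w.1.2))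
    (fun w => (⌊u w.1.1 ^ 2 / exp ℓ + Zf u ℓ w.1.2 + Zf u ℓ w.2.1⌋, u w.2.2 - u w.1.1, u w.1.1 - u w.1.2))
    (fun w => (u w.2.1, u w.2.2, u w.1.1 - u w.1.2)) 2 0
    (by
      refine le_trans ?_ (Hf_near hP (fun w => Zf u ℓ w.2.1 + (2 * (u w.1.1 - u w.1.2) / exp ℓ) * u w.2.2) _ ?_)
      · refine H_le_of_imp hP _ _ ?_
        intro a b _ _ h; simp only [Prod.mk.injEq] at h ⊢; tauto
      · intro a b _ _ h
        simp only [Prod.mk.injEq] at h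
        obtain ⟨h1, h2, h3⟩ := h
        have h4 := abs_lt_of_floor h1
        have id : ∀ a : (I × I) × (I × I), Zf u ℓ a.2.1 + (2 * (u a.1.1 - u a.1.2) / exp ℓ) * u a.2.2 =
          (u a.1.1 ^ 2 / exp ℓ + Zf u ℓ a.1.2 + Zf u ℓ a.2.1) +
           (u a.1.1 - u a.1.2) * (2 * (u a.2.2 - u a.1.1) + (u a.1.1 - u a.1.2)) / exp ℓ := by
          intro a; unfold Zf; ring
        rw [id a, id b, h2, h3]
        rw [add_sub_add_right_eq_sub]
        linarith)
    (by
      rw [add_zero]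
      refine H_le_of_imp hP _ _ ?_
      intro a b _ _ h
      simp only [Prod.mk.injEq] at h ⊢
      obtain ⟨h1, h2, h3⟩ := h
      unfold Zf
      rw [h1, h2, h3]; simp)
  have eF : H (prd (prd ν ν) (prd ν ν)) (fun w => (⌊u w.1.1 ^ 2 / exp ℓ + Zf u ℓ w.1.2 + Zf u ℓ w.2.1⌋, u w.2.2 - u w.1.1, u w.1.1 - u w.1.2)) ≤
      (s + 6 * κ) * ℓ + H (prd ν ν) (fun w => u w.1 - u w.2) + H (prd ν ν) (fun w => u w.1 - u w.2) := by
    have f0 := H_sub hP (fun w => ⌊u w.1.1 ^ 2 / exp ℓ + Zf u ℓ w.1.2 + Zf u ℓ w.2.1⌋) (fun w => (u w.2.2 - u w.1.1, u w.1.1 - u w.1.2))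
    have f1 := H_sub hP (fun w => u w.2.2 - u w.1.1) (fun w => u w.1.1 - u w.1.2)
    have f2 : H (prd (prd ν ν) (prd ν ν)) (fun w => ⌊u w.1.1 ^ 2 / exp ℓ + Zf u ℓ w.1.2 + Zf u ℓ w.2.1⌋) =
        Hf (prd ν (prd ν ν)) (fun w => u w.1 ^ 2 / exp ℓ + Zf u ℓ w.2.1 + Zf u ℓ w.2.2) := by
      have := (MP_q1 hν).H_eq
        (fun w => ⌊u w.1 ^ 2 / exp ℓ + Zf u ℓ w.2.1 + Zf u ℓ w.2.2⌋)
      exact this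
    have f3 : H (prd (prd ν ν) (prd ν ν)) (fun w => u w.2.2 - u w.1.1) = H (prd ν ν) (fun w => u w.1 - u w.2) := by
      have := (MP_q2 hν).H_eq (fun w => u w.1 - u w.2)
      exact this
    have f4 : H (prd (prd ν ν) (prd ν ν)) (fun w => u w.1.1 - u w.1.2) = H (prd ν ν) (fun w => u w.1 - u w.2) := by
      have := (MP_fst hνν (p := prd ν ν)).H_eq (fun w => u w.1 - u w.2)
      exact this
    have := h.triple
    linarith
  have eG : H (prd (prd ν ν) (prd ν ν)) (fun w => (u w.2.1, u w.2.2, u w.1.1 - u w.1.2)) =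
      H ν u + H ν u + H (prd ν ν) (fun w => u w.1 - u w.2) := by
    have g1 := H_prd hνν hνν (fun w => u w.1 - u w.2) (fun w => (u w.1, u w.2))
    have g2 := H_prd hν hν u u
    have g3 : H (prd (prd ν ν) (prd ν ν)) (fun w => (u w.2.1, u w.2.2, u w.1.1 - u w.1.2)) =
       H (prd (prd ν ν) (prd ν ν)) (fun w => (u w.1.1 - u w.1.2, (u w.2.1, u w.2.2))) :=
      H_eq_of_iff hP _ _ (by intro a b _ _; simp only [Prod.mk.injEq]; tauto)
    linarith
  have eFG : H ν u + H ν u + (H ν u + H ν u) ≤ H (prd (prd ν ν) (prd ν ν)) (fun w =>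
      ((⌊u w.1.1 ^ 2 / exp ℓ + Zf u ℓ w.1.2 + Zf u ℓ w.2.1⌋, u w.2.2 - u w.1.1, u w.1.1 - u w.1.2), (u w.2.1, u w.2.2, u w.1.1 - u w.1.2))) := by
    have g1 := H_prd hνν hνν (fun w => (u w.1, u w.2)) (fun w => (u w.1, u w.2))
    have g2 := H_prd hν hν u u
    rw [← g2, ← g1]
    refine H_le_of_imp hP _ _ ?_
    intro a b _ _ h
    simp only [Prod.mk.injEq] at h ⊢
    obtain ⟨⟨-, h2, h3⟩, h4, h5, -⟩ := h
    refine ⟨⟨?_, ?_⟩, h4, h5⟩ <;> linarith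
  have h2 := h.hE
  have h3 := h.hu_lo
  have := h.big
  have := h.log_nn
  change H (prd (prd ν ν) (prd ν ν)) (fun w => (⌊Zf u ℓ w.2.1 + (2 * (u w.1.1 - u w.1.2) / exp ℓ) * u w.2.2⌋, u w.1.1 - u w.1.2))
    = H (prd ν ν) (fun w => u w.1 - u w.2) + ∑ w, prd ν ν w * gD ν u ℓ (2 * (u w.1 - u w.2) / exp ℓ) at cond
  linarith

end propD
end CF

namespace CF
open Classical Finset

section propD2
variable {Ω Ω' : Type*} [Fintype Ω] [Fintype Ω']

theorem Pb_prd_le' {p : Ω → ℝ} {q : Ω' → ℝ} (hq : ∀ b, 0 ≤ q b) (E : Ω × Ω' → Prop) (N : Ω' → Prop) (K : ℝ)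
    (h : ∀ b, q b ≠ 0 → Pb p (fun a => E (a, b)) ≤ K) :
    Pb (prd p q) (fun w => E w ∧ N w.2) ≤ K * Pb q N := by
  have : Pb (prd p q) (fun w => E w ∧ N w.2) = ∑ b, (if N b then q b else 0) * Pb p (fun a => E (a, b)) := by
    unfold Pb prd
    rw [Fintype.sum_prod_type, Finset.sum_comm]
    refine Finset.sum_congr rfl fun b _ => ?_
    rw [Finset.mul_sum]
    refine Finset.sum_congr rfl fun a _ => ?_
    by_cases h1 : E (a, b) <;> by_cases h2 : N b <;> simp [h1, h2, mul_comm]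
  rw [this]
  unfold Pb
  rw [Finset.mul_sum]
  refine Finset.sum_le_sum fun b _ => ?_
  by_cases h2 : N b
  · simp only [h2, if_true]
    by_cases h0 : q b = 0
    · simp [h0]
    · rw [mul_comm]
      exact mul_le_mul_of_nonneg_right (h b h0) (hq b)
  · simp [h2]

/-- restriction of a probability vector to an event -/
noncomputable def rst (p : Ω → ℝ) (E : Ω → Prop) : Ω → ℝ := fun ω => if E ω then p ω / Pb p E else 0

theorem rst_isP {p : Ω → ℝ} (hp : IsP p) (E : Ω → Prop) (h : 0 < Pb p E) : IsP (rst p E) := by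
  refine ⟨fun ω => ?_, ?_⟩
  · unfold rst; split_ifs
    · exact div_nonneg (hp.nn ω) h.le
    · exact le_rfl
  · have : ∀ ω, rst p E ω = (if E ω then p ω else 0) / Pb p E := by
      intro ω; unfold rst; split_ifs <;> simp
    simp only [this]
    rw [← Finset.sum_div]
    exact div_self h.ne'

theorem rst_le {p : Ω → ℝ} (hp : IsP p) (E : Ω → Prop) (h : 0 < Pb p E) (ω) : Pb p E * rst p E ω ≤ p ω := by
  unfold rst; split_ifs
  · rw [mul_div_cancel₀ _ h.ne']
  · simpa using hp.nn ω

theorem rst_ne {p : Ω → ℝ} {E : Ω → Prop} {ω} (h : rst p E ω ≠ 0) : E ω ∧ p ω ≠ 0 := by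
  unfold rst at h
  split_ifs at h with h1
  · exact ⟨h1, fun h2 => by simp [h2] at h⟩
  · simp at h

theorem rst_Pb {p : Ω → ℝ} (hp : IsP p) (E : Ω → Prop) (h : 0 < Pb p E) (D : Ω → Prop) :
    Pb (rst p E) D ≤ Pb p D / Pb p E := by
  rw [le_div_iff₀ h]
  unfold Pb
  rw [Finset.sum_mul]
  refine Finset.sum_le_sum fun ω _ => ?_
  have := rst_le hp E h ω
  by_cases h1 : D ω
  · simp only [h1, if_true]; rw [mul_comm]; exact this
  · simp [h1]

theorem markov {p : Ω → ℝ} (hp : IsP p) (f : Ω → ℝ) (hf : ∀ ω, 0 ≤ f ω) (a M : ℝ) (ha : 0 < a)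
    (h : ∑ ω, p ω * f ω ≤ M) : Pb p (fun ω => a < f ω) ≤ M / a := by
  rw [le_div_iff₀ ha]
  refine le_trans ?_ h
  unfold Pb
  rw [Finset.sum_mul]
  refine Finset.sum_le_sum fun ω _ => ?_
  by_cases h1 : a < f ω
  · simp only [h1, if_true]; exact mul_le_mul_of_nonneg_left h1.le (hp.nn ω)
  · simp only [h1, if_false, zero_mul]; exact mul_nonneg (hp.nn ω) (hf ω)

variable {I : Type*} [Fintype I] {ν : I → ℝ} {u : I → ℝ} {s κ ℓ c : ℝ}

/-- good points -/
def Good (ν u : I → ℝ) (ℓ θ : ℝ) (j i : I) : Prop :=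
  gD ν u ℓ (2 * (u i - u j) / exp ℓ) - Hf ν (Zf u ℓ) ≤ θ * ℓ ∧
  gD ν u ℓ (2 * (u j - u i) / exp ℓ) - Hf ν (Zf u ℓ) ≤ θ * ℓ

theorem DHyp.goodset (h : DHyp ν u s κ ℓ c) (θ : ℝ) (hθ : 0 < θ) (hκ : κ = θ ^ 2) :
    ∃ j, Pb ν (fun i => ¬ Good ν u ℓ θ j i) ≤ 29 * θ := by
  have hz : (s - 3 * κ) * ℓ ≤ Hf ν (Zf u ℓ) := h.hz_lo (-1) (Or.inr rfl)
  have av := h.avg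
  have big := h.big
  have lnn := h.log_nn
  have hℓ := h.ℓ0
  set hzv := Hf ν (Zf u ℓ) with hzv_def
  set x : I → I → ℝ := fun a b => gD ν u ℓ (2 * (u a - u b) / exp ℓ) - hzv with hx
  have xlo : ∀ a b, -2 ≤ x a b := fun a b => by
    have := h.g_lo (2 * (u a - u b) / exp ℓ); simp only [hx]; linarith
  have s1 : ∑ b, ν b * ∑ a, ν a * gD ν u ℓ (2 * (u a - u b) / exp ℓ) ≤ (s + 11 * κ) * ℓ := by
    refine le_trans (le_of_eq ?_) av
    rw [Fintype.sum_prod_type, Finset.sum_comm]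
    refine Finset.sum_congr rfl fun b _ => ?_
    rw [Finset.mul_sum]
    refine Finset.sum_congr rfl fun a _ => ?_
    simp only [prd]; ring
  have s2 : ∑ b, ν b * ∑ a, ν a * gD ν u ℓ (2 * (u b - u a) / exp ℓ) ≤ (s + 11 * κ) * ℓ := by
    refine le_trans (le_of_eq ?_) av
    rw [Fintype.sum_prod_type]
    refine Finset.sum_congr rfl fun b _ => ?_
    rw [Finset.mul_sum]
    refine Finset.sum_congr rfl fun a _ => ?_
    simp only [prd]; ring
  have e0 : ∀ b, ∑ a, ν a * (x a b + x b a + 4) =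
      ∑ a, ν a * gD ν u ℓ (2 * (u a - u b) / exp ℓ) + ∑ a, ν a * gD ν u ℓ (2 * (u b - u a) / exp ℓ) + (4 - 2 * hzv) := by
    intro b
    have : (4 - 2 * hzv) = ∑ a, ν a * (4 - 2 * hzv) := by rw [← Finset.sum_mul, h.prob.sum, one_mul]
    rw [this, ← Finset.sum_add_distrib, ← Finset.sum_add_distrib]
    refine Finset.sum_congr rfl fun a _ => ?_
    simp only [hx]; ring
  have s3 : ∑ b, ν b * ∑ a, ν a * (x a b + x b a + 4) ≤ 29 * κ * ℓ := by
    rw [Finset.sum_congr rfl (fun b _ => by rw [e0 b])]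
    have e2 : ∀ (A B : I → ℝ) (K : ℝ), ∑ b, ν b * (A b + B b + K) = ∑ b, ν b * A b + ∑ b, ν b * B b + ∑ b, ν b * K := by
      intro A B K
      simp only [mul_add, Finset.sum_add_distrib]
    rw [e2]
    have e1 : ∑ b, ν b * (4 - 2 * hzv) = 4 - 2 * hzv := by rw [← Finset.sum_mul, h.prob.sum, one_mul]
    linarith
  obtain ⟨j, -, hj⟩ := exists_le_avg h.prob _ _ s3
  refine ⟨j, ?_⟩
  have mk := markov h.prob (fun a => x a j + x j a + 4) (fun a => by linarith [xlo a j, xlo j a]) (θ * ℓ) _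
    (mul_pos hθ hℓ) hj
  refine le_trans (Pb_mono h.prob.nn _ _ ?_) (mk.trans (le_of_eq ?_))
  · intro i _ hi
    by_contra hcon
    push Not at hcon
    refine hi ⟨?_, ?_⟩
    · have := xlo j i
      change x i j ≤ θ * ℓ
      linarith
    · have := xlo i j
      change x j i ≤ θ * ℓ
      linarith
  · rw [hκ]; field_simp

theorem DHyp.pair (h : DHyp ν u s κ ℓ c) (θ : ℝ) (hθ : 0 < θ) (hκ : κ = θ ^ 2) (hθ1 : θ ≤ 1 / 9)
    (j a a' v v' : I) (ha : Good ν u ℓ θ j a) (ha' : Good ν u ℓ θ j a')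
    (hv : Good ν u ℓ θ j v) (hv' : Good ν u ℓ θ j v') (b : ℝ) (hb : b = 0 ∨ b = 1) :
    gD ν u ℓ (4 * (u v' - u v) / exp ℓ) - Hf ν (Zf u ℓ) ≤ 5 * θ * ℓ ∧
    gD ν u ℓ (2 * (u a - u a') / exp ℓ + b * (2 * (u v' - u v) / exp ℓ)) - Hf ν (Zf u ℓ) ≤ 5 * θ * ℓ := by
  have hℓ := h.ℓ0
  have h9 : 9 * κ * ℓ ≤ θ * ℓ := by
    refine mul_le_mul_of_nonneg_right ?_ hℓ.le
    rw [hκ]; nlinarith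
  have hκ0 : 0 < κ * ℓ := mul_pos h.κ0 hℓ
  have two : ∀ i i', Good ν u ℓ θ j i → Good ν u ℓ θ j i' →
      gD ν u ℓ (2 * (u i - u i') / exp ℓ) - Hf ν (Zf u ℓ) ≤ 2 * (θ * ℓ) + 3 * κ * ℓ := by
    intro i i' hi hi'
    have := h.g_add (2 * (u i - u j) / exp ℓ) (2 * (u j - u i') / exp ℓ)
    rw [show 2 * (u i - u j) / exp ℓ + 2 * (u j - u i') / exp ℓ = 2 * (u i - u i') / exp ℓ by ring] at this
    linarith [hi.1, hi'.2]
  have t1 := two v' v hv' hv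
  have t2 := two a a' ha ha'
  have hθℓ : 0 < θ * ℓ := mul_pos hθ hℓ
  constructor
  · have := h.g_add (2 * (u v' - u v) / exp ℓ) (2 * (u v' - u v) / exp ℓ)
    rw [show 2 * (u v' - u v) / exp ℓ + 2 * (u v' - u v) / exp ℓ = 4 * (u v' - u v) / exp ℓ by ring] at this
    linarith
  · rcases hb with rfl | rfl
    · rw [zero_mul, add_zero]; linarith
    · rw [one_mul]
      have := h.g_add (2 * (u a - u a') / exp ℓ) (2 * (u v' - u v) / exp ℓ)
      linarith

theorem DHyp.upper (h : DHyp ν u s κ ℓ c) (θ : ℝ) (hθ : 0 < θ) (hκ : κ = θ ^ 2) (hθ1 : θ ≤ 1 / 9)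
    (d t B : ℝ) (hB : 1 ≤ B) (h1 : gD ν u ℓ d - Hf ν (Zf u ℓ) ≤ 5 * θ * ℓ)
    (h2 : gD ν u ℓ (d * t) - Hf ν (Zf u ℓ) ≤ 5 * θ * ℓ)
    (hV : ∀ i j, ν i ≠ 0 → ν j ≠ 0 → |d * (u i + t * u j)| ≤ B) :
    Hf (prd ν ν) (fun w => d * (u w.1 + t * u w.2)) ≤ s * log B + 11 * θ * ℓ := by
  have hℓ := h.ℓ0
  have h9 : 9 * κ * ℓ ≤ θ * ℓ := by
    refine mul_le_mul_of_nonneg_right ?_ hℓ.le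
    rw [hκ]; nlinarith
  have big := h.big
  have lnn := h.log_nn
  have kv := KV h.prob h.prob h.prob (Zf u ℓ) (fun i => d * u i) (fun i => d * t * u i)
  have sc := Hf_scale h.prob (prd_isP h.prob h.prob) (Zf u ℓ) (fun w => d * (u w.1 + t * u w.2)) B hB
    (by
      intro w hw
      exact hV _ _ (fun h => hw (by simp [prd, h])) (fun h => hw (by simp [prd, h])))
  have lo : s * (ℓ - log B) - 3 * κ * ℓ ≤ Hf ν (fun a => Zf u ℓ a / B) := h.Hsq (-1) (Or.inr rfl) B hB
  have hi := h.hz_hi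
  have e : Hf (prd ν (prd ν ν)) (fun w => Zf u ℓ w.1 + d * u w.2.1 + d * t * u w.2.2) =
      Hf (prd ν (prd ν ν)) (fun w => Zf u ℓ w.1 + d * (u w.2.1 + t * u w.2.2)) := by
    congr 1; funext w; ring
  unfold gD at h1 h2
  linarith

theorem e8_le : (8:ℝ) ≤ exp 1 * exp 1 * exp 1 := by
  have := exp_one_gt_d9
  nlinarith [mul_self_nonneg (exp 1 - 2)]

set_option maxHeartbeats 2000000 in
theorem DHyp.mass (h : DHyp ν u s κ ℓ c) (θ k : ℝ) (hθ : 0 < θ) (hκ : κ = θ ^ 2) (hθ1 : θ ≤ 1 / 2000)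
    (hk : s * k = 100 * θ) (hk0 : 0 < k) (hk1 : k ≤ 1)
    (j : I) (ν' : I → ℝ) (hν' : IsP ν') (w0 : ℝ) (hw0 : 1 - 29 * θ ≤ w0) (hw : ∀ i, w0 * ν' i ≤ ν i)
    (hsupp : ∀ i, ν' i ≠ 0 → Good ν u ℓ θ j i ∧ ν i ≠ 0)
    (hfr : ∀ z ρ : ℝ, 1 ≤ ρ → Pb ν' (fun i => |u i - z| ≤ ρ) ≤ 2 * exp (κ * ℓ + s * (log ρ - ℓ)))
    (a a' v v' : I) (ha : ν' a ≠ 0) (ha' : ν' a' ≠ 0) (hv : ν' v ≠ 0) (hv' : ν' v' ≠ 0)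
    (hvv : exp (ℓ - k * ℓ) ≤ |u v - u v'|) (ht : |(u a - u a') / (u v' - u v)| ≤ 3) (b : ℝ) (hb : b = 0 ∨ b = 1) :
    exp (-((s + 80 * θ) * ℓ)) ≤ Pb (prd (prd ν' ν') (prd ν' ν')) (fun w =>
      exp (ℓ - k * ℓ) ≤ |u w.1.2 - u w.2.2| ∧
      |(u w.1.1 - u w.2.1) / (u w.2.2 - u w.1.2) - ((u a - u a') / (u v' - u v) + b) / 2| ≤ exp (2 * k * ℓ - ℓ)) := by
  have hℓ := h.ℓ0
  have big := h.big
  have lnn := h.log_nn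
  have hs0 := h.s0
  have hs1 := h.s1
  have hc1 := h.c1
  have hθℓ : 0 < θ * ℓ := mul_pos hθ hℓ
  have h9 : 2000 * (κ * ℓ) ≤ θ * ℓ := by
    rw [← mul_assoc]
    refine mul_le_mul_of_nonneg_right ?_ hℓ.le
    rw [hκ]; nlinarith
  have hLp := exp_pos ℓ
  set L := exp ℓ with hL
  set δ := exp (-(k * ℓ)) with hδ
  have hδp : 0 < δ := exp_pos _
  have hδL : exp (ℓ - k * ℓ) = δ * L := by rw [hδ, hL, ← exp_add]; ring_nf
  rw [hδL] at hvv ⊢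
  have hδL1 : 1 ≤ δ * L := by rw [← hδL]; apply one_le_exp; linarith [mul_le_of_le_one_left hℓ.le hk1]
  set d := 4 * (u v' - u v) / L with hd
  set t := ((u a - u a') / (u v' - u v) + b) / 2 with ht_def
  have hne : u v' - u v ≠ 0 := by
    intro h0
    have : |u v - u v'| = 0 := by rw [abs_sub_comm, h0, abs_zero]
    linarith
  have hdabs : |d| = 4 * |u v - u v'| / L := by
    rw [hd, abs_div, abs_mul, abs_of_pos hLp, abs_sub_comm]; norm_num
  have hd_lo : 4 * δ ≤ |d| := by
    rw [hdabs, le_div_iff₀ hLp]; linarith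
  have hdp : 0 < |d| := by linarith
  have hu_v := h.hi v (hsupp v hv).2
  have hu_v' := h.hi v' (hsupp v' hv').2
  have hd_hi : |d| ≤ 8 * c := by
    rw [hdabs, div_le_iff₀ hLp]
    have := abs_sub (u v) (u v')
    linarith
  have ht2 : |t| ≤ 2 := by
    rw [ht_def, abs_le]
    rw [abs_le] at ht
    rcases hb with rfl | rfl <;> constructor <;> linarith [ht.1, ht.2]
  have hpair := h.pair θ hθ hκ (by linarith) j a a' v v' (hsupp a ha).1 (hsupp a' ha').1 (hsupp v hv).1 (hsupp v' hv').1 b hb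
  have hdt : d * t = 2 * (u a - u a') / L + b * (2 * (u v' - u v) / L) := by
    rw [hd, ht_def]; field_simp; ring
  rw [← hdt] at hpair
  set B := 3 * c * |d| * L with hB
  have hB1 : 1 ≤ B := by
    have : 1 ≤ 3 * c := by linarith
    have : δ * L ≤ |d| * L := mul_le_mul_of_nonneg_right (by linarith) hLp.le
    rw [hB, mul_assoc]; exact one_le_mul_of_one_le_of_one_le (by linarith) (hδL1.trans this)
  have up := h.upper θ hθ hκ (by linarith) d t B hB1 hpair.1 hpair.2 (by
    intro i i' hi hi'
    have b1 := h.hi i hi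
    have b2 := h.hi i' hi'
    rw [abs_mul, hB]
    have : |u i + t * u i'| ≤ 3 * c * L := by
      refine (abs_add_le _ _).trans ?_
      rw [abs_mul]
      have : |t| * |u i'| ≤ 2 * (c * L) := mul_le_mul ht2 b2 (abs_nonneg _) (by norm_num)
      linarith
    calc |d| * |u i + t * u i'| ≤ |d| * (3 * c * L) := mul_le_mul_of_nonneg_left this hdp.le
      _ = _ := by ring)
  have hlog3 : log (3 * c) ≤ log (8 * c) := log_le_log (by linarith) (by linarith)
  have hlog3nn : 0 ≤ log (3 * c) := log_nonneg (by linarith)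
  have hlogd : log |d| ≤ log (8 * c) := log_le_log hdp hd_hi
  have hlogB : log B = log (3 * c) + log |d| + ℓ := by
    rw [hB, log_mul (by positivity) hLp.ne', log_mul (by positivity) hdp.ne', hL, log_exp]
  have hlogB0 : 0 ≤ log B := log_nonneg hB1
  -- restriction
  have hνν' := prd_isP hν' hν'
  have res := H_restrict (prd_isP h.prob h.prob) hνν' (fun w => ⌊d * (u w.1 + t * u w.2)⌋) (w0 ^ 2) (by positivity)
    (by
      intro w
      have w0p : 0 ≤ w0 := by linarith
      have := mul_le_mul (hw w.1) (hw w.2) (mul_nonneg w0p (hν'.nn _)) (h.prob.nn _)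
      unfold prd
      calc w0 ^ 2 * (ν' w.1 * ν' w.2) = w0 * ν' w.1 * (w0 * ν' w.2) := by ring
        _ ≤ _ := this)
  have Hnn := H_nonneg hνν' (fun w => ⌊d * (u w.1 + t * u w.2)⌋)
  set Hv := H (prd ν' ν') (fun w => ⌊d * (u w.1 + t * u w.2)⌋) with hHv
  have HM : Hv ≤ s * log B + 77 * θ * ℓ := by
    have A1 : w0 ^ 2 * Hv ≤ s * log B + 11 * θ * ℓ := res.trans up
    have A2 : (1 - 58 * θ) * Hv ≤ w0 ^ 2 * Hv := mul_le_mul_of_nonneg_right (by linarith [pow_le_pow_left₀ (by linarith : 0 ≤ 1 - 29 * θ) hw0 2, sq_nonneg θ]) Hnn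
    have A3 : Hv ≤ (1 + 60 * θ) * ((1 - 58 * θ) * Hv) := by
      have : 1 ≤ (1 + 60 * θ) * (1 - 58 * θ) := by linarith [mul_le_mul_of_nonneg_left hθ1 hθ.le]
      linarith [mul_le_mul_of_nonneg_right this Hnn]
    have A4 : (1 + 60 * θ) * ((1 - 58 * θ) * Hv) ≤ (1 + 60 * θ) * (s * log B + 11 * θ * ℓ) :=
      mul_le_mul_of_nonneg_left (A2.trans A1) (by positivity)
    have A5 : s * log B + 11 * θ * ℓ ≤ 11/10 * ℓ := by
      have q1 : s * log B ≤ log B := mul_le_of_le_one_left hlogB0 hs1.le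
      have q2 : 11 * θ * ℓ ≤ 11/2000 * ℓ := mul_le_mul_of_nonneg_right (by linarith) hℓ.le
      have q3 : κ * ℓ ≤ 1/2000 * ℓ := mul_le_mul_of_nonneg_right (by rw [hκ]; linarith [mul_le_mul_of_nonneg_left hθ1 hθ.le]) hℓ.le
      linarith
    have A6 : 60 * θ * (s * log B + 11 * θ * ℓ) ≤ 60 * θ * (11/10 * ℓ) := mul_le_mul_of_nonneg_left A5 (by positivity)
    linarith
  have col := collision hνν' (fun w : I × I => ⌊d * (u w.1 + t * u w.2)⌋) _ HM
  change exp (-(s * log B + 77 * θ * ℓ)) ≤ Pb (prd (prd ν' ν') (prd ν' ν')) (fun w =>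
    ⌊d * (u w.1.1 + t * u w.1.2)⌋ = ⌊d * (u w.2.1 + t * u w.2.2)⌋) at col
  have hmnn := (prd_isP hνν' hνν').nn
  have split := (Pb_mono hmnn (fun w : (I × I) × (I × I) => ⌊d * (u w.1.1 + t * u w.1.2)⌋ = ⌊d * (u w.2.1 + t * u w.2.2)⌋) (fun w : (I × I) × (I × I) => (|(u w.1.1 - u w.2.1) + t * (u w.1.2 - u w.2.2)| ≤ 8 * c / |d| ∧ |u w.1.2 - u w.2.2| ≤ δ * L) ∨
      (δ * L ≤ |u w.1.2 - u w.2.2| ∧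
      |(u w.1.1 - u w.2.1) / (u w.2.2 - u w.1.2) - t| ≤ exp (2 * k * ℓ - ℓ))) (by
    intro w _ hfl
    have f1 := abs_lt_of_floor hfl
    rw [show d * (u w.1.1 + t * u w.1.2) - d * (u w.2.1 + t * u w.2.2) = d * ((u w.1.1 - u w.2.1) + t * (u w.1.2 - u w.2.2)) by ring,
      abs_mul] at f1
    have f2 : |(u w.1.1 - u w.2.1) + t * (u w.1.2 - u w.2.2)| ≤ 1 / |d| := by
      rw [le_div_iff₀ hdp]; linarith
    rcases le_total (|u w.1.2 - u w.2.2|) (δ * L) with hc | hc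
    · left
      refine ⟨f2.trans ?_, hc⟩
      exact div_le_div_of_nonneg_right (by linarith) hdp.le
    · right
      refine ⟨hc, ?_⟩
      have hne2 : u w.2.2 - u w.1.2 ≠ 0 := by
        intro h0
        rw [abs_sub_comm, h0, abs_zero] at hc
        linarith
      rw [show (u w.1.1 - u w.2.1) / (u w.2.2 - u w.1.2) - t = ((u w.1.1 - u w.2.1) + t * (u w.1.2 - u w.2.2)) / (u w.2.2 - u w.1.2) by
        field_simp; ring, abs_div]
      rw [abs_sub_comm] at hc
      rw [div_le_iff₀ (by linarith)]
      refine f2.trans ?_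
      have e1 : exp (2 * k * ℓ - ℓ) * (δ * L) = exp (k * ℓ) := by
        rw [hδ, hL, ← exp_add, ← exp_add]; congr 1; ring
      calc 1 / |d| ≤ 1 / δ := one_div_le_one_div_of_le hδp (by linarith)
        _ = exp (k * ℓ) := by rw [hδ, exp_neg]; simp
        _ = exp (2 * k * ℓ - ℓ) * (δ * L) := e1.symm
        _ ≤ _ := mul_le_mul_of_nonneg_left hc (exp_pos _).le)).trans (Pb_or hmnn _ _)
  have near : Pb (prd (prd ν' ν') (prd ν' ν')) (fun w => |(u w.1.1 - u w.2.1) + t * (u w.1.2 - u w.2.2)| ≤ 8 * c / |d| ∧ |u w.1.2 - u w.2.2| ≤ δ * L)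
     ≤ (2 * exp (κ * ℓ + s * (log (8 * c / |d|) - ℓ))) * (2 * exp (κ * ℓ + s * (log (δ * L) - ℓ))) := by
    refine Pb_prd_le hνν' _ _ fun w2 _ => ?_
    refine (Pb_prd_le' hν'.nn (fun w : I × I => |(u w.1 - u w2.1) + t * (u w.2 - u w2.2)| ≤ 8 * c / |d|)
      (fun v => |u v - u w2.2| ≤ δ * L) (2 * exp (κ * ℓ + s * (log (8 * c / |d|) - ℓ))) ?_).trans ?_
    · intro v1 _
      have := hfr (u w2.1 - t * (u v1 - u w2.2)) (8 * c / |d|) (by rw [le_div_iff₀ hdp]; linarith)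
      refine le_trans (le_of_eq ?_) this
      congr 1; funext i
      rw [show u i - (u w2.1 - t * (u v1 - u w2.2)) = u i - u w2.1 + t * (u v1 - u w2.2) by ring]
    · exact mul_le_mul_of_nonneg_left (hfr _ _ hδL1) (by positivity)
  have near2 : (2 * exp (κ * ℓ + s * (log (8 * c / |d|) - ℓ))) * (2 * exp (κ * ℓ + s * (log (δ * L) - ℓ))) ≤ 1/2 * exp (-(s * log B + 77 * θ * ℓ)) := by
    have e1 : log (δ * L) = ℓ - k * ℓ := by rw [← hδL, log_exp]
    have e2 : log (8 * c / |d|) = log (8 * c) - log |d| := log_div (by linarith) hdp.ne'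
    rw [e1, e2, hlogB]
    have e3 : exp 3 ≥ 8 := by
      have := exp_one_gt_d9
      have h3 : exp 3 = exp 1 * exp 1 * exp 1 := by rw [← exp_add, ← exp_add]; norm_num
      rw [h3]
      exact e8_le
    have e4 : exp 3 * (exp (κ * ℓ + s * (log (8 * c) - log |d| - ℓ)) * exp (κ * ℓ + s * (ℓ - k * ℓ - ℓ))) ≤
        exp (-(s * (log (3 * c) + log |d| + ℓ) + 77 * θ * ℓ)) := by
      rw [← exp_add, ← exp_add, exp_le_exp]
      have i1 : s * (ℓ - k * ℓ - ℓ) = -(100 * θ * ℓ) := by rw [← hk]; ring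
      have i2 : s * log (8 * c) ≤ log (8 * c) := mul_le_of_le_one_left lnn hs1.le
      have i3 : s * log (3 * c) ≤ log (8 * c) := (mul_le_of_le_one_left hlog3nn hs1.le).trans hlog3
      rw [i1]
      linarith
    have := mul_pos (exp_pos (κ * ℓ + s * (log (8 * c) - log |d| - ℓ))) (exp_pos (κ * ℓ + s * (ℓ - k * ℓ - ℓ)))
    linarith [mul_le_mul_of_nonneg_right e3 this.le]
  have fin : exp (-((s + 80 * θ) * ℓ)) ≤ 1/2 * exp (-(s * log B + 77 * θ * ℓ)) := by
    have e3 : exp 1 ≥ 2 := by have := exp_one_gt_d9; linarith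
    have e4 : exp 1 * exp (-((s + 80 * θ) * ℓ)) ≤ exp (-(s * log B + 77 * θ * ℓ)) := by
      rw [← exp_add, exp_le_exp, hlogB]
      have i2 : s * log |d| ≤ log (8 * c) := (mul_le_mul_of_nonneg_left hlogd hs0.le).trans (mul_le_of_le_one_left lnn hs1.le)
      have i3 : s * log (3 * c) ≤ log (8 * c) := (mul_le_of_le_one_left hlog3nn hs1.le).trans hlog3
      linarith
    have := exp_pos (-((s + 80 * θ) * ℓ))
    linarith [mul_le_mul_of_nonneg_right e3 this.le]
  linarith

theorem DHyp.false (h : DHyp ν u s κ ℓ c) (hκ : κ = (s * (1 - s) / 2000) ^ 2) : False := by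
  have hs0 := h.s0
  have hs1 := h.s1
  have hℓ := h.ℓ0
  have big := h.big
  have lnn := h.log_nn
  have hss : 0 < s * (1 - s) := mul_pos hs0 (by linarith)
  have hss1 : s * (1 - s) ≤ 1 - s := by nlinarith
  set θ := s * (1 - s) / 2000 with hθd
  have hθ : 0 < θ := by positivity
  have hθ1 : θ ≤ 1 / 2000 := by rw [hθd]; linarith
  set k := (1 - s) / 20 with hkd
  have hk : s * k = 100 * θ := by rw [hkd, hθd]; ring
  have hk0 : 0 < k := by rw [hkd]; linarith
  have hk1 : k ≤ 1 := by rw [hkd]; linarith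
  have hθℓ : 0 < θ * ℓ := mul_pos hθ hℓ
  have h9 : 2000 * (κ * ℓ) ≤ θ * ℓ := by
    rw [← mul_assoc]
    refine mul_le_mul_of_nonneg_right ?_ hℓ.le
    rw [hκ]; nlinarith
  obtain ⟨j, hj⟩ := h.goodset θ hθ hκ
  set G := fun i => Good ν u ℓ θ j i with hG
  have hc := Pb_compl h.prob G
  have hwG : 1 - 29 * θ ≤ Pb ν G := by linarith
  have hwp : 1 / 2 ≤ Pb ν G := by linarith
  have hwp0 : 0 < Pb ν G := by linarith
  have hν' := rst_isP h.prob G hwp0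
  set ν' := rst ν G with hν'd
  have hfr : ∀ z ρ : ℝ, 1 ≤ ρ → Pb ν' (fun i => |u i - z| ≤ ρ) ≤ 2 * exp (κ * ℓ + s * (log ρ - ℓ)) := by
    intro z ρ hρ
    refine (rst_Pb h.prob G hwp0 _).trans ?_
    rw [div_le_iff₀ hwp0]
    have := h.fr z ρ hρ
    have := exp_pos (κ * ℓ + s * (log ρ - ℓ))
    nlinarith
  -- mass function
  set m : (I × I) × (I × I) → ℝ := fun w =>
    if exp (ℓ - k * ℓ) ≤ |u w.1.2 - u w.2.2| then prd (prd ν' ν') (prd ν' ν') w else 0 with hm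
  have hP := prd_isP (prd_isP hν' hν') (prd_isP hν' hν')
  have mnn : ∀ w, 0 ≤ m w := fun w => by
    simp only [hm]; split_ifs; exacts [hP.nn w, le_rfl]
  have m1 : ∑ w, m w ≤ 1 := by
    rw [← hP.sum]
    refine Finset.sum_le_sum fun w _ => ?_
    simp only [hm]; split_ifs; exacts [le_rfl, hP.nn w]
  have mne : ∀ w, m w ≠ 0 → exp (ℓ - k * ℓ) ≤ |u w.1.2 - u w.2.2| ∧ ν' w.1.1 ≠ 0 ∧ ν' w.1.2 ≠ 0 ∧ ν' w.2.1 ≠ 0 ∧ ν' w.2.2 ≠ 0 := by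
    intro w hw
    simp only [hm] at hw
    split_ifs at hw with h1
    · refine ⟨h1, ?_, ?_, ?_, ?_⟩ <;> intro h2 <;> simp [prd, h2] at hw
    · simp at hw
  obtain ⟨i0, hi0, -⟩ := exists_le_avg hν' (fun _ => 0) 0 (by simp)
  have hex : ∃ i1, ν' i1 ≠ 0 ∧ exp (ℓ - k * ℓ) ≤ |u i1 - u i0| := by
    by_contra hcon
    push Not at hcon
    have b1 := hfr (u i0) (exp (ℓ - k * ℓ)) (one_le_exp (by nlinarith))
    have b2 : Pb ν' (fun i => |u i - u i0| ≤ exp (ℓ - k * ℓ)) = 1 := by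
      rw [← hν'.sum]
      refine Finset.sum_congr rfl fun i _ => ?_
      by_cases h0 : ν' i = 0
      · simp [h0]
      · rw [if_pos (hcon i h0).le]
    rw [b2, log_exp] at b1
    have b3 : exp (κ * ℓ + s * (ℓ - k * ℓ - ℓ)) ≤ exp (-1) := by
      rw [exp_le_exp]
      have i1 : s * (ℓ - k * ℓ - ℓ) = -(100 * θ * ℓ) := by rw [← hk]; ring
      rw [i1]; linarith
    have b4 : exp (-1:ℝ) < 1/2 := by
      rw [exp_neg, one_div]
      exact inv_strictAnti₀ (by norm_num) (by have := exp_one_gt_d9; linarith)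
    linarith
  obtain ⟨i1, hi1, hi01⟩ := hex
  have key := slopes m mnn m1 (fun w => (u w.1.1 - u w.2.1) / (u w.2.2 - u w.1.2)) (exp (2 * k * ℓ - ℓ))
    (exp (-((s + 80 * θ) * ℓ))) (exp_pos _) (by
      have h1 : exp (2 * k * ℓ - ℓ) ≤ exp (-(1/2 * ℓ)) := by
        rw [exp_le_exp]
        have : k * ℓ ≤ 1/20 * ℓ := mul_le_mul_of_nonneg_right (by rw [hkd]; linarith) hℓ.le
        linarith
      have h2 : exp (-(1/2 * ℓ)) ≤ exp (-2) := by
        rw [exp_le_exp]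
        have : θ * ℓ ≤ 1 * ℓ := mul_le_mul_of_nonneg_right (by linarith) hℓ.le
        linarith
      have h3 : exp (-2:ℝ) ≤ 1/4 := by
        rw [exp_neg, one_div]
        refine inv_anti₀ (by norm_num) ?_
        have := exp_one_gt_d9
        have h2 : Real.exp 2 = Real.exp 1 * Real.exp 1 := by rw [← Real.exp_add]; norm_num
        rw [h2]; nlinarith
      linarith) (exp_pos _) ((i0, i1), (i0, i0)) (by
        simp only [hm]
        rw [if_pos hi01]
        simp [prd, hi0, hi1]) (by simp) (by
        intro w hw ht b hb
        obtain ⟨q0, q1, q2, q3, q4⟩ := mne w hw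
        have := h.mass θ k hθ hκ hθ1 hk hk0 hk1 j ν' hν' (Pb ν G) hwG (rst_le h.prob G hwp0)
          (fun i hi => rst_ne hi) hfr w.1.1 w.2.1 w.1.2 w.2.2 q1 q3 q2 q4 q0 ht b hb
        refine this.trans (le_of_eq ?_)
        unfold Pb
        refine Finset.sum_congr rfl fun w' _ => ?_
        simp only [hm]
        by_cases r1 : exp (ℓ - k * ℓ) ≤ |u w'.1.2 - u w'.2.2| <;>
        by_cases r2 : |(u w'.1.1 - u w'.2.1) / (u w'.2.2 - u w'.1.2) - ((u w.1.1 - u w.2.1) / (u w.2.2 - u w.1.2) + b) / 2| ≤ exp (2 * k * ℓ - ℓ) <;>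
        simp [r1, r2])
  have e8 : (8:ℝ) ≤ exp 3 := by
      have := exp_one_gt_d9
      have h3 : exp 3 = exp 1 * exp 1 * exp 1 := by rw [← exp_add, ← exp_add]; norm_num
      rw [h3]
      nlinarith [mul_self_nonneg (exp 1 - 2)]
  have : exp (-((s + 80 * θ) * ℓ)) ≤ exp (3 + (2 * k * ℓ - ℓ)) := by
    rw [exp_add]
    exact key.trans (mul_le_mul_of_nonneg_right e8 (exp_pos _).le)
  rw [exp_le_exp] at this
  have hfin : (θ : ℝ) * ℓ ≤ (1 - s - 80 * θ - 2 * k) * ℓ := by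
    refine mul_le_mul_of_nonneg_right ?_ hℓ.le
    rw [hθd, hkd]; nlinarith
  linarith

end propD2
end CF

namespace CF
open Classical Finset

section stepC
variable {Ω Ω' S S' T : Type*} [Fintype Ω] [Fintype Ω']

theorem H_cop_fst {p : Ω → ℝ} (hp : IsP p) (c : Ω → S) (f : Ω → T) : H (cop p c) (fun w => f w.1) = H p f := by
  have := (MP_cop_fst hp c).H_eq f
  exact this
theorem H_cop_snd {p : Ω → ℝ} (hp : IsP p) (c : Ω → S) (f : Ω → T) : H (cop p c) (fun w => f w.2) = H p f := by
  have := (MP_cop_snd hp c).H_eq f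
  exact this

theorem H_cop2 {p : Ω → ℝ} (hp : IsP p) (c : Ω → S) (f : Ω → T) :
    H (cop p c) (fun w => (f w.1, f w.2)) ≤ 2 * H p f := by
  have := H_sub (cop_isP hp c) (fun w => f w.1) (fun w => f w.2)
  rw [H_cop_fst hp, H_cop_snd hp] at this
  linarith

theorem diff_ent {p : Ω → ℝ} (hp : IsP p) (a b : Ω → ℝ) (μ : ℝ) (hμ : μ ≠ 0) :
    H (cop p a) (fun w => b w.1 - b w.2) + (2 * H p (fun ω => (b ω, a ω)) - H p a) ≤
      2 * H p (fun ω => a ω + μ * b ω) + 2 * H p b := by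
  have hc := cop_isP hp a
  have sm := H_SM hc (fun w => b w.1 - b w.2) (fun w => (a w.1 + μ * b w.1, a w.2 + μ * b w.2))
    (fun w => (b w.1, b w.2)) 0 (by
      rw [add_zero]
      refine H_le_of_imp hc _ _ ?_
      intro w w' hw hw' h
      have e1 := (cop_ne hw).1
      have e2 := (cop_ne hw').1
      simp only [Prod.mk.injEq] at h ⊢
      refine ⟨?_, h⟩
      have : μ * (b w.1 - b w.2) = μ * (b w'.1 - b w'.2) := by linarith [h.1, h.2]
      exact mul_left_cancel₀ hμ this) (by
      intro w w' _ _ h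
      simp only [Prod.mk.injEq] at h
      rw [h.1, h.2])
  have lo : H (cop p a) (fun w => (b w.1, b w.2, a w.1)) ≤ H (cop p a) (fun w =>
      ((a w.1 + μ * b w.1, a w.2 + μ * b w.2), (b w.1, b w.2))) := by
    refine H_le_of_imp hc _ _ ?_
    intro w w' _ _ h
    simp only [Prod.mk.injEq] at h ⊢
    refine ⟨h.2.1, h.2.2, ?_⟩
    have h1 := h.1.1
    rw [h.2.1] at h1
    linarith
  rw [H_cop hp] at lo
  have u1 := H_cop2 hp a (fun ω => a ω + μ * b ω)
  have u2 := H_cop2 hp a b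
  linarith

theorem quad_near {x y η L K : ℝ} (hη : 0 < η) (hL : 0 < L) (hx : η * L ≤ |x|) (hy : η * L ≤ |y|)
    (h : |x ^ 2 - y ^ 2| ≤ K * L) : |x - y| ≤ K / η ∨ |x + y| ≤ K / η := by
  by_contra hcon
  push Not at hcon
  obtain ⟨h1, h2⟩ := hcon
  rw [div_lt_iff₀ hη] at h1 h2
  have e : |x ^ 2 - y ^ 2| = |x - y| * |x + y| := by rw [← abs_mul]; ring_nf
  have e2 : |x - y| * η ≤ |x-y| * η := le_rfl
  have hm : η * L ≤ |x - y| ∨ η * L ≤ |x + y| := by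
    by_contra h3
    push Not at h3
    have : |x| + |x| ≤ |x - y| + |x + y| := by
      have := abs_add_le (x - y) (x + y)
      rw [show x - y + (x + y) = 2 * x by ring, abs_mul, abs_two] at this
      linarith
    linarith
  have hLη := mul_pos hη hL
  have n1 := abs_nonneg (x - y)
  have n2 := abs_nonneg (x + y)
  have hK : 0 ≤ K * L := (abs_nonneg _).trans h
  have hK' : 0 ≤ K := by
    by_contra hh
    push Not at hh
    have := mul_neg_of_neg_of_pos hh hL
    linarith
  rcases hm with hm | hm
  · have : (η * L) * |x + y| ≤ |x - y| * |x + y| := mul_le_mul_of_nonneg_right hm n2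
    have h3 : K * L < |x + y| * η * L := mul_lt_mul_of_pos_right h2 hL
    linarith
  · have : |x - y| * (η * L) ≤ |x - y| * |x + y| := mul_le_mul_of_nonneg_left hm n1
    have h3 : K * L < |x - y| * η * L := mul_lt_mul_of_pos_right h1 hL
    linarith

theorem quad_ent {p : Ω → ℝ} (hp : IsP p) (a b : Ω → ℝ) (k1 k2 η L : ℝ) (hk1 : k1 ≠ 0) (hk2 : k2 ≠ 0)
    (hη : 0 < η) (hL : 0 < L) (ha : ∀ ω, p ω ≠ 0 → η * L ≤ |a ω|) (hinteg : ∀ ω, ∃ m : ℤ, a ω = m)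
    (K J : ℕ) (hK : 1 / |k1| / η ≤ K) (hJ : 2 / |k2| ≤ J) :
    Hf (cop p a) (fun w => (b w.1 ^ 2 - b w.2 ^ 2) / L) + (2 * H p (fun ω => (b ω, a ω)) - H p a) ≤
      2 * Hf p (fun ω => (k1 * a ω ^ 2 + k2 * b ω ^ 2) / L) + 2 * H p b + log (2 * J + 3) + log (4 * K + 2) := by
  have hc := cop_isP hp a
  set φ : Ω → ℤ := fun ω => ⌊(k1 * a ω ^ 2 + k2 * b ω ^ 2) / L⌋ with hφ
  have hk2p : 0 < |k2| := abs_pos.2 hk2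
  have hk1p : 0 < |k1| := abs_pos.2 hk1
  have sm := H_SM hc (fun w => ⌊(b w.1 ^ 2 - b w.2 ^ 2) / L⌋) (fun w => (φ w.1, φ w.2))
    (fun w => (b w.1, b w.2)) _ (Hf_near_k hc _ _ J (by
      intro w w' hw hw' h
      have e1 := (cop_ne hw).1
      have e2 := (cop_ne hw').1
      simp only [Prod.mk.injEq] at h
      have f1 := abs_lt_of_floor h.1
      have f2 := abs_lt_of_floor h.2
      refine le_trans ?_ hJ
      rw [le_div_iff₀ hk2p, mul_comm, ← abs_mul]
      have : k2 * ((b w.1 ^ 2 - b w.2 ^ 2) / L - (b w'.1 ^ 2 - b w'.2 ^ 2) / L) =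
        ((k1 * a w.1 ^ 2 + k2 * b w.1 ^ 2) / L - (k1 * a w'.1 ^ 2 + k2 * b w'.1 ^ 2) / L) -
        ((k1 * a w.2 ^ 2 + k2 * b w.2 ^ 2) / L - (k1 * a w'.2 ^ 2 + k2 * b w'.2 ^ 2) / L) := by
        rw [e1, e2]; ring
      rw [this]
      refine (abs_sub _ _).trans ?_
      linarith)) (by
      intro w w' _ _ h
      simp only [Prod.mk.injEq] at h
      rw [h.1, h.2])
  have lo : H (cop p a) (fun w => (a w.1, ((φ w.1, φ w.2), (b w.1, b w.2)))) ≤ H (cop p a) (fun w =>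
      ((φ w.1, φ w.2), (b w.1, b w.2))) + log (4 * K + 2) := by
    refine H_fiber hc _ _ _ (by positivity) ?_
    intro w0 h0
    obtain ⟨m0, hm0⟩ := hinteg w0.1
    refine ⟨(Finset.Icc (m0 - K) (m0 + K) ∪ Finset.Icc (-m0 - K) (-m0 + K)).image (fun m : ℤ => (m : ℝ)), ?_, ?_⟩
    · refine le_trans (Nat.cast_le.2 (Finset.card_image_le.trans (Finset.card_union_le _ _))) ?_
      rw [Int.card_Icc, Int.card_Icc]
      have e1 : (m0 + K + 1 - (m0 - K)).toNat = 2 * K + 1 := by omega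
      have e2 : (-m0 + K + 1 - (-m0 - K)).toNat = 2 * K + 1 := by omega
      rw [e1, e2]; push_cast; linarith
    · intro w hw h
      simp only [Prod.mk.injEq] at h
      obtain ⟨m, hm⟩ := hinteg w.1
      have f1 := abs_lt_of_floor h.1.1
      rw [h.2.1] at f1
      have f2 : |a w.1 ^ 2 - a w0.1 ^ 2| ≤ (1 / |k1|) * L := by
        rw [show (k1 * a w.1 ^ 2 + k2 * b w0.1 ^ 2) / L - (k1 * a w0.1 ^ 2 + k2 * b w0.1 ^ 2) / L =
          k1 * (a w.1 ^ 2 - a w0.1 ^ 2) / L by ring, abs_div, abs_mul, abs_of_pos hL, div_lt_iff₀ hL] at f1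
        rw [div_mul_eq_mul_div, le_div_iff₀ hk1p]
        linarith
      have q := quad_near hη hL (ha _ (cop_ne hw).2.1) (ha _ (cop_ne h0).2.1) f2
      rw [Finset.mem_image]
      refine ⟨m, ?_, hm.symm⟩
      rw [hm, hm0] at q
      rw [Finset.mem_union, Finset.mem_Icc, Finset.mem_Icc]
      rcases q with q | q
      · left
        have := abs_le.1 (q.trans hK)
        have g1 : ((m0 - K : ℤ) : ℝ) ≤ m := by push_cast; linarith [this.1]
        have g2 : (m : ℝ) ≤ ((m0 + K : ℤ) : ℝ) := by push_cast; linarith [this.2]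
        exact ⟨Int.cast_le.1 g1, Int.cast_le.1 g2⟩
      · right
        have := abs_le.1 (q.trans hK)
        have g1 : ((-m0 - K : ℤ) : ℝ) ≤ m := by push_cast; linarith [this.1]
        have g2 : (m : ℝ) ≤ ((-m0 + K : ℤ) : ℝ) := by push_cast; linarith [this.2]
        exact ⟨Int.cast_le.1 g1, Int.cast_le.1 g2⟩
  have lo2 : H (cop p a) (fun w => (b w.1, b w.2, a w.1)) ≤ H (cop p a) (fun w => (a w.1, ((φ w.1, φ w.2), (b w.1, b w.2)))) := by
    refine H_le_of_imp hc _ _ ?_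
    intro w w' _ _ h
    simp only [Prod.mk.injEq] at h ⊢
    tauto
  rw [H_cop hp] at lo2
  have u1 := H_cop2 hp a φ
  have u2 := H_cop2 hp a b
  unfold Hf
  linarith

theorem cond_mix {p : Ω → ℝ} (hp : IsP p) (a : Ω → S) (f : Ω × Ω → T) :
    ∑ ω', p ω' * H (prd (rst p (fun ω => a ω = a ω')) (rst p (fun ω => a ω = a ω'))) f ≤ H (cop p a) f := by
  refine H_mix (cop_isP hp a) f p hp.nn (fun ω' => prd (rst p (fun ω => a ω = a ω')) (rst p (fun ω => a ω = a ω'))) ?_ ?_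
  · intro i hi
    have : 0 < Pb p (fun ω => a ω = a i) := Pr_pos hp.nn a hi
    exact prd_isP (rst_isP hp _ this) (rst_isP hp _ this)
  · intro w
    have e : ∀ ω', p ω' * prd (rst p (fun ω => a ω = a ω')) (rst p (fun ω => a ω = a ω')) w =
        (if a ω' = a w.1 then p ω' else 0) * (cop p a w / Pr p a (a w.1)) := by
      intro ω'
      unfold prd rst cop
      by_cases h1 : a w.1 = a ω'
      · by_cases h2 : a w.2 = a ω'
        · rw [if_pos h1, if_pos h2, if_pos h1.symm, if_pos (h1.trans h2.symm), h1]
          change p ω' * (p w.1 / Pr p a (a ω') * (p w.2 / Pr p a (a ω'))) = _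
          rw [div_div]
          by_cases h3 : Pr p a (a ω') = 0
          · simp [h3]
          · field_simp
        · have h4 : ¬ (a w.1 = a w.2) := fun h => h2 (h.symm.trans h1)
          simp [h2, h4]
      · have h5 : ¬ (a ω' = a w.1) := fun h => h1 h.symm
        simp [h1, h5]
    simp only [e]
    rw [← Finset.sum_mul]
    change Pr p a (a w.1) * _ ≤ _
    by_cases h3 : Pr p a (a w.1) = 0
    · rw [h3, zero_mul]; exact cop_nn hp a w
    · rw [mul_div_cancel₀ _ h3]

/-- hypotheses of step C -/
structure CHyp (p : Ω → ℝ) (a b : Ω → ℝ) (s κ ℓ c η μ k1 k2 : ℝ) : Prop where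
  prob : IsP p
  int : ∀ ω, ∃ m : ℤ, a ω = m
  loa : ∀ ω, p ω ≠ 0 → η * exp ℓ ≤ |a ω|
  lob : ∀ ω, p ω ≠ 0 → η * exp ℓ ≤ |b ω|
  hib : ∀ ω, p ω ≠ 0 → |b ω| ≤ c * exp ℓ
  fr : ∀ i z ρ : ℝ, 1 ≤ ρ → Pb p (fun ω => a ω = i ∧ |b ω - z| ≤ ρ) ≤ exp (κ * ℓ - s * ℓ + s * (log ρ - ℓ))
  Ha : H p a ≤ (s + κ) * ℓ
  Hb : H p b ≤ (s + κ) * ℓ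
  Hm : H p (fun ω => a ω + μ * b ω) ≤ (s + κ) * ℓ
  HQ : Hf p (fun ω => (k1 * a ω ^ 2 + k2 * b ω ^ 2) / exp ℓ) ≤ (s + κ) * ℓ

theorem CHyp.select {p : Ω → ℝ} {a b : Ω → ℝ} {s κ ℓ c η μ k1 k2 : ℝ} (h : CHyp p a b s κ ℓ c η μ k1 k2)
    (s0 : 0 < s) (s1 : s < 1) (κ0 : 0 < κ) (c1 : 1 ≤ c) (hη : 0 < η) (hμ : μ ≠ 0) (hk1 : k1 ≠ 0) (hk2 : k2 ≠ 0)
    (K J : ℕ) (hK : 1 / |k1| / η ≤ K) (hJ : 2 / |k2| ≤ J) (hℓ : 0 < ℓ)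
    (big : 100 + 10 * log (8 * c) ≤ κ * ℓ) (big1 : log (2 * J + 3) + log (4 * K + 2) ≤ κ * ℓ)
    (big2 : -log η ≤ κ * ℓ) : ∃ ν : Ω → ℝ, DHyp ν b s (40 * κ) ℓ c := by
  have hp := h.prob
  have hL := exp_pos ℓ
  have hκℓ : 0 < κ * ℓ := mul_pos κ0 hℓ
  have l8 : log c ≤ log (8 * c) := log_le_log (by linarith) (by linarith)
  have lc0 : 0 ≤ log c := log_nonneg c1
  have hab : (2 * s - κ) * ℓ ≤ H p (fun ω => (b ω, a ω)) := by
    refine H_lower hp _ _ fun k => ?_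
    rw [Pr_eq_Pb]
    refine le_trans (Pb_mono hp.nn _ _ ?_) ((h.fr k.2 k.1 1 le_rfl).trans (le_of_eq ?_))
    · intro i _ hi
      rw [← hi]; simp
    · simp; ring
  have d1 := diff_ent hp a b μ hμ
  have d2 := quad_ent hp a b k1 k2 η (exp ℓ) hk1 hk2 hη hL h.loa h.int K J hK hJ
  have E1 := (cond_mix hp a (fun w => b w.1 - b w.2))
  have E2 := (cond_mix hp a (fun w => ⌊(b w.1 ^ 2 - b w.2 ^ 2) / exp ℓ⌋))
  have hHa := h.Ha
  have hHb := h.Hb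
  have hHm := h.Hm
  have hHQ := h.HQ
  set q : Ω → Ω → ℝ := fun ω' => rst p (fun ω => a ω = a ω') with hq
  set e : Ω → ℝ := fun ω' => -log (Pr p a (a ω')) - s * ℓ with he
  have E3 : ∑ ω', p ω' * e ω' = H p a - s * ℓ := by
    unfold H
    simp only [he, mul_sub, Finset.sum_sub_distrib, ← Finset.sum_mul, hp.sum, mul_neg, Finset.sum_neg_distrib]
    ring
  have tot : ∑ ω', p ω' * (H (prd (q ω') (q ω')) (fun w => b w.1 - b w.2) +
      H (prd (q ω') (q ω')) (fun w => ⌊(b w.1 ^ 2 - b w.2 ^ 2) / exp ℓ⌋) + 5 * e ω') ≤ (2 * s + 20 * κ) * ℓ := by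
    have : ∀ A B : Ω → ℝ, ∑ ω', p ω' * (A ω' + B ω' + 5 * e ω') = ∑ ω', p ω' * A ω' + ∑ ω', p ω' * B ω' + 5 * ∑ ω', p ω' * e ω' := by
      intro A B
      rw [Finset.mul_sum, ← Finset.sum_add_distrib, ← Finset.sum_add_distrib]
      exact Finset.sum_congr rfl fun _ _ => by ring
    rw [this, E3]
    unfold Hf at d2 hHQ
    linarith
  obtain ⟨ω0, h0, hsel⟩ := exists_le_avg hp _ _ tot
  have hPp : 0 < Pb p (fun ω => a ω = a ω0) := Pr_pos hp.nn a h0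
  have hqP : IsP (q ω0) := rst_isP hp _ hPp
  have hPe : Pb p (fun ω => a ω = a ω0) = exp (-(e ω0) - s * ℓ) := by
    simp only [he]
    rw [show -(-log (Pr p a (a ω0)) - s * ℓ) - s * ℓ = log (Pr p a (a ω0)) by ring, exp_log]
    · rfl
    · exact hPp
  have e_lo : -(2 * (κ * ℓ)) ≤ e ω0 := by
    have h1 : Pb p (fun ω => a ω = a ω0) ≤ exp (κ * ℓ - s * ℓ + s * (log (c * exp ℓ) - ℓ)) := by
      refine le_trans (Pb_mono hp.nn _ _ ?_) (h.fr (a ω0) 0 (c * exp ℓ) ?_)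
      · intro i hi hh
        exact ⟨hh, by rw [sub_zero]; exact h.hib i hi⟩
      · exact one_le_mul_of_one_le_of_one_le c1 (one_le_exp hℓ.le)
    rw [hPe, exp_le_exp, log_mul (by linarith) hL.ne', log_exp] at h1
    have : s * log c ≤ log c := mul_le_of_le_one_left lc0 s1.le
    linarith
  have frq : ∀ z ρ : ℝ, 1 ≤ ρ → Pb (q ω0) (fun i => |b i - z| ≤ ρ) ≤ exp (κ * ℓ + e ω0 + s * (log ρ - ℓ)) := by
    intro z ρ hρ
    have h1 : Pb (q ω0) (fun i => |b i - z| ≤ ρ) ≤ Pb p (fun ω => a ω = a ω0 ∧ |b ω - z| ≤ ρ) / Pb p (fun ω => a ω = a ω0) := by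
      refine le_trans (Pb_mono hqP.nn _ (fun ω => a ω = a ω0 ∧ |b ω - z| ≤ ρ) ?_) (rst_Pb hp _ hPp _)
      intro i hi hh
      exact ⟨(rst_ne hi).1, hh⟩
    refine h1.trans ?_
    rw [div_le_iff₀ hPp, hPe, ← exp_add]
    refine (h.fr _ z ρ hρ).trans (le_of_eq ?_)
    congr 1; ring
  set κ' := 4 * κ + e ω0 / ℓ with hκ'
  have eκ' : κ' * ℓ = 4 * (κ * ℓ) + e ω0 := by rw [hκ']; field_simp
  have κ'0 : 0 < κ' := by
    by_contra hcon
    push Not at hcon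
    have := mul_nonpos_of_nonpos_of_nonneg hcon hℓ.le
    linarith
  have lnn : 0 ≤ log (8 * c) := log_nonneg (by linarith)
  have hlo : ∀ κ1, κ * ℓ ≤ κ1 * ℓ → ∀ i, q ω0 i ≠ 0 → exp (ℓ - κ1 * ℓ) ≤ |b i| := by
    intro κ1 h1 i hi
    refine le_trans ?_ (h.lob i (rst_ne hi).2)
    have : exp (ℓ - κ1 * ℓ) ≤ exp (log η + ℓ) := by rw [exp_le_exp]; linarith
    rwa [exp_add, exp_log hη] at this
  have B : BHyp (q ω0) b s κ' ℓ := by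
    refine ⟨hqP, hlo κ' (by linarith), ?_, s1, κ'0, hℓ, by linarith⟩
    intro z ρ hρ
    refine (frq z ρ hρ).trans ?_
    rw [exp_le_exp, eκ']; linarith
  have l1 : (s - κ') * ℓ ≤ H (prd (q ω0) (q ω0)) (fun w => b w.1 - b w.2) := by
    refine B.hu_lo.trans ?_
    have := H_ge_l hqP hqP b (fun ω => - b ω)
    simpa only [← sub_eq_add_neg] using this
  have l2 : (s - 3 * κ') * ℓ - 2 ≤ H (prd (q ω0) (q ω0)) (fun w => ⌊(b w.1 ^ 2 - b w.2 ^ 2) / exp ℓ⌋) := by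
    have h1 := B.hz_lo 1 (Or.inl rfl)
    have h2 := Hf_ge hqP hqP (fun i => 1 * (b i ^ 2 / exp ℓ)) (fun i => -(b i ^ 2 / exp ℓ))
    have h3 : Hf (prd (q ω0) (q ω0)) (fun w => 1 * (b w.1 ^ 2 / exp ℓ) + -(b w.2 ^ 2 / exp ℓ)) =
      H (prd (q ω0) (q ω0)) (fun w => ⌊(b w.1 ^ 2 - b w.2 ^ 2) / exp ℓ⌋) := by
      unfold Hf; congr 1; funext w; congr 1; ring
    linarith
  refine ⟨q ω0, hqP, hlo (40 * κ) (by linarith), fun i hi => h.hib i (rst_ne hi).2, ?_, ?_, ?_, s0, s1, by linarith, c1, by linarith⟩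
  · intro z ρ hρ
    refine (frq z ρ hρ).trans ?_
    rw [exp_le_exp]; linarith
  · linarith
  · unfold Hf; linarith

/-- step C -/
theorem stepC (s κ c η μ k1 k2 : ℝ) (s0 : 0 < s) (s1 : s < 1) (hκ : 40 * κ = (s * (1 - s) / 2000) ^ 2)
    (c1 : 1 ≤ c) (hη : 0 < η) (hμ : μ ≠ 0) (hk1 : k1 ≠ 0) (hk2 : k2 ≠ 0) :
    ∃ ℓ0 : ℝ, ∀ ℓ, ℓ0 ≤ ℓ → ∀ (Ω : Type) [Fintype Ω] (p a b : Ω → ℝ), ¬ CHyp p a b s κ ℓ c η μ k1 k2 := by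
  obtain ⟨K, hK⟩ := exists_nat_ge (1 / |k1| / η)
  obtain ⟨J, hJ⟩ := exists_nat_ge (2 / |k2|)
  have κ0 : 0 < κ := by
    have : 0 < s * (1 - s) := mul_pos s0 (by linarith)
    have : 0 < (s * (1 - s) / 2000) ^ 2 := by positivity
    linarith
  refine ⟨max ((100 + 10 * log (8 * c)) / κ) (max ((log (2 * J + 3) + log (4 * K + 2)) / κ) (max (-log η / κ) 1)), ?_⟩
  intro ℓ hℓ Ω _ p a b h
  simp only [max_le_iff, div_le_iff₀ κ0] at hℓ
  obtain ⟨b1, b2, b3, b4⟩ := hℓ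
  obtain ⟨ν, hν⟩ := h.select s0 s1 κ0 c1 hη hμ hk1 hk2 K J hK hJ (by linarith) (by linarith) (by linarith) (by linarith)
  exact hν.false hκ

end stepC
end CF

namespace CF
open Classical Finset

section stepL
variable {Ω Ω' Ω'' S S' S'' T : Type*} [Fintype Ω] [Fintype Ω'] [Fintype Ω'']

theorem Pb_fiber (p : Ω → ℝ) (f : Ω → S) (D : Ω → Prop) :
    Pb p D = ∑ t ∈ Finset.univ.image f, Pb p (fun ω => D ω ∧ f ω = t) := by
  unfold Pb
  rw [Finset.sum_comm]
  refine Finset.sum_congr rfl fun ω _ => ?_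
  by_cases h : D ω
  · simp only [h, true_and, if_true]
    rw [Finset.sum_ite_eq]
    simp
  · simp [h]

theorem Pb_disint {p : Ω → ℝ} (f : Ω → S) (E N : Ω → Prop) (K : ℝ)
    (h : ∀ t, Pb p (fun ω => E ω ∧ f ω = t) ≤ K * Pb p (fun ω => N ω ∧ f ω = t)) :
    Pb p E ≤ K * Pb p N := by
  rw [Pb_fiber p f E, Pb_fiber p f N, Finset.mul_sum]
  exact Finset.sum_le_sum fun t _ => h t

theorem Pb_true {p : Ω → ℝ} (hp : IsP p) : Pb p (fun _ => True) = 1 := by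
  unfold Pb; simpa using hp.sum

theorem Pb_le_one {p : Ω → ℝ} (hp : IsP p) (E : Ω → Prop) : Pb p E ≤ 1 := by
  rw [← Pb_true hp]
  exact Pb_mono hp.nn _ _ (fun _ _ _ => trivial)

theorem Pb_disint1 {p : Ω → ℝ} (hp : IsP p) (f : Ω → S) (E : Ω → Prop) (K : ℝ)
    (h : ∀ t, Pb p (fun ω => E ω ∧ f ω = t) ≤ K * Pb p (fun ω => f ω = t)) :
    Pb p E ≤ K := by
  have := Pb_disint f E (fun _ => True) K (by simpa using h)
  rwa [Pb_true hp, mul_one] at this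

theorem H_cond_lower {p : Ω → ℝ} (hp : IsP p) (f : Ω → S) (g : Ω → S') (M : ℝ)
    (h : ∀ t u, Pb p (fun ω => g ω = u ∧ f ω = t) ≤ exp (-M) * Pb p (fun ω => f ω = t)) :
    H p f + M ≤ H p (fun ω => (f ω, g ω)) := by
  have e : M = ∑ ω, p ω * M := by rw [← Finset.sum_mul, hp.sum, one_mul]
  unfold H
  rw [← sub_nonneg, e]
  have : -∑ ω, p ω * Real.log (Pr p (fun ω => (f ω, g ω)) (f ω, g ω)) - (-∑ ω, p ω * Real.log (Pr p f (f ω)) + ∑ ω, p ω * M)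
      = ∑ ω, p ω * (Real.log (Pr p f (f ω)) - M - Real.log (Pr p (fun ω => (f ω, g ω)) (f ω, g ω))) := by
    simp only [mul_sub, Finset.sum_sub_distrib]; ring
  rw [this]
  refine Finset.sum_nonneg fun ω _ => ?_
  by_cases h0 : p ω = 0
  · simp [h0]
  refine mul_nonneg (hp.nn ω) ?_
  have p1 := Pr_pos hp.nn f h0
  have p2 := Pr_pos hp.nn (fun ω => (f ω, g ω)) h0
  have h1 : Pr p (fun ω => (f ω, g ω)) (f ω, g ω) ≤ exp (-M) * Pr p f (f ω) := by
    refine le_trans ?_ (h (f ω) (g ω))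
    rw [Pr_eq_Pb]
    exact Pb_mono hp.nn _ _ (fun a _ h => by simp only [Prod.mk.injEq] at h; exact ⟨h.2, h.1⟩)
  have h2 := log_le_log p2 h1
  rw [log_mul (exp_pos _).ne' p1.ne', log_exp] at h2
  linarith

/-- one-sided hypotheses -/
structure LHyp (p : Ω → ℝ) (x y : Ω → ℝ) (s κ ℓ c θ δ : ℝ) : Prop where
  prob : IsP p
  intx : ∀ ω, ∃ m : ℤ, x ω = m
  inty : ∀ ω, ∃ m : ℤ, y ω = m
  bx : ∀ ω, p ω ≠ 0 → |x ω| ≤ c * exp ℓ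
  by_ : ∀ ω, p ω ≠ 0 → |y ω| ≤ c * exp ℓ
  Fx : ∀ z ρ j : ℝ, 1 ≤ ρ → Pb p (fun ω => |x ω - z| ≤ ρ ∧ y ω = j) ≤ exp (κ * ℓ + s * (log ρ - ℓ)) * Pb p (fun ω => y ω = j)
  Sx : ∀ z j : ℝ, Pb p (fun ω => |x ω - z| ≤ θ * exp ℓ ∧ y ω = j) ≤ δ * Pb p (fun ω => y ω = j)
  Fy : ∀ z ρ : ℝ, 1 ≤ ρ → Pb p (fun ω => |y ω - z| ≤ ρ) ≤ exp (κ * ℓ + s * (log ρ - ℓ))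
  Sy : ∀ z : ℝ, Pb p (fun ω => |y ω - z| ≤ θ * exp ℓ) ≤ δ

theorem LHyp.Fx1 {p : Ω → ℝ} {x y : Ω → ℝ} {s κ ℓ c θ δ : ℝ} (h : LHyp p x y s κ ℓ c θ δ) (z j : ℝ) :
    Pb p (fun ω => x ω = z ∧ y ω = j) ≤ exp (-((s - κ) * ℓ)) * Pb p (fun ω => y ω = j) := by
  have := h.Fx z 1 j le_rfl
  rw [log_one] at this
  rw [show -((s - κ) * ℓ) = κ * ℓ + s * (0 - ℓ) by ring]
  refine le_trans (Pb_mono h.prob.nn _ _ ?_) this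
  rintro ω _ ⟨h1, h2⟩
  exact ⟨by rw [h1]; simp, h2⟩

theorem LHyp.Fy1 {p : Ω → ℝ} {x y : Ω → ℝ} {s κ ℓ c θ δ : ℝ} (h : LHyp p x y s κ ℓ c θ δ) (z : ℝ) :
    Pb p (fun ω => y ω = z) ≤ exp (-((s - κ) * ℓ)) := by
  have := h.Fy z 1 le_rfl
  rw [log_one] at this
  rw [show -((s - κ) * ℓ) = κ * ℓ + s * (0 - ℓ) by ring]
  refine le_trans (Pb_mono h.prob.nn _ _ ?_) this
  intro ω _ h1
  rw [h1]; simp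

theorem LHyp.Hy_lo {p : Ω → ℝ} {x y : Ω → ℝ} {s κ ℓ c θ δ : ℝ} (h : LHyp p x y s κ ℓ c θ δ) :
    (s - κ) * ℓ ≤ H p y := H_lower h.prob y _ (fun z => h.Fy1 z)

theorem LHyp.Hxy_lo {p : Ω → ℝ} {x y : Ω → ℝ} {s κ ℓ c θ δ : ℝ} (h : LHyp p x y s κ ℓ c θ δ) :
    H p y + (s - κ) * ℓ ≤ H p (fun ω => (y ω, x ω)) :=
  H_cond_lower h.prob y x _ (fun t u => h.Fx1 u t)

theorem LHyp.Hlin_lo {p : Ω → ℝ} {x y : Ω → ℝ} {s κ ℓ c θ δ : ℝ} (h : LHyp p x y s κ ℓ c θ δ) (β : ℝ) :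
    (s - κ) * ℓ ≤ H p (fun ω => x ω + β * y ω) := by
  refine H_lower h.prob _ _ (fun z => ?_)
  rw [Pr_eq_Pb]
  refine Pb_disint1 h.prob y _ _ (fun j => ?_)
  refine le_trans (Pb_mono h.prob.nn _ _ ?_) (h.Fx1 (z - β * j) j)
  rintro ω _ ⟨h1, h2⟩
  refine ⟨?_, h2⟩
  rw [← h1, h2]; ring

/-- small probability of being near a value for a form with nonzero `x`-coefficient -/
theorem LHyp.small {p : Ω → ℝ} {x y : Ω → ℝ} {s κ ℓ c θ δ : ℝ} (h : LHyp p x y s κ ℓ c θ δ) (α : ℤ) (β : ℝ)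
    (hα : α ≠ 0) : Pb p (fun ω => |α * x ω + β * y ω| ≤ θ * exp ℓ) ≤ δ := by
  have ha : (1 : ℝ) ≤ |(α : ℝ)| := by
    rw [← Int.cast_abs]; exact_mod_cast Int.one_le_abs hα
  have ha0 : (α : ℝ) ≠ 0 := by exact_mod_cast hα
  refine Pb_disint1 h.prob y _ _ (fun j => ?_)
  refine le_trans (Pb_mono h.prob.nn _ _ ?_) (h.Sx (-(β * j) / α) j)
  rintro ω _ ⟨h1, h2⟩
  refine ⟨?_, h2⟩
  have e : (α : ℝ) * x ω + β * y ω = α * (x ω - -(β * j) / α) := by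
    rw [h2]; field_simp; ring
  rw [e, abs_mul] at h1
  refine le_trans ?_ h1
  exact le_mul_of_one_le_left (abs_nonneg _) ha

theorem LHyp.small' {p : Ω → ℝ} {x y : Ω → ℝ} {s κ ℓ c θ δ : ℝ} (h : LHyp p x y s κ ℓ c θ δ) (α β : ℤ)
    (hα : α ≠ 0 ∨ β ≠ 0) : Pb p (fun ω => |α * x ω + β * y ω| ≤ θ * exp ℓ) ≤ δ := by
  by_cases h0 : α = 0
  · have hb : β ≠ 0 := by tauto
    have ha : (1 : ℝ) ≤ |(β : ℝ)| := by
      rw [← Int.cast_abs]; exact_mod_cast Int.one_le_abs hb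
    refine le_trans (Pb_mono h.prob.nn _ _ ?_) (h.Sy 0)
    intro ω _ h1
    rw [h0, Int.cast_zero, zero_mul, zero_add, abs_mul] at h1
    rw [sub_zero]
    exact le_trans (le_mul_of_one_le_left (abs_nonneg _) ha) h1
  · exact h.small α β h0

/-- joint Frostman bound for two forms -/
theorem LHyp.joint {p : Ω → ℝ} {x y : Ω → ℝ} {s κ ℓ c θ δ : ℝ} (h : LHyp p x y s κ ℓ c θ δ) (α β γ ζ : ℤ)
    (hα : α ≠ 0) (hd : α * ζ - β * γ ≠ 0) (i z ρ : ℝ) (hρ : 1 ≤ ρ) :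
    Pb p (fun ω => α * x ω + β * y ω = i ∧ |γ * x ω + ζ * y ω - z| ≤ ρ) ≤
      exp (-((s - κ) * ℓ)) * exp (κ * ℓ + s * (log (|(α : ℝ)| * ρ) - ℓ)) := by
  have ha : (1 : ℝ) ≤ |(α : ℝ)| := by
    rw [← Int.cast_abs]; exact_mod_cast Int.one_le_abs hα
  have ha0 : (α : ℝ) ≠ 0 := by exact_mod_cast hα
  set d : ℝ := ((α * ζ - β * γ : ℤ) : ℝ) with hdd
  have hd1 : 1 ≤ |d| := by
    rw [hdd, ← Int.cast_abs]; exact_mod_cast Int.one_le_abs hd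
  have hd0 : d ≠ 0 := by rw [hdd]; exact_mod_cast hd
  have hde : d = α * ζ - β * γ := by rw [hdd]; push_cast; ring
  have b1 := h.Fy ((α * z - γ * i) / d) (|(α : ℝ)| * ρ) (by nlinarith)
  refine le_trans ?_ (mul_le_mul_of_nonneg_left b1 (exp_pos _).le)
  refine Pb_disint y _ _ _ (fun j => ?_)
  by_cases hN : |j - (α * z - γ * i) / d| ≤ |(α : ℝ)| * ρ
  · refine le_trans (le_trans (Pb_mono h.prob.nn _ _ ?_) (h.Fx1 ((i - β * j) / α) j))
      (mul_le_mul_of_nonneg_left (Pb_mono h.prob.nn _ _ ?_) (exp_pos _).le)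
    · rintro ω _ ⟨⟨h1, _⟩, h2⟩
      refine ⟨?_, h2⟩
      rw [← h1, h2]; field_simp; ring
    · intro ω _ h2
      exact ⟨by rw [h2]; exact hN, h2⟩
  · refine le_trans (le_of_eq ?_) (mul_nonneg (exp_pos _).le (Pb_nn h.prob.nn _))
    unfold Pb
    refine Finset.sum_eq_zero fun ω _ => if_neg ?_
    rintro ⟨⟨h1, h2⟩, h3⟩
    apply hN
    have e : d * (j - (α * z - γ * i) / d) = α * (γ * x ω + ζ * y ω - z) := by
      rw [mul_sub, mul_div_cancel₀ _ hd0, hde, ← h1, h3]; ring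
    have e2 : |d| * |j - (α * z - γ * i) / d| = |(α : ℝ)| * |γ * x ω + ζ * y ω - z| := by
      rw [← abs_mul, e, abs_mul]
    calc |j - (α * z - γ * i) / d| ≤ |d| * |j - (α * z - γ * i) / d| := le_mul_of_one_le_left (abs_nonneg _) hd1
      _ = _ := e2
      _ ≤ _ := mul_le_mul_of_nonneg_left h2 (abs_nonneg _)

/-- contradiction from forms -/
theorem fin (s κ c θ μ k1 k2 : ℝ) (α β γ ζ : ℤ) (s0 : 0 < s) (s1 : s < 1) (hκ : 40 * κ = (s * (1 - s) / 2000) ^ 2)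
    (c1 : 1 ≤ c) (hθ : 0 < θ) (hμ : μ ≠ 0) (hk1 : k1 ≠ 0) (hk2 : k2 ≠ 0) (hα : α ≠ 0) (hd : α * ζ - β * γ ≠ 0) :
    ∃ ℓ0 : ℝ, ∀ ℓ, ℓ0 ≤ ℓ → ∀ (Ω : Type) [Fintype Ω] (p x y : Ω → ℝ),
      LHyp p x y s (κ / 8) ℓ c θ (κ / 8) →
      H p (fun ω => α * x ω + β * y ω) ≤ (s + κ / 8) * ℓ →
      H p (fun ω => γ * x ω + ζ * y ω) ≤ (s + κ / 8) * ℓ →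
      H p (fun ω => (α * x ω + β * y ω) + μ * (γ * x ω + ζ * y ω)) ≤ (s + κ / 8) * ℓ →
      Hf p (fun ω => (k1 * (α * x ω + β * y ω) ^ 2 + k2 * (γ * x ω + ζ * y ω) ^ 2) / exp ℓ) ≤ (s + κ / 8) * ℓ → False := by
  have hs : 0 < s * (1 - s) := mul_pos s0 (by linarith)
  have hs' : s * (1 - s) ≤ 1 := by nlinarith
  have κ0 : 0 < κ := by
    have : 0 < (s * (1 - s) / 2000) ^ 2 := by positivity
    linarith
  have κ1 : κ ≤ 1 := by nlinarith
  set c' : ℝ := (|(γ : ℝ)| + |(ζ : ℝ)| + 1) * c with hc'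
  have c'1 : 1 ≤ c' := by
    have := abs_nonneg (γ : ℝ); have := abs_nonneg (ζ : ℝ)
    nlinarith
  obtain ⟨ℓ1, hℓ1⟩ := stepC s κ c' θ μ k1 k2 s0 s1 hκ c'1 hθ hμ hk1 hk2
  have ha : (1 : ℝ) ≤ |(α : ℝ)| := by
    rw [← Int.cast_abs]; exact_mod_cast Int.one_le_abs hα
  have la : 0 ≤ log |(α : ℝ)| := log_nonneg ha
  refine ⟨max ℓ1 (max 1 ((log 2 + log |(α : ℝ)|) / (κ / 2))), ?_⟩
  intro ℓ hℓ Ω _ p x y h HA HB HM HQ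
  simp only [max_le_iff, div_le_iff₀ (show (0 : ℝ) < κ / 2 by linarith)] at hℓ
  obtain ⟨g1, g2, g3⟩ := hℓ
  have hp := h.prob
  set E : Ω → Prop := fun ω => ¬ (|α * x ω + β * y ω| ≤ θ * exp ℓ ∨ |γ * x ω + ζ * y ω| ≤ θ * exp ℓ) with hE
  have w1 : 1 - κ / 4 ≤ Pb p E := by
    have q1 := Pb_compl hp (fun ω => |α * x ω + β * y ω| ≤ θ * exp ℓ ∨ |γ * x ω + ζ * y ω| ≤ θ * exp ℓ)
    have q2 := Pb_or hp.nn (fun ω => |α * x ω + β * y ω| ≤ θ * exp ℓ) (fun ω => |γ * x ω + ζ * y ω| ≤ θ * exp ℓ)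
    have q3 := h.small' α β (Or.inl hα)
    have q4 := h.small' γ ζ (by
      by_contra hh
      push Not at hh
      apply hd; rw [hh.1, hh.2]; ring)
    linarith
  have w0 : 0 < Pb p E := by linarith
  have hq := rst_isP hp E w0
  have tr : ∀ (X : ℝ), 0 ≤ X → Pb p E * X ≤ (s + κ / 8) * ℓ → X ≤ (s + κ) * ℓ := by
    intro X hX hb
    have t1 : (1 - κ / 4) * X ≤ (s + κ / 8) * ℓ := le_trans (mul_le_mul_of_nonneg_right w1 hX) hb
    have t2 : (s + κ / 8) * ℓ ≤ (1 - κ / 4) * ((s + κ) * ℓ) := by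
      have : (1 - κ / 4) * ((s + κ) * ℓ) - (s + κ / 8) * ℓ = κ * ℓ * (7 / 8 - s / 4 - κ / 4) := by ring
      have : 0 ≤ κ * ℓ * (7 / 8 - s / 4 - κ / 4) := by
        refine mul_nonneg (mul_nonneg κ0.le (by linarith)) (by linarith)
      linarith
    exact le_of_mul_le_mul_left (t1.trans t2) (by linarith)
  have trH : ∀ {S : Type} (f : Ω → S), H p f ≤ (s + κ / 8) * ℓ → H (rst p E) f ≤ (s + κ) * ℓ := by
    intro S f hf
    exact tr _ (H_nonneg hq f) ((H_restrict hp hq f _ w0.le (rst_le hp E w0)).trans hf)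
  refine hℓ1 ℓ g1 Ω (rst p E) (fun ω => α * x ω + β * y ω) (fun ω => γ * x ω + ζ * y ω) ?_
  refine ⟨hq, ?_, ?_, ?_, ?_, ?_, trH _ HA, trH _ HB, trH _ HM, trH _ HQ⟩
  · intro ω
    obtain ⟨m, hm⟩ := h.intx ω
    obtain ⟨k, hk⟩ := h.inty ω
    exact ⟨α * m + β * k, by rw [hm, hk]; push_cast; ring⟩
  · intro ω hω
    have := (rst_ne hω).1
    rw [hE] at this
    simp only [not_or, not_le] at this
    exact this.1.le
  · intro ω hω
    have := (rst_ne hω).1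
    rw [hE] at this
    simp only [not_or, not_le] at this
    exact this.2.le
  · intro ω hω
    have b1 := h.bx ω (rst_ne hω).2
    have b2 := h.by_ ω (rst_ne hω).2
    have b3 := abs_add_le (γ * x ω) (ζ * y ω)
    rw [abs_mul, abs_mul] at b3
    have b4 := mul_le_mul_of_nonneg_left b1 (abs_nonneg (γ : ℝ))
    have b5 := mul_le_mul_of_nonneg_left b2 (abs_nonneg (ζ : ℝ))
    have b6 : 0 < c * exp ℓ := mul_pos (by linarith) (exp_pos _)
    have : c' * exp ℓ = |(γ : ℝ)| * (c * exp ℓ) + |(ζ : ℝ)| * (c * exp ℓ) + c * exp ℓ := by rw [hc']; ring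
    show |γ * x ω + ζ * y ω| ≤ c' * exp ℓ
    linarith
  · intro i z ρ hρ
    refine (rst_Pb hp E w0 _).trans ?_
    rw [div_le_iff₀ w0]
    refine (h.joint α β γ ζ hα hd i z ρ hρ).trans ?_
    have half : exp (-log 2) ≤ Pb p E := by
      rw [exp_neg, exp_log (by norm_num)]; linarith
    refine le_trans ?_ (mul_le_mul_of_nonneg_left half (exp_pos _).le)
    rw [← exp_add, ← exp_add, exp_le_exp, log_mul (by linarith) (by linarith)]
    have : s * log |(α : ℝ)| ≤ log |(α : ℝ)| := mul_le_of_le_one_left la s1.le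
    have e1 : 0 ≤ κ * ℓ := mul_nonneg κ0.le (by linarith)
    nlinarith

end stepL
end CF

namespace CF
open Classical Finset

section stepR
variable {Ω Ω' Ω'' S S' S'' T : Type*} [Fintype Ω] [Fintype Ω'] [Fintype Ω'']

theorem Hf_int {p : Ω → ℝ} (hp : IsP p) (f : Ω → ℝ) (hf : ∀ ω, ∃ m : ℤ, f ω = m) : Hf p f = H p f := by
  unfold Hf
  refine H_eq_of_iff hp _ _ ?_
  intro ω ω'
  obtain ⟨m, hm⟩ := hf ω
  obtain ⟨k, hk⟩ := hf ω'
  simp [hm, hk]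

/-- independent sum from the dependent one -/
theorem indep_sum {p : Ω → ℝ} (hp : IsP p) (x y : Ω → ℝ) :
    H (prd p p) (fun w => x w.1 + y w.2) + H p (fun ω => (y ω, x ω)) ≤
      H p (fun ω => x ω + y ω) + H (prd p p) (fun w => y w.1 - y w.2) + H p x := by
  have hP := prd_isP hp hp
  have sm := H_SM hP (fun w => x w.1 + y w.2) (fun w => (x w.1 + y w.1, y w.1 - y w.2)) (fun w => (x w.1, y w.2)) 0
    (by
      rw [add_zero]
      refine H_le_of_imp hP _ _ ?_
      intro w w' _ _ h
      simp only [Prod.mk.injEq] at h ⊢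
      exact ⟨by linarith [h.1, h.2], h⟩)
    (by
      intro w w' _ _ h
      simp only [Prod.mk.injEq] at h
      rw [h.1, h.2])
  have e1 := H_sub hP (fun w => x w.1 + y w.1) (fun w => y w.1 - y w.2)
  have e2 : H (prd p p) (fun w => x w.1 + y w.1) = H p (fun ω => x ω + y ω) := by
    have := (MP_fst hp (p := p)).H_eq (fun ω => x ω + y ω)
    exact this
  have e3 := H_prd hp hp x y
  have e4 := H_prd hp hp (fun ω => (y ω, x ω)) y
  have e5 : H (prd p p) (fun w => ((y w.1, x w.1), y w.2)) ≤
      H (prd p p) (fun w => ((x w.1 + y w.1, y w.1 - y w.2), (x w.1, y w.2))) := by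
    refine H_le_of_imp hP _ _ ?_
    intro w w' _ _ h
    simp only [Prod.mk.injEq] at h ⊢
    refine ⟨⟨by linarith [h.1.1, h.2.1], h.2.1⟩, h.2.2⟩
  linarith

theorem diff_x {p : Ω → ℝ} (hp : IsP p) (x y : Ω → ℝ) :
    H (prd p p) (fun w => x w.1 - x w.2) + H p y ≤ 2 * H (prd p p) (fun w => x w.1 + y w.2) := by
  have hP := prd_isP hp hp
  have hQ := prd_isP hp hP
  have sm := H_SM hQ (fun w => x w.2.1 - x w.2.2) (fun w => (x w.2.1 + y w.1, x w.2.2 + y w.1)) (fun w => (x w.2.1, x w.2.2)) 0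
    (by
      rw [add_zero]
      refine H_le_of_imp hQ _ _ ?_
      intro w w' _ _ h
      simp only [Prod.mk.injEq] at h ⊢
      exact ⟨by linarith [h.1, h.2], h⟩)
    (by
      intro w w' _ _ h
      simp only [Prod.mk.injEq] at h
      rw [h.1, h.2])
  have e1 := H_sub hQ (fun w => x w.2.1 + y w.1) (fun w => x w.2.2 + y w.1)
  have a1 : H (prd p (prd p p)) (fun w => x w.2.1 - x w.2.2) = H (prd p p) (fun w => x w.1 - x w.2) := by
    have := (MP_snd hp (q := prd p p)).H_eq (fun w => x w.1 - x w.2)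
    exact this
  have sw : H (prd p p) (fun w => x w.2 + y w.1) = H (prd p p) (fun w => x w.1 + y w.2) := by
    have := (MP_swap (p := p) (q := p)).H_eq (fun w => x w.1 + y w.2)
    exact this
  have a2 : H (prd p (prd p p)) (fun w => x w.2.1 + y w.1) = H (prd p p) (fun w => x w.2 + y w.1) := by
    have := ((MP_id (p := p)).prd (MP_fst hp (p := p))).H_eq (fun w => x w.2 + y w.1)
    exact this
  have a3 : H (prd p (prd p p)) (fun w => x w.2.2 + y w.1) = H (prd p p) (fun w => x w.2 + y w.1) := by
    have := ((MP_id (p := p)).prd (MP_snd hp (q := p))).H_eq (fun w => x w.2 + y w.1)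
    exact this
  have a4 : H (prd p (prd p p)) (fun w => (x w.2.1, x w.2.2)) = H (prd p p) (fun w => (x w.1, x w.2)) := by
    have := (MP_snd hp (q := prd p p)).H_eq (fun w => (x w.1, x w.2))
    exact this
  have e4 := H_prd hp hP y (fun w => (x w.1, x w.2))
  have e5 : H (prd p (prd p p)) (fun w => (y w.1, (x w.2.1, x w.2.2))) ≤
      H (prd p (prd p p)) (fun w => ((x w.2.1 + y w.1, x w.2.2 + y w.1), (x w.2.1, x w.2.2))) := by
    refine H_le_of_imp hQ _ _ ?_
    intro w w' _ _ h
    simp only [Prod.mk.injEq] at h ⊢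
    refine ⟨by linarith [h.1.1, h.2.1], h.2⟩
  linarith

/-- dependent form from independent one -/
theorem dep_form {p : Ω → ℝ} (hp : IsP p) (x y : Ω → ℝ) (α β : ℝ) :
    H p (fun ω => α * x ω + β * y ω) + H p y ≤
      H (prd p p) (fun w => α * x w.1 + β * y w.2) + H (prd p p) (fun w => y w.1 - y w.2) := by
  have hP := prd_isP hp hp
  have sm := H_SM hP (fun w => α * x w.1 + β * y w.1) (fun w => (α * x w.1 + β * y w.2, y w.1 - y w.2))
    (fun w => (x w.1, y w.1)) 0
    (by
      rw [add_zero]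
      refine H_le_of_imp hP _ _ ?_
      intro w w' _ _ h
      simp only [Prod.mk.injEq] at h ⊢
      refine ⟨?_, h⟩
      linear_combination h.1 + β * h.2)
    (by
      intro w w' _ _ h
      simp only [Prod.mk.injEq] at h
      rw [h.1, h.2])
  have e1 := H_sub hP (fun w => α * x w.1 + β * y w.2) (fun w => y w.1 - y w.2)
  have e2 : H (prd p p) (fun w => α * x w.1 + β * y w.1) = H p (fun ω => α * x ω + β * y ω) := by
    have := (MP_fst hp (p := p)).H_eq (fun ω => α * x ω + β * y ω)
    exact this
  have e3 : H (prd p p) (fun w => (x w.1, y w.1)) = H p (fun ω => (x ω, y ω)) := by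
    have := (MP_fst hp (p := p)).H_eq (fun ω => (x ω, y ω))
    exact this
  have e4 := H_prd hp hp (fun ω => (x ω, y ω)) y
  have e5 : H (prd p p) (fun w => ((x w.1, y w.1), y w.2)) ≤
      H (prd p p) (fun w => ((α * x w.1 + β * y w.2, y w.1 - y w.2), (x w.1, y w.1))) := by
    refine H_le_of_imp hP _ _ ?_
    intro w w' _ _ h
    simp only [Prod.mk.injEq] at h ⊢
    refine ⟨h.2, by linarith [h.1.2, h.2.2]⟩
  linarith

theorem stepR2 {p : Ω → ℝ} {x y : Ω → ℝ} {s κ ℓ c θ δ : ℝ} (h : LHyp p x y s κ ℓ c θ δ) (big : 1 ≤ κ * ℓ)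
    (hx : H p x ≤ (s + κ) * ℓ) (hm : H p (fun ω => x ω + y ω) ≤ (s + κ) * ℓ)
    (hT : H (prd p p) (fun w => y w.1 - y w.2) ≤ (s + κ) * ℓ) (α : ℕ) (β : ℤ) :
    H p (fun ω => α * x ω + β * y ω) ≤ s * ℓ + 30 * (α + |(β : ℝ)| + 1) * (κ * ℓ) := by
  have hp := h.prob
  have hP := prd_isP hp hp
  have hQ := prd_isP hp hP
  set e := κ * ℓ with he
  set t := s * ℓ with ht
  have r1 : (s + κ) * ℓ = t + e := by rw [he, ht]; ring
  have r2 : (s - κ) * ℓ = t - e := by rw [he, ht]; ring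
  rw [r1] at hx hm hT
  have ylo := h.Hy_lo
  have xylo := h.Hxy_lo
  have xlo := h.Hlin_lo 0
  simp only [zero_mul, add_zero] at xlo
  rw [r2] at ylo xylo xlo
  have iy : ∀ ω, ∃ m : ℤ, y ω = m := h.inty
  have ix : ∀ ω, ∃ m : ℤ, x ω = m := h.intx
  have fx : Hf p x = H p x := Hf_int hp x ix
  have fy : Hf p y = H p y := Hf_int hp y iy
  have yhi : H p y ≤ t + e := by
    have := H_ge_l hp hp y (fun ω => - y ω)
    simp only [← sub_eq_add_neg] at this
    linarith
  have S1 : H (prd p p) (fun w => x w.1 + y w.2) ≤ t + 5 * e := by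
    have := indep_sum hp x y
    linarith
  have V1 : H (prd p p) (fun w => x w.1 - x w.2) ≤ t + 11 * e := by
    have := diff_x hp x y
    linarith
  have S1f : Hf (prd p p) (fun w => x w.1 + y w.2) ≤ t + 5 * e := by
    rw [Hf_int hP]
    · exact S1
    · intro w
      obtain ⟨m, hm⟩ := ix w.1
      obtain ⟨k, hk⟩ := iy w.2
      exact ⟨m + k, by rw [hm, hk]; push_cast; ring⟩
  have S2f : Hf (prd p p) (fun w => y w.1 + 1 * x w.2) ≤ t + 5 * e := by
    have : Hf (prd p p) (fun w => y w.1 + 1 * x w.2) = Hf (prd p p) (fun w => x w.1 + y w.2) := by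
      unfold Hf
      have := (MP_swap (p := p) (q := p)).H_eq (fun w => ⌊x w.1 + y w.2⌋)
      rw [← this]
      congr 1
      funext w
      simp [add_comm]
    linarith
  have T1f : Hf (prd p p) (fun w => y w.1 + (-1) * y w.2) ≤ t + e := by
    rw [Hf_int hP]
    · refine le_trans (le_of_eq ?_) hT
      congr 1; funext w; ring
    · intro w
      obtain ⟨m, hm⟩ := iy w.1
      obtain ⟨k, hk⟩ := iy w.2
      exact ⟨m - k, by rw [hm, hk]; push_cast; ring⟩
  have Y1f : Hf (prd p p) (fun w => y w.1 + 1 * y w.2) ≤ t + 19 * e := by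
    have k1 := KV hp hp hp x y y
    have k2 := Hf_ge hP hp (fun w => y w.1 + y w.2) x
    have k3 : Hf (prd (prd p p) p) (fun w => (y w.1.1 + y w.1.2) + x w.2) =
        Hf (prd p (prd p p)) (fun w => x w.1 + y w.2.1 + y w.2.2) := by
      unfold Hf
      have := (MP_swap (p := prd p p) (q := p)).H_eq (fun w => ⌊x w.1 + y w.2.1 + y w.2.2⌋)
      rw [← this]
      congr 1
      funext w
      congr 1
      simp only [Prod.fst_swap, Prod.snd_swap]
      ring
    simp only [one_mul]
    linarith
  have base : ∀ f : Ω → ℝ, Hf (prd p p) (fun w => y w.1 + 0 * f w.2) ≤ t + e := by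
    intro f
    have : Hf (prd p p) (fun w => y w.1 + 0 * f w.2) = Hf p y := by
      unfold Hf
      have := (MP_fst hp (p := p)).H_eq (fun ω => ⌊y ω⌋)
      rw [← this]
      congr 1; funext w; simp
    linarith
  have Ypos : ∀ k : ℕ, Hf (prd p p) (fun w => y w.1 + (k : ℝ) * y w.2) ≤ t + e + 30 * k * e := by
    intro k
    induction k with
    | zero => simpa using base y
    | succ k ih =>
      have := Stab hp hp y y k 1
      push_cast
      linarith
  have Yneg : ∀ k : ℕ, Hf (prd p p) (fun w => y w.1 + (-(k : ℝ)) * y w.2) ≤ t + e + 30 * k * e := by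
    intro k
    induction k with
    | zero => simpa using base y
    | succ k ih =>
      have := Stab hp hp y y (-(k : ℝ)) (-1)
      rw [show -(k : ℝ) + -1 = -((k + 1 : ℕ) : ℝ) by push_cast; ring] at this
      have q : (30 : ℝ) * ((k + 1 : ℕ) : ℝ) * e = 30 * k * e + 30 * e := by push_cast; ring
      rw [q]
      linarith
  have Yb : Hf (prd p p) (fun w => y w.1 + (β : ℝ) * y w.2) ≤ t + e + 30 * |(β : ℝ)| * e := by
    rcases le_total 0 β with hb | hb
    · obtain ⟨k, hk⟩ := Int.eq_ofNat_of_zero_le hb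
      have := Ypos k
      rw [hk]; simpa using this
    · obtain ⟨k, hk⟩ := Int.eq_ofNat_of_zero_le (neg_nonneg.2 hb)
      have := Yneg k
      have hk' : β = -(k : ℤ) := by omega
      rw [hk']; simpa using this
  have Xa : ∀ k : ℕ, Hf (prd p p) (fun w => y w.1 + (k : ℝ) * x w.2) ≤ t + e + 30 * k * e := by
    intro k
    induction k with
    | zero => simpa using base x
    | succ k ih =>
      have := Stab hp hp y x k 1
      push_cast
      linarith
  have k1 := KV hp hp hp y (fun ω => (α : ℝ) * x ω) (fun ω => (β : ℝ) * y ω)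
  have k2 := Hf_ge hP hp (fun w => (α : ℝ) * x w.1 + (β : ℝ) * y w.2) y
  have k3 : Hf (prd (prd p p) p) (fun w => ((α : ℝ) * x w.1.1 + (β : ℝ) * y w.1.2) + y w.2) =
      Hf (prd p (prd p p)) (fun w => y w.1 + (α : ℝ) * x w.2.1 + (β : ℝ) * y w.2.2) := by
    unfold Hf
    have := (MP_swap (p := prd p p) (q := p)).H_eq (fun w => ⌊y w.1 + (α : ℝ) * x w.2.1 + (β : ℝ) * y w.2.2⌋)
    rw [← this]
    congr 1
    funext w
    congr 1
    simp only [Prod.fst_swap, Prod.snd_swap]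
    ring
  have k4 : Hf (prd p p) (fun w => (α : ℝ) * x w.1 + (β : ℝ) * y w.2) = H (prd p p) (fun w => (α : ℝ) * x w.1 + (β : ℝ) * y w.2) := by
    refine Hf_int hP _ ?_
    intro w
    obtain ⟨m, hm⟩ := ix w.1
    obtain ⟨k, hk⟩ := iy w.2
    exact ⟨α * m + β * k, by rw [hm, hk]; push_cast; ring⟩
  have k5 := dep_form hp x y α β
  have k6 := Xa α
  have q : 30 * ((α : ℝ) + |(β : ℝ)| + 1) * e = 30 * α * e + 30 * |(β : ℝ)| * e + 30 * e := by ring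
  rw [q]
  linarith

end stepR
end CF

namespace CF
open Classical Finset

section stepR1
variable {Ω Ω' Ω'' S S' S'' T : Type*} [Fintype Ω] [Fintype Ω'] [Fintype Ω'']

/-- two-sided hypotheses -/
structure PHyp (p : Ω → ℝ) (x y : Ω → ℝ) (s κ ℓ c θ δ : ℝ) : Prop where
  prob : IsP p
  intx : ∀ ω, ∃ m : ℤ, x ω = m
  inty : ∀ ω, ∃ m : ℤ, y ω = m
  bx : ∀ ω, p ω ≠ 0 → |x ω| ≤ c * exp ℓ
  by_ : ∀ ω, p ω ≠ 0 → |y ω| ≤ c * exp ℓ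
  Fx : ∀ z ρ j : ℝ, 1 ≤ ρ → Pb p (fun ω => |x ω - z| ≤ ρ ∧ y ω = j) ≤ exp (κ * ℓ + s * (log ρ - ℓ)) * Pb p (fun ω => y ω = j)
  Sx : ∀ z j : ℝ, Pb p (fun ω => |x ω - z| ≤ θ * exp ℓ ∧ y ω = j) ≤ δ * Pb p (fun ω => y ω = j)
  Fy : ∀ z ρ j : ℝ, 1 ≤ ρ → Pb p (fun ω => |y ω - z| ≤ ρ ∧ x ω = j) ≤ exp (κ * ℓ + s * (log ρ - ℓ)) * Pb p (fun ω => x ω = j)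
  Sy : ∀ z j : ℝ, Pb p (fun ω => |y ω - z| ≤ θ * exp ℓ ∧ x ω = j) ≤ δ * Pb p (fun ω => x ω = j)

theorem PHyp.toL {p : Ω → ℝ} {x y : Ω → ℝ} {s κ ℓ c θ δ : ℝ} (h : PHyp p x y s κ ℓ c θ δ) :
    LHyp p x y s κ ℓ c θ δ :=
  ⟨h.prob, h.intx, h.inty, h.bx, h.by_, h.Fx, h.Sx,
   fun z ρ hρ => Pb_disint1 h.prob x _ _ (fun j => h.Fy z ρ j hρ),
   fun z => Pb_disint1 h.prob x _ _ (fun j => h.Sy z j)⟩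

theorem LHyp.mono {p : Ω → ℝ} {x y : Ω → ℝ} {s κ ℓ c θ δ κ' δ' : ℝ} (h : LHyp p x y s κ ℓ c θ δ)
    (hκ : κ ≤ κ') (hδ : δ ≤ δ') (hℓ : 0 ≤ ℓ) : LHyp p x y s κ' ℓ c θ δ' := by
  have m := mul_le_mul_of_nonneg_right hκ hℓ
  refine ⟨h.prob, h.intx, h.inty, h.bx, h.by_, ?_, ?_, ?_, ?_⟩
  · intro z ρ j hρ
    refine (h.Fx z ρ j hρ).trans (mul_le_mul_of_nonneg_right ?_ (Pb_nn h.prob.nn _))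
    rw [exp_le_exp]; linarith
  · intro z j
    exact (h.Sx z j).trans (mul_le_mul_of_nonneg_right hδ (Pb_nn h.prob.nn _))
  · intro z ρ hρ
    refine (h.Fy z ρ hρ).trans ?_
    rw [exp_le_exp]; linarith
  · intro z
    exact (h.Sy z).trans hδ

theorem rst_Pb_eq (p : Ω → ℝ) (E D : Ω → Prop) : Pb (rst p E) D = Pb p (fun ω => D ω ∧ E ω) / Pb p E := by
  have e : Pb p (fun ω => D ω ∧ E ω) = ∑ ω, if D ω then (if E ω then p ω else 0) else 0 := by
    unfold Pb
    refine Finset.sum_congr rfl fun ω _ => ?_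
    by_cases h1 : D ω <;> by_cases h2 : E ω <;> simp [h1, h2]
  rw [e, Finset.sum_div]
  change ∑ ω, (if D ω then rst p E ω else 0) = _
  refine Finset.sum_congr rfl fun ω _ => ?_
  unfold rst
  by_cases h1 : D ω <;> by_cases h2 : E ω <;> simp [h1, h2]

theorem mix1 {p : Ω → ℝ} (hp : IsP p) (a : Ω → S) (f : Ω → T) :
    ∑ ω', p ω' * H (rst p (fun ω => a ω = a ω')) f ≤ H p f := by
  refine H_mix hp f p hp.nn (fun ω' => rst p (fun ω => a ω = a ω')) ?_ ?_
  · intro i hi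
    exact rst_isP hp _ (Pr_pos hp.nn a hi)
  · intro w
    have e : ∀ ω', p ω' * rst p (fun ω => a ω = a ω') w = (if a ω' = a w then p ω' else 0) * (p w / Pr p a (a w)) := by
      intro ω'
      unfold rst
      by_cases h1 : a w = a ω'
      · rw [if_pos h1, if_pos h1.symm, h1]; rfl
      · have h5 : ¬ (a ω' = a w) := fun h => h1 h.symm
        simp [h1, h5]
    simp only [e]
    rw [← Finset.sum_mul]
    change Pr p a (a w) * _ ≤ _
    by_cases h3 : Pr p a (a w) = 0
    · rw [h3, zero_mul]; exact hp.nn w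
    · rw [mul_div_cancel₀ _ h3]

theorem MP.Pb_eq {p : Ω → ℝ} {pr : Ω → Ω'} {p' : Ω' → ℝ} (h : MP p pr p') (E : Ω' → Prop) :
    Pb p (fun ω => E (pr ω)) = Pb p' E := by
  have := h (fun ω => if E ω then 1 else 0)
  simpa [Pb] using this

theorem cop_F {p : Ω → ℝ} (hp : IsP p) (x y : Ω → ℝ) (E : Ω → Prop) (K i j : ℝ)
    (h : Pb p (fun ω => E ω ∧ y ω = j) ≤ K * Pb p (fun ω => y ω = j)) :
    Pb (cop p y) (fun w => (E w.2 ∧ y w.2 = j) ∧ x w.1 = i) ≤ K * Pb (cop p y) (fun w => y w.2 = j ∧ x w.1 = i) := by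
  have hc := cop_isP hp y
  have e1 := Pr_cop p x E y i True j
  rw [Pr_eq_Pb, Pr_eq_Pb p (fun ω => (x ω, y ω)), Pr_eq_Pb p (fun ω => (E ω, y ω)), Pr_eq_Pb p y] at e1
  have l1 : Pb (cop p y) (fun w => (E w.2 ∧ y w.2 = j) ∧ x w.1 = i) ≤
      Pb (cop p y) (fun w => (x w.1, E w.2, y w.1) = (i, True, j)) := by
    refine Pb_mono hc.nn _ _ ?_
    rintro w hw ⟨⟨h1, h2⟩, h3⟩
    have := (cop_ne hw).1
    simp [h3, h1, this, h2]
  have l2 : Pb p (fun ω => (E ω, y ω) = (True, j)) ≤ Pb p (fun ω => E ω ∧ y ω = j) := by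
    refine Pb_mono hp.nn _ _ ?_
    intro ω _ h1
    simp only [Prod.mk.injEq, eq_iff_iff, iff_true] at h1
    exact h1
  have l3 : Pb p (fun ω => (x ω, y ω) = (i, j)) ≤ Pb (cop p y) (fun w => y w.2 = j ∧ x w.1 = i) := by
    rw [← (MP_cop_fst hp y).Pb_eq]
    refine Pb_mono hc.nn _ _ ?_
    intro w hw h1
    simp only [Prod.mk.injEq] at h1
    exact ⟨by rw [← (cop_ne hw).1, h1.2], h1.1⟩
  have l3' : Pb (cop p y) (fun w => y w.2 = j ∧ x w.1 = i) ≤ Pb p (fun ω => (x ω, y ω) = (i, j)) := by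
    rw [← (MP_cop_fst hp y).Pb_eq]
    refine Pb_mono hc.nn _ _ ?_
    rintro w hw ⟨h1, h2⟩
    simp only [Prod.mk.injEq]
    exact ⟨h2, by rw [(cop_ne hw).1, h1]⟩
  rw [le_antisymm l3' l3]
  refine l1.trans ?_
  rw [e1]
  have n1 := Pb_nn hp.nn (fun ω => (x ω, y ω) = (i, j))
  rcases eq_or_lt_of_le (Pb_nn hp.nn (fun ω => y ω = j)) with h0 | h0
  · have : Pb p (fun ω => (x ω, y ω) = (i, j)) ≤ Pb p (fun ω => y ω = j) := by
      refine Pb_mono hp.nn _ _ ?_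
      intro ω _ h1
      simp only [Prod.mk.injEq] at h1
      exact h1.2
    have z : Pb p (fun ω => (x ω, y ω) = (i, j)) = 0 := by linarith
    rw [z]; simp
  · rw [div_le_iff₀ h0]
    have := mul_le_mul_of_nonneg_left (l2.trans h) n1
    linarith

theorem stepR1 {p : Ω → ℝ} {x y : Ω → ℝ} {s τ ℓ c θ δ : ℝ} (h : PHyp p x y s (τ ^ 2) ℓ c θ δ)
    (s1 : s ≤ 1) (τ0 : 0 < τ) (τ1 : τ ≤ 1) (hℓ : 0 < ℓ) (φ : Ω → ℝ)
    (hx : H p x ≤ (s + τ ^ 2) * ℓ) (hy : H p y ≤ (s + τ ^ 2) * ℓ) (hm : H p (fun ω => x ω + y ω) ≤ (s + τ ^ 2) * ℓ)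
    (hφ : Hf p φ ≤ (s + τ ^ 2) * ℓ) :
    ∃ P : Ω × Ω → ℝ, LHyp P (fun w => x w.2) (fun w => y w.2) s (τ ^ 2) ℓ c θ δ ∧
      H P (fun w => x w.2) ≤ (s + 20 * τ) * ℓ ∧ H P (fun w => x w.2 + y w.2) ≤ (s + 20 * τ) * ℓ ∧
      H (prd P P) (fun w => y w.1.2 - y w.2.2) ≤ (s + 20 * τ) * ℓ ∧ Hf P (fun w => φ w.2) ≤ (s + 20 * τ) * ℓ := by
  have hp := h.prob
  have hc := cop_isP hp y
  set R : Ω × Ω → Ω × Ω → ℝ := fun w' => rst (cop p y) (fun w => x w.1 = x w'.1) with hR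
  have hL : ∀ w', cop p y w' ≠ 0 → LHyp (R w') (fun w => x w.2) (fun w => y w.2) s (τ ^ 2) ℓ c θ δ := by
    intro w' hw'
    have pos : 0 < Pb (cop p y) (fun w => x w.1 = x w'.1) := Pr_pos hc.nn (fun w => x w.1) hw'
    have pe : Pb (cop p y) (fun w => x w.1 = x w'.1) = Pb p (fun ω => x ω = x w'.1) := by
      have := (MP_cop_fst hp y).Pb_eq (fun ω => x ω = x w'.1)
      exact this
    have Fgen : ∀ (E : Ω → Prop) (K j : ℝ), Pb p (fun ω => E ω ∧ y ω = j) ≤ K * Pb p (fun ω => y ω = j) →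
        Pb (R w') (fun w => E w.2 ∧ y w.2 = j) ≤ K * Pb (R w') (fun w => y w.2 = j) := by
      intro E K j hK
      rw [hR]
      simp only
      rw [rst_Pb_eq, rst_Pb_eq, ← mul_div_assoc]
      exact div_le_div_of_nonneg_right (cop_F hp x y E K _ j hK) pos.le
    have Ggen : ∀ (E : ℝ → Prop) (K : ℝ), Pb p (fun ω => E (y ω) ∧ x ω = x w'.1) ≤ K * Pb p (fun ω => x ω = x w'.1) →
        Pb (R w') (fun w => E (y w.2)) ≤ K := by
      intro E K hK
      rw [hR]
      simp only
      rw [rst_Pb_eq, div_le_iff₀ pos, pe]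
      refine le_trans ?_ hK
      rw [← (MP_cop_fst hp y).Pb_eq]
      refine Pb_mono hc.nn _ _ ?_
      intro w hw h1
      rw [(cop_ne hw).1]; exact h1
    refine ⟨rst_isP hc _ pos, fun w => h.intx w.2, fun w => h.inty w.2, ?_, ?_, ?_, ?_, ?_, ?_⟩
    · intro w hw
      exact h.bx _ (cop_ne (rst_ne hw).2).2.2
    · intro w hw
      exact h.by_ _ (cop_ne (rst_ne hw).2).2.2
    · intro z ρ j hρ
      exact Fgen (fun ω => |x ω - z| ≤ ρ) _ j (h.Fx z ρ j hρ)
    · intro z j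
      exact Fgen (fun ω => |x ω - z| ≤ θ * exp ℓ) _ j (h.Sx z j)
    · intro z ρ hρ
      exact Ggen (fun t => |t - z| ≤ ρ) _ (h.Fy z ρ _ hρ)
    · intro z
      exact Ggen (fun t => |t - z| ≤ θ * exp ℓ) _ (h.Sy z _)
  have L0 := h.toL
  have a1 : ∑ w', cop p y w' * H (R w') (fun w => x w.2) ≤ (s + τ ^ 2) * ℓ := by
    refine (mix1 hc (fun w => x w.1) _).trans ?_
    rw [H_cop_snd hp y x]; exact hx
  have a2 : ∑ w', cop p y w' * H (R w') (fun w => x w.2 + y w.2) ≤ (s + τ ^ 2) * ℓ := by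
    refine (mix1 hc (fun w => x w.1) _).trans ?_
    rw [H_cop_snd hp y (fun ω => x ω + y ω)]; exact hm
  have a3 : ∑ w', cop p y w' * Hf (R w') (fun w => φ w.2) ≤ (s + τ ^ 2) * ℓ := by
    unfold Hf
    refine (mix1 hc (fun w => x w.1) _).trans ?_
    rw [H_cop_snd hp y (fun ω => ⌊φ ω⌋)]; exact hφ
  have a4 : ∑ w', cop p y w' * H (prd (R w') (R w')) (fun w => y w.1.2 - y w.2.2) ≤ (s + 9 * τ ^ 2) * ℓ := by
    refine (cond_mix hc (fun w => x w.1) _).trans ?_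
    have d := diff_ent hc (fun w => x w.1) (fun w => y w.1) 1 one_ne_zero
    rw [H_cop_fst hp y (fun ω => (y ω, x ω)), H_cop_fst hp y x, H_cop_fst hp y (fun ω => x ω + 1 * y ω), H_cop_fst hp y y] at d
    simp only [one_mul] at d
    have e : H (cop (cop p y) (fun w => x w.1)) (fun w => y w.1.2 - y w.2.2) ≤
        H (cop (cop p y) (fun w => x w.1)) (fun w => y w.1.1 - y w.2.1) := by
      refine H_le_of_imp (cop_isP hc _) _ _ ?_
      intro w w' hw hw' q
      have q1 := (cop_ne (cop_ne hw).2.1).1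
      have q2 := (cop_ne (cop_ne hw).2.2).1
      have q3 := (cop_ne (cop_ne hw').2.1).1
      have q4 := (cop_ne (cop_ne hw').2.2).1
      rw [← q1, ← q2, ← q3, ← q4]; exact q
    have l1 := L0.Hxy_lo
    have l2 := L0.Hy_lo
    have r1 : (s + τ ^ 2) * ℓ = s * ℓ + τ ^ 2 * ℓ := by ring
    have r2 : (s - τ ^ 2) * ℓ = s * ℓ - τ ^ 2 * ℓ := by ring
    have r3 : (s + 9 * τ ^ 2) * ℓ = s * ℓ + 9 * (τ ^ 2 * ℓ) := by ring
    rw [r1] at hx hy hm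
    rw [r2] at l1 l2
    rw [r3]
    linarith
  set L := (s - τ ^ 2) * ℓ with hLd
  set F : Ω × Ω → ℝ := fun w' => τ * Hf (R w') (fun w => φ w.2) + ((H (R w') (fun w => x w.2) - L) +
    (H (R w') (fun w => x w.2 + y w.2) - L) + (H (prd (R w') (R w')) (fun w => y w.1.2 - y w.2.2) - L)) with hF
  have avg : ∑ w', cop p y w' * F w' ≤ τ * ((s + τ ^ 2) * ℓ) + 14 * (τ ^ 2 * ℓ) := by
    have sp : ∑ w', cop p y w' * F w' = τ * ∑ w', cop p y w' * Hf (R w') (fun w => φ w.2) +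
       ∑ w', cop p y w' * H (R w') (fun w => x w.2) + ∑ w', cop p y w' * H (R w') (fun w => x w.2 + y w.2) +
       ∑ w', cop p y w' * H (prd (R w') (R w')) (fun w => y w.1.2 - y w.2.2) - 3 * L * ∑ w', cop p y w' := by
      rw [Finset.mul_sum, Finset.mul_sum, ← Finset.sum_add_distrib, ← Finset.sum_add_distrib, ← Finset.sum_add_distrib, ← Finset.sum_sub_distrib]
      refine Finset.sum_congr rfl fun w' _ => ?_
      rw [hF]; ring
    rw [sp, hc.sum]
    have := mul_le_mul_of_nonneg_left a3 τ0.le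
    have r1 : (s + τ ^ 2) * ℓ = s * ℓ + τ ^ 2 * ℓ := by ring
    have r2 : L = s * ℓ - τ ^ 2 * ℓ := by rw [hLd]; ring
    have r3 : (s + 9 * τ ^ 2) * ℓ = s * ℓ + 9 * (τ ^ 2 * ℓ) := by ring
    rw [r1] at a1 a2
    rw [r3] at a4
    rw [r2]
    linarith
  obtain ⟨w', hw', hle⟩ := exists_le_avg hc F _ avg
  have hl := hL w' hw'
  have hq := hl.prob
  have n1 : L ≤ H (R w') (fun w => x w.2) := by
    have := hl.Hlin_lo 0
    simpa using this
  have n2 : L ≤ H (R w') (fun w => x w.2 + y w.2) := by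
    have := hl.Hlin_lo 1
    simpa using this
  have n3 : L ≤ H (prd (R w') (R w')) (fun w => y w.1.2 - y w.2.2) := by
    have q1 := H_ge_l hq hq (fun w => y w.2) (fun w => - y w.2)
    simp only [← sub_eq_add_neg] at q1
    exact hl.Hy_lo.trans q1
  have n4 : 0 ≤ Hf (R w') (fun w => φ w.2) := H_nonneg hq _
  have n4' := mul_nonneg τ0.le n4
  rw [hF] at hle
  simp only at hle
  have up : τ * ((s + τ ^ 2) * ℓ) + 14 * (τ ^ 2 * ℓ) ≤ 16 * (τ * ℓ) := by
    have t2 : τ ^ 2 ≤ 1 := by nlinarith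
    have t3 : (s + τ ^ 2) + 14 * τ ≤ 16 := by linarith
    have t4 := mul_le_mul_of_nonneg_left t3 (mul_pos τ0 hℓ).le
    nlinarith
  have Lle : L ≤ s * ℓ := by
    have : 0 ≤ τ ^ 2 * ℓ := by positivity
    rw [hLd]; linarith
  have r5 : (s + 20 * τ) * ℓ = s * ℓ + 20 * (τ * ℓ) := by ring
  have tl : 0 < τ * ℓ := mul_pos τ0 hℓ
  refine ⟨R w', hl, by rw [r5]; linarith, by rw [r5]; linarith, by rw [r5]; linarith, ?_⟩
  have f1 : τ * Hf (R w') (fun w => φ w.2) ≤ τ * ((s + τ ^ 2) * ℓ + 14 * (τ * ℓ)) := by nlinarith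
  have f2 := le_of_mul_le_mul_left f1 τ0
  have f3 : τ ^ 2 * ℓ ≤ τ * ℓ := by
    refine mul_le_mul_of_nonneg_right ?_ hℓ.le
    nlinarith
  rw [r5]
  linarith

theorem kappaC {s : ℝ} (s0 : 0 < s) (s1 : s < 1) : 0 < (s * (1 - s) / 2000) ^ 2 / 40 ∧ (s * (1 - s) / 2000) ^ 2 / 40 ≤ 1 := by
  have hs : 0 < s * (1 - s) := mul_pos s0 (by linarith)
  have hs' : s * (1 - s) ≤ 1 := by nlinarith
  constructor
  · positivity
  · have : s * (1 - s) / 2000 ≤ 1 := by linarith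
    have : 0 ≤ s * (1 - s) / 2000 := by positivity
    nlinarith

theorem nondiag (s : ℝ) (s0 : 0 < s) (s1 : s < 1) (α γ α' : ℕ) (β ζ β' : ℤ) (μ k1 k2 : ℝ)
    (hμ : μ ≠ 0) (hk1 : k1 ≠ 0) (hk2 : k2 ≠ 0) (hα : α ≠ 0) (hd : (α : ℤ) * ζ - β * γ ≠ 0)
    (e1 : (α' : ℝ) = α + μ * γ) (e2 : (β' : ℝ) = β + μ * ζ) :
    ∃ κ : ℝ, 0 < κ ∧ ∀ c θ : ℝ, 1 ≤ c → 0 < θ → ∃ ℓ0 : ℝ, ∀ ℓ, ℓ0 ≤ ℓ → ∀ (Ω : Type) [Fintype Ω] (p x y : Ω → ℝ),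
      PHyp p x y s κ ℓ c θ κ → H p x ≤ (s + κ) * ℓ → H p y ≤ (s + κ) * ℓ → H p (fun ω => x ω + y ω) ≤ (s + κ) * ℓ →
      Hf p (fun ω => (k1 * (α * x ω + β * y ω) ^ 2 + k2 * (γ * x ω + ζ * y ω) ^ 2) / exp ℓ) ≤ (s + κ) * ℓ → False := by
  obtain ⟨κC0, κC1⟩ := kappaC s0 s1
  set κC := (s * (1 - s) / 2000) ^ 2 / 40 with hκC
  set D : ℝ := 30 * (α + γ + α' + |(β : ℝ)| + |(ζ : ℝ)| + |(β' : ℝ)| + 1) with hD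
  have nb := abs_nonneg (β : ℝ)
  have nz := abs_nonneg (ζ : ℝ)
  have nb' := abs_nonneg (β' : ℝ)
  have na : (0 : ℝ) ≤ α := Nat.cast_nonneg _
  have ng : (0 : ℝ) ≤ γ := Nat.cast_nonneg _
  have na' : (0 : ℝ) ≤ α' := Nat.cast_nonneg _
  have D1 : 1 ≤ D := by rw [hD]; linarith
  set τ := κC / (160 * D) with hτ
  have τ0 : 0 < τ := by positivity
  have τD : 20 * τ * D = κC / 8 := by rw [hτ]; field_simp; ring
  have τle : 20 * τ ≤ κC / 8 := by
    rw [← τD]; exact le_mul_of_one_le_right (by linarith) D1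
  have τ1 : τ ≤ 1 := by linarith
  have τ2 : τ ^ 2 ≤ τ := by nlinarith
  refine ⟨τ ^ 2, by positivity, ?_⟩
  intro c θ c1 hθ
  obtain ⟨ℓ1, hℓ1⟩ := fin s κC c θ μ k1 k2 α β γ ζ s0 s1 (by rw [hκC]; ring) c1 hθ hμ hk1 hk2
    (by exact_mod_cast hα) hd
  refine ⟨max ℓ1 (max 1 (1 / (20 * τ))), ?_⟩
  intro ℓ hℓ Ω _ p x y h hx hy hm hφ
  simp only [max_le_iff, div_le_iff₀ (show (0 : ℝ) < 20 * τ by linarith)] at hℓ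
  obtain ⟨g1, g2, g3⟩ := hℓ
  obtain ⟨P, hP, b1, b2, b3, b4⟩ := stepR1 h s1.le τ0 τ1 (by linarith) _ hx hy hm hφ
  have hP2 := hP.mono (show τ ^ 2 ≤ 20 * τ by linarith) (le_refl (τ ^ 2)) (by linarith)
  have R2 := stepR2 hP2 (by linarith) b1 b2 b3
  have key : ∀ (a : ℕ) (b : ℤ), 30 * ((a : ℝ) + |(b : ℝ)| + 1) ≤ D →
      H P (fun w => (a : ℝ) * x w.2 + (b : ℝ) * y w.2) ≤ (s + κC / 8) * ℓ := by
    intro a b hab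
    refine (R2 a b).trans ?_
    have t1 : 0 ≤ 20 * τ * ℓ := mul_nonneg (by linarith) (by linarith)
    have t2 := mul_le_mul_of_nonneg_right hab t1
    have t3 : D * (20 * τ * ℓ) = κC / 8 * ℓ := by rw [← τD]; ring
    have t4 : (s + κC / 8) * ℓ = s * ℓ + κC / 8 * ℓ := by ring
    rw [t4, ← t3]
    linarith
  refine hℓ1 ℓ g1 (Ω × Ω) P (fun w => x w.2) (fun w => y w.2) (hP.mono (by linarith) (by linarith) (by linarith)) ?_ ?_ ?_ ?_
  · have := key α β (by rw [hD]; linarith)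
    simpa using this
  · have := key γ ζ (by rw [hD]; linarith)
    simpa using this
  · have := key α' β' (by rw [hD]; linarith)
    refine le_trans (le_of_eq ?_) this
    congr 1
    funext w
    rw [e1, e2]; push_cast; ring
  · have : (s + 20 * τ) * ℓ ≤ (s + κC / 8) * ℓ := mul_le_mul_of_nonneg_right (by linarith) (by linarith)
    refine le_trans ?_ (b4.trans this)
    simp

theorem diag (s : ℝ) (s0 : 0 < s) (s1 : s < 1) (k1 k2 : ℝ) (hk1 : k1 ≠ 0) (hk2 : k2 ≠ 0) :
    ∀ c θ : ℝ, 1 ≤ c → 0 < θ → ∃ ℓ0 : ℝ, ∀ ℓ, ℓ0 ≤ ℓ → ∀ (Ω : Type) [Fintype Ω] (p x y : Ω → ℝ),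
      PHyp p x y s ((s * (1 - s) / 2000) ^ 2 / 40 / 8) ℓ c θ ((s * (1 - s) / 2000) ^ 2 / 40 / 8) →
      H p x ≤ (s + (s * (1 - s) / 2000) ^ 2 / 40 / 8) * ℓ → H p y ≤ (s + (s * (1 - s) / 2000) ^ 2 / 40 / 8) * ℓ →
      H p (fun ω => x ω + y ω) ≤ (s + (s * (1 - s) / 2000) ^ 2 / 40 / 8) * ℓ →
      Hf p (fun ω => (k1 * x ω ^ 2 + k2 * y ω ^ 2) / exp ℓ) ≤ (s + (s * (1 - s) / 2000) ^ 2 / 40 / 8) * ℓ → False := by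
  intro c θ c1 hθ
  obtain ⟨ℓ1, hℓ1⟩ := fin s ((s * (1 - s) / 2000) ^ 2 / 40) c θ 1 k1 k2 1 0 0 1 s0 s1 (by ring) c1 hθ one_ne_zero hk1 hk2
    (by norm_num) (by norm_num)
  refine ⟨ℓ1, ?_⟩
  intro ℓ hℓ Ω _ p x y h hx hy hm hφ
  refine hℓ1 ℓ hℓ Ω p x y h.toL ?_ ?_ ?_ ?_
  · simpa using hx
  · simpa using hy
  · simpa using hm
  · simpa using hφ

theorem rat_frac (r : ℚ) (h : r ≠ 0) : ∃ (α : ℕ) (β : ℤ), α ≠ 0 ∧ β ≠ 0 ∧ (r : ℝ) = α / β := by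
  rcases lt_or_gt_of_ne h with h0 | h0
  · refine ⟨r.num.natAbs, -(r.den : ℤ), by simpa using h, by simp, ?_⟩
    have : ((r.num.natAbs : ℕ) : ℝ) = -(r.num : ℝ) := by
      have h1 : ((r.num.natAbs : ℕ) : ℤ) = -r.num := by
        have := Rat.num_neg.2 h0
        omega
      have h2 := congrArg (Int.cast : ℤ → ℝ) h1
      simpa using h2
    rw [this, Rat.cast_def]
    push_cast
    rw [neg_div_neg_eq]
  · refine ⟨r.num.natAbs, (r.den : ℤ), by simpa using h, by simp, ?_⟩
    have : ((r.num.natAbs : ℕ) : ℝ) = (r.num : ℝ) := by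
      have h1 : ((r.num.natAbs : ℕ) : ℤ) = r.num := by
        have := Rat.num_pos.2 h0
        omega
      have h2 := congrArg (Int.cast : ℤ → ℝ) h1
      simpa using h2
    rw [this, Rat.cast_def]
    push_cast
    rfl

theorem core (s : ℝ) (s0 : 0 < s) (s1 : s < 1) : ∃ κd : ℝ, 0 < κd ∧ ∀ a₁ a₂ a₃ : ℚ, a₂ ^ 2 - 4 * a₁ * a₃ ≠ 0 →
    ∃ κ : ℝ, 0 < κ ∧ (a₂ = 0 → κ = κd) ∧
    ∀ c θ : ℝ, 1 ≤ c → 0 < θ → ∃ ℓ0 : ℝ, ∀ ℓ, ℓ0 ≤ ℓ → ∀ (Ω : Type) [Fintype Ω] (p x y : Ω → ℝ),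
      PHyp p x y s κ ℓ c θ κ → H p x ≤ (s + κ) * ℓ → H p y ≤ (s + κ) * ℓ → H p (fun ω => x ω + y ω) ≤ (s + κ) * ℓ →
      Hf p (fun ω => ((a₁ : ℝ) * x ω ^ 2 + (a₂ : ℝ) * (x ω * y ω) + (a₃ : ℝ) * y ω ^ 2) / exp ℓ) ≤ (s + κ) * ℓ → False := by
  obtain ⟨κC0, κC1⟩ := kappaC s0 s1
  refine ⟨(s * (1 - s) / 2000) ^ 2 / 40 / 8, by linarith, ?_⟩
  intro a₁ a₂ a₃ hdet
  have hdetR : ((a₂ : ℝ)) ^ 2 - 4 * a₁ * a₃ ≠ 0 := by exact_mod_cast hdet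
  by_cases h2 : a₂ = 0
  · refine ⟨_, by linarith, fun _ => rfl, ?_⟩
    have h1 : (a₁ : ℝ) ≠ 0 := by
      intro h; apply hdetR; rw [h, h2]; simp
    have h3 : (a₃ : ℝ) ≠ 0 := by
      intro h; apply hdetR; rw [h, h2]; simp
    intro c θ c1 hθ
    obtain ⟨ℓ0, H0⟩ := diag s s0 s1 a₁ a₃ h1 h3 c θ c1 hθ
    refine ⟨ℓ0, fun ℓ hℓ Ω _ p x y h hx hy hm hφ => H0 ℓ hℓ Ω p x y h hx hy hm ?_⟩
    rw [h2] at hφ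
    simpa using hφ
  have h2R : (a₂ : ℝ) ≠ 0 := by exact_mod_cast h2
  have main : ∃ (α γ α' : ℕ) (β ζ β' : ℤ) (μ k1 k2 : ℝ), μ ≠ 0 ∧ k1 ≠ 0 ∧ k2 ≠ 0 ∧ α ≠ 0 ∧ (α : ℤ) * ζ - β * γ ≠ 0 ∧
      (α' : ℝ) = α + μ * γ ∧ (β' : ℝ) = β + μ * ζ ∧ ∀ x y : ℝ, k1 * (α * x + β * y) ^ 2 + k2 * (γ * x + ζ * y) ^ 2 =
        (a₁ : ℝ) * x ^ 2 + (a₂ : ℝ) * (x * y) + (a₃ : ℝ) * y ^ 2 := by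
    by_cases h1 : a₁ = 0
    · by_cases h3 : a₃ = 0
      · refine ⟨1, 1, 2, 1, -1, 0, 1, a₂ / 4, -(a₂ / 4), one_ne_zero, by positivity, by simpa using h2, by norm_num, by norm_num,
          by norm_num, by norm_num, ?_⟩
        intro x y
        rw [h1, h3]; push_cast; ring
      · have h3R : (a₃ : ℝ) ≠ 0 := by exact_mod_cast h3
        obtain ⟨α, β, hα, hβ, e⟩ := rat_frac (a₂ / (2 * a₃)) (by positivity)
        have hαR : (α : ℝ) ≠ 0 := by exact_mod_cast hα
        have hβR : (β : ℝ) ≠ 0 := by exact_mod_cast hβ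
        push_cast at e
        rw [div_eq_div_iff (by positivity) hβR] at e
        refine ⟨α, 1, 0, β, 0, β, -α, a₃ / β ^ 2, -(a₂ ^ 2 / (4 * a₃)), neg_ne_zero.2 hαR, by positivity, ?_, hα, by simpa using hβ,
          by simp, by simp, ?_⟩
        · exact neg_ne_zero.2 (by positivity)
        · intro x y
          rw [h1]
          have ea : (α : ℝ) = a₂ * β / (2 * a₃) := by rw [e]; field_simp
          rw [ea]; push_cast; field_simp; ring
    · have h1R : (a₁ : ℝ) ≠ 0 := by exact_mod_cast h1
      obtain ⟨α, β, hα, hβ, e⟩ := rat_frac (2 * a₁ / a₂) (by positivity)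
      have hαR : (α : ℝ) ≠ 0 := by exact_mod_cast hα
      have hβR : (β : ℝ) ≠ 0 := by exact_mod_cast hβ
      push_cast at e
      rw [div_eq_div_iff h2R hβR] at e
      refine ⟨α, 0, α, β, 1, 0, -β, a₁ / α ^ 2, -(a₂ ^ 2 - 4 * a₁ * a₃) / (4 * a₁), neg_ne_zero.2 hβR, by positivity, ?_, hα,
        by simpa using hα, by simp, by simp, ?_⟩
      · exact div_ne_zero (neg_ne_zero.2 hdetR) (by positivity)
      · intro x y
        have ea : (β : ℝ) = α * a₂ / (2 * a₁) := by field_simp; linarith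
        rw [ea]; push_cast; field_simp; ring
  obtain ⟨α, γ, α', β, ζ, β', μ, k1, k2, hμ, hk1, hk2, hα, hd, e1, e2, e3⟩ := main
  obtain ⟨κ, κ0, hκ⟩ := nondiag s s0 s1 α γ α' β ζ β' μ k1 k2 hμ hk1 hk2 hα hd e1 e2
  refine ⟨κ, κ0, fun h => absurd h h2, ?_⟩
  simp only [e3] at hκ
  exact hκ

end stepR1
end CF

namespace CF
open Classical Finset

section step0

/-- the finite model of a finitely valued random variable -/
noncomputable def law {Ω V : Type} [MeasurableSpace Ω] (P : Measure Ω) (T : Ω → V) (F : Finset V) :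
    {v // v ∈ F} → ℝ := fun j => (P (T ⁻¹' {j.1})).toReal

variable {Ω V S : Type} [MeasurableSpace Ω] {P : Measure Ω}

theorem law_Pb [IsProbabilityMeasure P] (T : Ω → V) (hT : ∀ v, MeasurableSet (T ⁻¹' {v})) (F : Finset V)
    (hF : ∀ ω, T ω ∈ F) (E : V → Prop) :
    Pb (law P T F) (fun j => E j.1) = (P {ω | E (T ω)}).toReal := by
  have e1 : Pb (law P T F) (fun j => E j.1) = ∑ v ∈ F, if E v then (P (T ⁻¹' {v})).toReal else 0 := by
    unfold Pb law
    exact Finset.sum_coe_sort F (fun v => if E v then (P (T ⁻¹' {v})).toReal else 0)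
  rw [e1, ← Finset.sum_filter]
  have e2 : {ω | E (T ω)} = ⋃ v ∈ F.filter E, T ⁻¹' {v} := by
    ext ω
    simp only [Set.mem_setOf_eq, Set.mem_iUnion, Set.mem_preimage, Set.mem_singleton_iff, Finset.mem_filter, exists_prop]
    constructor
    · intro h; exact ⟨T ω, ⟨hF ω, h⟩, rfl⟩
    · rintro ⟨v, ⟨_, h⟩, h2⟩; rw [h2]; exact h
  have := measureReal_biUnion_finset (μ := P) (s := F.filter E) (f := fun v => T ⁻¹' {v})
    (by
      intro a _ b _ hab
      refine Set.disjoint_left.2 ?_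
      intro ω h1 h2
      exact hab (h1.symm.trans h2))
    (fun b _ => hT b)
  rw [e2]
  exact this.symm

theorem law_isP [IsProbabilityMeasure P] (T : Ω → V) (hT : ∀ v, MeasurableSet (T ⁻¹' {v})) (F : Finset V)
    (hF : ∀ ω, T ω ∈ F) : IsP (law P T F) := by
  refine ⟨fun _ => ENNReal.toReal_nonneg, ?_⟩
  have := law_Pb (P := P) T hT F hF (fun _ => True)
  unfold Pb at this
  simpa using this

theorem H_image {J : Type} [Fintype J] (p : J → ℝ) (f : J → S) :
    H p f = ∑ t ∈ Finset.univ.image f, -(Pr p f t * log (Pr p f t)) := by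
  unfold H
  rw [← Finset.sum_neg_distrib]
  have : ∀ t, -(Pr p f t * log (Pr p f t)) = ∑ ω, if f ω = t then -(p ω * log (Pr p f (f ω))) else 0 := by
    intro t
    conv_lhs => rw [show Pr p f t * log (Pr p f t) = (∑ ω, if f ω = t then p ω else 0) * log (Pr p f t) by rfl]
    rw [Finset.sum_mul, ← Finset.sum_neg_distrib]
    refine Finset.sum_congr rfl fun ω _ => ?_
    by_cases h : f ω = t
    · rw [if_pos h, if_pos h, h]
    · rw [if_neg h, if_neg h]; simp
  simp only [this]
  rw [Finset.sum_comm]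
  refine Finset.sum_congr rfl fun ω _ => ?_
  rw [Finset.sum_ite_eq]
  simp

theorem law_ent [IsProbabilityMeasure P] (T : Ω → V) (hT : ∀ v, MeasurableSet (T ⁻¹' {v})) (F : Finset V)
    (hF : ∀ ω, T ω ∈ F) (G : V → S) :
    entOf P (fun ω => G (T ω)) = H (law P T F) (fun j => G j.1) / log 2 := by
  have e : ∀ t : S, (P ((fun ω => G (T ω)) ⁻¹' {t})).toReal = Pr (law P T F) (fun j => G j.1) t := by
    intro t
    rw [Pr_eq_Pb]
    exact (law_Pb (P := P) T hT F hF (fun v => G v = t)).symm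
  unfold entOf
  simp only [e]
  rw [H_image, Finset.sum_div]
  rw [tsum_eq_sum (s := Finset.univ.image (fun j : {v // v ∈ F} => G j.1))]
  · refine Finset.sum_congr rfl fun t _ => ?_
    unfold Real.logb
    ring
  · intro t ht
    have : Pr (law P T F) (fun j => G j.1) t = 0 := by
      unfold Pr
      refine Finset.sum_eq_zero fun j _ => if_neg ?_
      intro h
      exact ht (Finset.mem_image.2 ⟨j, Finset.mem_univ _, h⟩)
    rw [this]; simp

theorem frost_disc {U W : Ω → ℝ} {s₁ C₁ C : ℝ} [IsProbabilityMeasure P] (h : FrostmanGiven P U W s₁ C₁)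
    (hs0 : 0 ≤ s₁) (hs1 : s₁ ≤ 1) (hC : C₁ ≤ C) (C0 : 0 ≤ C) (n : ℕ) (z ρ j : ℝ) (hρ : 1 ≤ ρ) :
    (P {ω | |(⌊(2 : ℝ) ^ n * U ω⌋ : ℝ) - z| ≤ ρ ∧ (⌊(2 : ℝ) ^ n * W ω⌋ : ℝ) = j}).toReal ≤
      3 * C * exp (s₁ * (log ρ - n * log 2)) * (P {ω | (⌊(2 : ℝ) ^ n * W ω⌋ : ℝ) = j}).toReal := by
  have L0 : (0 : ℝ) < 2 ^ n := by positivity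
  have hE : MeasurableSet {t : ℝ | (⌊(2 : ℝ) ^ n * t⌋ : ℝ) = j} := by
    have : Measurable (fun t : ℝ => (⌊(2 : ℝ) ^ n * t⌋ : ℝ)) := by
      have h1 : Measurable (fun t : ℝ => ⌊(2 : ℝ) ^ n * t⌋) := Int.measurable_floor.comp (measurable_const.mul measurable_id)
      exact (measurable_from_top (f := fun m : ℤ => (m : ℝ))).comp h1
    exact this (measurableSet_singleton j)
  have h1 := h (z / 2 ^ n) (3 * ρ / 2 ^ n) (by positivity) _ hE
  refine le_trans (le_trans (ENNReal.toReal_mono (measure_ne_top _ _) (measure_mono ?_)) h1) ?_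
  · rintro ω ⟨a1, a2⟩
    refine ⟨?_, a2⟩
    rw [Set.mem_preimage, Metric.mem_ball, Real.dist_eq, lt_div_iff₀ L0]
    have f1 := Int.floor_le ((2 : ℝ) ^ n * U ω)
    have f2 := Int.lt_floor_add_one ((2 : ℝ) ^ n * U ω)
    have e : |U ω - z / 2 ^ n| * 2 ^ n = |(2 : ℝ) ^ n * U ω - z| := by
      rw [← abs_of_pos L0, ← abs_mul, abs_of_pos L0]
      congr 1; field_simp
    rw [e, abs_lt]
    have := abs_le.1 a1
    constructor <;> linarith [this.1, this.2]
  · have e : exp (s₁ * (log ρ - n * log 2)) = (ρ / 2 ^ n) ^ s₁ := by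
      rw [Real.rpow_def_of_pos (by positivity), log_div (by positivity) (by positivity), log_pow]
      congr 1; ring
    refine mul_le_mul_of_nonneg_right ?_ ENNReal.toReal_nonneg
    rw [e, mul_div_assoc, Real.mul_rpow (by norm_num) (by positivity)]
    have t1 : (3 : ℝ) ^ s₁ ≤ 3 := by
      have := Real.rpow_le_rpow_of_exponent_le (x := 3) (by norm_num) hs1
      simpa using this
    have t2 : 0 ≤ (ρ / 2 ^ n) ^ s₁ := by positivity
    have t3 : 0 ≤ (3 : ℝ) ^ s₁ := by positivity
    calc C₁ * (3 ^ s₁ * (ρ / 2 ^ n) ^ s₁) ≤ C * (3 * (ρ / 2 ^ n) ^ s₁) :=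
          mul_le_mul hC (mul_le_mul_of_nonneg_right t1 t2) (by positivity) C0
      _ = _ := by ring

/-- exponent comparison -/
theorem frost_exp {s s₁ ε κ ℓ ρ C : ℝ} (hκ : 4 * ε ≤ κ) (hs : 0 < s) (hℓ : 0 < ℓ) (ε0 : 0 < ε)
    (h1 : s - 3 * ε ≤ s₁) (hρ : 1 ≤ ρ) (hρ2 : log ρ ≤ ℓ) (C1 : 1 ≤ C) (hC : log (3 * C) ≤ ε * ℓ) :
    3 * C * exp (s₁ * (log ρ - ℓ)) ≤ exp (κ * ℓ + s * (log ρ - ℓ)) := by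
  have l0 := log_nonneg hρ
  have e : 3 * C = exp (log (3 * C)) := (exp_log (by linarith)).symm
  rw [e, ← exp_add, exp_le_exp]
  have t1 : (s - 3 * ε) * (ℓ - log ρ) ≤ s₁ * (ℓ - log ρ) := mul_le_mul_of_nonneg_right h1 (by linarith)
  have t2 : 0 ≤ ε * log ρ := mul_nonneg ε0.le l0
  have t3 := mul_le_mul_of_nonneg_right hκ hℓ.le
  nlinarith

end step0
end CF

namespace CF
open Classical Finset

section fin

theorem half_hyp {Ω : Type} [Fintype Ω] {p x y : Ω → ℝ} {s ε κ ℓ C θ s₁ : ℝ} (hp : IsP p)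
    (D : ∀ z ρ j : ℝ, 1 ≤ ρ → Pb p (fun ω => |x ω - z| ≤ ρ ∧ y ω = j) ≤
      3 * C * exp (s₁ * (log ρ - ℓ)) * Pb p (fun ω => y ω = j))
    (hs : 0 < s) (ε0 : 0 < ε) (hκ : 8 * ε ≤ κ) (hεs : 8 * ε ≤ s) (hℓ : 0 < ℓ) (h1 : s - 3 * ε ≤ s₁)
    (C1 : 1 ≤ C) (hC : log (3 * C) ≤ ε * ℓ) (θ0 : 0 < θ) (hθ1 : log θ ≤ 0)
    (hθ2 : s / 2 * log θ ≤ log (κ / (3 * C))) (hθ3 : -log θ ≤ ℓ) :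
    (∀ z ρ j : ℝ, 1 ≤ ρ → Pb p (fun ω => |x ω - z| ≤ ρ ∧ y ω = j) ≤
      exp (κ * ℓ + s * (log ρ - ℓ)) * Pb p (fun ω => y ω = j)) ∧
    (∀ z j : ℝ, Pb p (fun ω => |x ω - z| ≤ θ * exp ℓ ∧ y ω = j) ≤ κ * Pb p (fun ω => y ω = j)) := by
  have κ0 : 0 < κ := by linarith
  constructor
  · intro z ρ j hρ
    by_cases h : log ρ ≤ ℓ
    · refine (D z ρ j hρ).trans (mul_le_mul_of_nonneg_right ?_ (Pb_nn hp.nn _))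
      exact frost_exp (by linarith) hs hℓ ε0 h1 hρ h C1 hC
    · have e1 : Pb p (fun ω => |x ω - z| ≤ ρ ∧ y ω = j) ≤ Pb p (fun ω => y ω = j) :=
        Pb_mono hp.nn _ _ (fun _ _ h => h.2)
      have e2 : 1 ≤ exp (κ * ℓ + s * (log ρ - ℓ)) := by
        rw [one_le_exp_iff]
        push Not at h
        have := mul_pos hs (sub_pos.2 h)
        have := mul_pos κ0 hℓ
        linarith
      exact e1.trans (le_mul_of_one_le_left (Pb_nn hp.nn _) e2)
  · intro z j
    have e1 : log (θ * exp ℓ) = log θ + ℓ := by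
      rw [log_mul θ0.ne' (exp_pos _).ne', log_exp]
    have e2 : 1 ≤ θ * exp ℓ := by
      have : 0 ≤ log (θ * exp ℓ) := by rw [e1]; linarith
      exact (log_nonneg_iff (by positivity)).1 this
    refine (D z _ j e2).trans (mul_le_mul_of_nonneg_right ?_ (Pb_nn hp.nn _))
    rw [e1, add_sub_cancel_right]
    have e3 : s₁ * log θ ≤ log (κ / (3 * C)) := by
      refine le_trans (mul_le_mul_of_nonpos_right (b := s / 2) (by linarith) hθ1) hθ2
    have e4 : exp (s₁ * log θ) ≤ κ / (3 * C) := by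
      rw [← exp_log (show 0 < κ / (3 * C) by positivity)]
      exact exp_le_exp.2 e3
    rw [le_div_iff₀ (by positivity)] at e4
    linarith

theorem half_ent {Ω : Type} [Fintype Ω] {p x y : Ω → ℝ} {ℓ C s₁ : ℝ} (hp : IsP p)
    (D : ∀ z ρ j : ℝ, 1 ≤ ρ → Pb p (fun ω => |x ω - z| ≤ ρ ∧ y ω = j) ≤
      3 * C * exp (s₁ * (log ρ - ℓ)) * Pb p (fun ω => y ω = j))
    (C1 : 1 ≤ C) :
    s₁ * ℓ - log (3 * C) ≤ H p (fun ω => x ω + y ω) ∧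
    H p y + (s₁ * ℓ - log (3 * C)) ≤ H p (fun ω => (y ω, x ω)) := by
  have e0 : 3 * C * exp (s₁ * (log 1 - ℓ)) = exp (-(s₁ * ℓ - log (3 * C))) := by
    have e : 3 * C = exp (log (3 * C)) := (exp_log (by linarith)).symm
    conv_lhs => rw [e]
    rw [← exp_add, log_one]
    congr 1; ring
  have D1 : ∀ z j : ℝ, Pb p (fun ω => x ω = z ∧ y ω = j) ≤
      exp (-(s₁ * ℓ - log (3 * C))) * Pb p (fun ω => y ω = j) := by
    intro z j
    rw [← e0]
    refine le_trans (Pb_mono hp.nn _ _ ?_) (D z 1 j le_rfl)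
    rintro ω _ ⟨h1, h2⟩
    refine ⟨?_, h2⟩
    rw [h1]; simp
  constructor
  · refine H_lower hp _ _ fun t => ?_
    rw [Pr_eq_Pb]
    refine Pb_disint1 hp y _ _ fun j => ?_
    refine le_trans (Pb_mono hp.nn _ _ ?_) (D1 (t - j) j)
    rintro ω _ ⟨h1, h2⟩
    exact ⟨by rw [← h1, ← h2]; ring, h2⟩
  · exact H_cond_lower hp y x _ (fun t u => D1 u t)

theorem fin_step {Ω : Type} [Fintype Ω] {p x y g : Ω → ℝ} {m f : Ω → ℤ}
    {s ε κ ℓ C θ s₁ s₂ c : ℝ} {k : ℕ} (hp : IsP p)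
    (ix : ∀ ω, ∃ m : ℤ, x ω = m) (iy : ∀ ω, ∃ m : ℤ, y ω = m)
    (bx : ∀ ω, p ω ≠ 0 → |x ω| ≤ c * exp ℓ) (by_ : ∀ ω, p ω ≠ 0 → |y ω| ≤ c * exp ℓ)
    (Dx : ∀ z ρ j : ℝ, 1 ≤ ρ → Pb p (fun ω => |x ω - z| ≤ ρ ∧ y ω = j) ≤
      3 * C * exp (s₁ * (log ρ - ℓ)) * Pb p (fun ω => y ω = j))
    (Dy : ∀ z ρ j : ℝ, 1 ≤ ρ → Pb p (fun ω => |y ω - z| ≤ ρ ∧ x ω = j) ≤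
      3 * C * exp (s₂ * (log ρ - ℓ)) * Pb p (fun ω => x ω = j))
    (hm : ∀ ω, p ω ≠ 0 → |x ω + y ω - m ω| ≤ 1)
    (hf : ∀ ω, p ω ≠ 0 → |g ω - f ω| ≤ k)
    (Hxy : H p (fun ω => (x ω, y ω)) < 2 * (s + ε) * ℓ) (Hm : H p m < (s + ε) * ℓ)
    (Hff : H p f < (s + ε) * ℓ) (hs12 : 2 * s ≤ s₁ + s₂)
    (hs : 0 < s) (ε0 : 0 < ε) (hκ : 8 * ε ≤ κ) (hεs : 8 * ε ≤ s) (hℓ : 0 < ℓ)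
    (C1 : 1 ≤ C) (hC : log (3 * C) ≤ ε * ℓ) (θ0 : 0 < θ) (hθ1 : log θ ≤ 0)
    (hθ2 : s / 2 * log θ ≤ log (κ / (3 * C))) (hθ3 : -log θ ≤ ℓ)
    (h2 : 2 ≤ ε * ℓ) (hk : log (2 * (2 * k : ℕ) + 3) ≤ ε * ℓ) :
    PHyp p x y s κ ℓ c θ κ ∧ H p x ≤ (s + κ) * ℓ ∧ H p y ≤ (s + κ) * ℓ ∧
      H p (fun ω => x ω + y ω) ≤ (s + κ) * ℓ ∧ Hf p g ≤ (s + κ) * ℓ := by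
  have hκℓ : 8 * (ε * ℓ) ≤ κ * ℓ := by nlinarith
  have eℓ : 0 < ε * ℓ := mul_pos ε0 hℓ
  have Hs : H p (fun ω => x ω + y ω) ≤ (s + 2 * ε) * ℓ := by
    have h := Hf_near' hp (fun ω => x ω + y ω) m (fun a b ha hb hab => by
      have h1 := abs_le.1 (hm a ha)
      have h2 := abs_le.1 (hm b hb)
      rw [hab] at h1
      rw [abs_le]
      constructor <;> linarith [h1.1, h1.2, h2.1, h2.2])
    rw [Hf_int hp _ (fun ω => by
      obtain ⟨a, ha⟩ := ix ω
      obtain ⟨b, hb⟩ := iy ω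
      exact ⟨a + b, by push_cast; rw [ha, hb]⟩)] at h
    linarith
  have Hg : Hf p g ≤ (s + 2 * ε) * ℓ := by
    have h := Hf_near_k hp g f (2 * k) (fun a b ha hb hab => by
      have h1 := abs_le.1 (hf a ha)
      have h2 := abs_le.1 (hf b hb)
      rw [hab] at h1
      push_cast
      rw [abs_le]
      constructor <;> linarith [h1.1, h1.2, h2.1, h2.2])
    have h' : Hf p g ≤ _ := H_pair_le_l hp (fun ω => ⌊g ω⌋) f
    linarith
  obtain ⟨E1, E2⟩ := half_ent hp Dx C1
  obtain ⟨E3, E4⟩ := half_ent hp Dy C1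
  have e5 : H p (fun ω => y ω + x ω) = H p (fun ω => x ω + y ω) := by
    simp only [add_comm]
  rw [e5] at E3
  have e6 : H p (fun ω => (y ω, x ω)) = H p (fun ω => (x ω, y ω)) :=
    H_eq_of_iff hp _ _ (fun a b _ _ => by simp only [Prod.mk.injEq]; tauto)
  rw [e6] at E2
  have u1 : s₁ ≤ s + 3 * ε := by
    refine le_of_mul_le_mul_right ?_ hℓ
    linarith
  have u2 : s₂ ≤ s + 3 * ε := by
    refine le_of_mul_le_mul_right ?_ hℓ
    linarith
  have w1 : s - 3 * ε ≤ s₁ := by linarith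
  have w2 : s - 3 * ε ≤ s₂ := by linarith
  have w1' := mul_le_mul_of_nonneg_right w1 hℓ.le
  have w2' := mul_le_mul_of_nonneg_right w2 hℓ.le
  obtain ⟨Fx, Sx⟩ := half_hyp hp Dx hs ε0 hκ hεs hℓ w1 C1 hC θ0 hθ1 hθ2 hθ3
  obtain ⟨Fy, Sy⟩ := half_hyp hp Dy hs ε0 hκ hεs hℓ w2 C1 hC θ0 hθ1 hθ2 hθ3
  refine ⟨⟨hp, ix, iy, bx, by_, Fx, Sx, Fy, Sy⟩, ?_, ?_, ?_, ?_⟩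
  · linarith
  · linarith
  · linarith
  · linarith

/-- rounding error of the form -/
theorem form_round {a₁ a₂ a₃ X Y c L : ℝ} {i j f : ℤ} (L1 : 1 ≤ L) (c0 : 0 ≤ c)
    (hi : i = ⌊L * X⌋) (hj : j = ⌊L * Y⌋)
    (hf : f = ⌊L * (a₁ * X ^ 2 + a₂ * (X * Y) + a₃ * Y ^ 2)⌋)
    (bx : |(i : ℝ)| ≤ c * L) (by_ : |(j : ℝ)| ≤ c * L) :
    |(a₁ * (i : ℝ) ^ 2 + a₂ * ((i : ℝ) * j) + a₃ * (j : ℝ) ^ 2) / L - f| ≤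
      (|a₁| + |a₂| + |a₃|) * (2 * c + 1) + 1 := by
  have L0 : 0 < L := by linarith
  obtain ⟨u, hu⟩ : ∃ u, u = L * X - i := ⟨_, rfl⟩
  obtain ⟨v, hv⟩ : ∃ v, v = L * Y - j := ⟨_, rfl⟩
  have u0 : 0 ≤ u := by rw [hu, hi]; linarith [Int.floor_le (L * X)]
  have u1 : u ≤ 1 := by rw [hu, hi]; linarith [Int.lt_floor_add_one (L * X)]
  have v0 : 0 ≤ v := by rw [hv, hj]; linarith [Int.floor_le (L * Y)]
  have v1 : v ≤ 1 := by rw [hv, hj]; linarith [Int.lt_floor_add_one (L * Y)]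
  have hX : X = (i + u) / L := by rw [hu]; field_simp; ring
  have hY : Y = (j + v) / L := by rw [hv]; field_simp; ring
  have f0 := Int.floor_le (L * (a₁ * X ^ 2 + a₂ * (X * Y) + a₃ * Y ^ 2))
  have f1 := Int.lt_floor_add_one (L * (a₁ * X ^ 2 + a₂ * (X * Y) + a₃ * Y ^ 2))
  rw [← hf] at f0 f1
  have e : L * (a₁ * X ^ 2 + a₂ * (X * Y) + a₃ * Y ^ 2) -
      (a₁ * (i : ℝ) ^ 2 + a₂ * ((i : ℝ) * j) + a₃ * (j : ℝ) ^ 2) / L =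
      a₁ * ((2 * i * u + u ^ 2) / L) + a₂ * ((i * v + j * u + u * v) / L) + a₃ * ((2 * j * v + v ^ 2) / L) := by
    rw [hX, hY]; field_simp; ring
  have hcL : 0 ≤ c * L := by positivity
  have pr : ∀ a b : ℝ, |a| ≤ c * L → 0 ≤ b → b ≤ 1 → |a * b| ≤ c * L := by
    intro a b h1 h2 h3
    rw [abs_mul, abs_of_nonneg h2]
    calc |a| * b ≤ (c * L) * 1 := mul_le_mul h1 h3 h2 hcL
      _ = c * L := mul_one _
  have q : ∀ t : ℝ, |t| ≤ 2 * (c * L) + 1 → |t / L| ≤ 2 * c + 1 := by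
    intro t ht
    rw [abs_div, abs_of_pos L0, div_le_iff₀ L0]
    nlinarith
  have iu := abs_le.1 (pr i u bx u0 u1)
  have iv := abs_le.1 (pr i v bx v0 v1)
  have ju := abs_le.1 (pr j u by_ u0 u1)
  have jv := abs_le.1 (pr j v by_ v0 v1)
  have uu0 : 0 ≤ u ^ 2 := sq_nonneg _
  have uu1 : u ^ 2 ≤ 1 := by nlinarith
  have vv0 : 0 ≤ v ^ 2 := sq_nonneg _
  have vv1 : v ^ 2 ≤ 1 := by nlinarith
  have uv0 : 0 ≤ u * v := mul_nonneg u0 v0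
  have uv1 : u * v ≤ 1 := by nlinarith
  have q1 := q (2 * i * u + u ^ 2) (by rw [abs_le]; constructor <;> linarith [iu.1, iu.2])
  have q2 := q (i * v + j * u + u * v) (by rw [abs_le]; constructor <;> linarith [iv.1, iv.2, ju.1, ju.2])
  have q3 := q (2 * j * v + v ^ 2) (by rw [abs_le]; constructor <;> linarith [jv.1, jv.2])
  have m1 : |a₁ * ((2 * i * u + u ^ 2) / L)| ≤ |a₁| * (2 * c + 1) := by
    rw [abs_mul]; exact mul_le_mul_of_nonneg_left q1 (abs_nonneg _)
  have m2 : |a₂ * ((i * v + j * u + u * v) / L)| ≤ |a₂| * (2 * c + 1) := by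
    rw [abs_mul]; exact mul_le_mul_of_nonneg_left q2 (abs_nonneg _)
  have m3 : |a₃ * ((2 * j * v + v ^ 2) / L)| ≤ |a₃| * (2 * c + 1) := by
    rw [abs_mul]; exact mul_le_mul_of_nonneg_left q3 (abs_nonneg _)
  have m1 := abs_le.1 m1
  have m2 := abs_le.1 m2
  have m3 := abs_le.1 m3
  rw [abs_le]
  constructor <;> linarith [m1.1, m1.2, m2.1, m2.2, m3.1, m3.2]

end fin
end CF

namespace CF
open Classical Finset

section fin2

/-- the joint discretization -/
noncomputable def TT {Ω : Type} (n : ℕ) (X Y Z W : Ω → ℝ) (ω : Ω) : ℤ × ℤ × ℤ × ℤ :=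
  (⌊(2 : ℝ) ^ n * X ω⌋, ⌊(2 : ℝ) ^ n * Y ω⌋, ⌊(2 : ℝ) ^ n * Z ω⌋, ⌊(2 : ℝ) ^ n * W ω⌋)

/-- integer box -/
noncomputable def II (n : ℕ) (M : ℝ) : Finset ℤ := Finset.Icc ⌊(2 : ℝ) ^ n * (-M)⌋ ⌊(2 : ℝ) ^ n * M⌋

theorem mem_II {n : ℕ} {M t : ℝ} (h : |t| ≤ M) : ⌊(2 : ℝ) ^ n * t⌋ ∈ II n M := by
  have h := abs_le.1 h
  have : (0 : ℝ) ≤ 2 ^ n := by positivity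
  exact Finset.mem_Icc.2 ⟨Int.floor_mono (mul_le_mul_of_nonneg_left h.1 this), Int.floor_mono (mul_le_mul_of_nonneg_left h.2 this)⟩

theorem meas_TT {Ω : Type} [MeasurableSpace Ω] (n : ℕ) {X Y Z W : Ω → ℝ} (hX : Measurable X) (hY : Measurable Y)
    (hZ : Measurable Z) (hW : Measurable W) (v : ℤ × ℤ × ℤ × ℤ) : MeasurableSet (TT n X Y Z W ⁻¹' {v}) := by
  have f : ∀ U : Ω → ℝ, Measurable U → Measurable (fun ω => ⌊(2 : ℝ) ^ n * U ω⌋) := fun U hU =>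
    Int.measurable_floor.comp (measurable_const.mul hU)
  have : Measurable (TT n X Y Z W) := (f X hX).prodMk ((f Y hY).prodMk ((f Z hZ).prodMk (f W hW)))
  exact this (measurableSet_singleton v)

theorem main_model {Ω : Type} [MeasurableSpace Ω] (P : Measure Ω) [IsProbabilityMeasure P] {X Y : Ω → ℝ}
    (hX : Measurable X) (hY : Measurable Y) {a₁ a₂ a₃ : ℝ} {s ε κ C C₁ C₂ θ s₁ s₂ c : ℝ} {k : ℕ} (n : ℕ)
    (c0 : 0 < c)
    (hb : ∀ ω, X ω ∈ Set.Icc (-c) c ∧ Y ω ∈ Set.Icc (-c) c)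
    (s10 : 0 ≤ s₁) (s11 : s₁ ≤ 1) (s20 : 0 ≤ s₂) (s21 : s₂ ≤ 1)
    (FX : FrostmanGiven P X Y s₁ C₁) (FY : FrostmanGiven P Y X s₂ C₂) (hC1 : C₁ ≤ C) (hC2 : C₂ ≤ C)
    (hk1 : (|a₁| + |a₂| + |a₃|) * (2 * (c + 1) + 1) + 1 ≤ k)
    (Hxy : Hn2 P n X Y / 2 < n * (s + ε)) (Hm : Hn P n (fun ω => X ω + Y ω) < n * (s + ε))
    (Hff : Hn P n (fun ω => a₁ * X ω ^ 2 + a₂ * (X ω * Y ω) + a₃ * Y ω ^ 2) < n * (s + ε))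
    (hs12 : 2 * s ≤ s₁ + s₂)
    (hs : 0 < s) (ε0 : 0 < ε) (hκ : 8 * ε ≤ κ) (hεs : 8 * ε ≤ s) (hℓ : 0 < n * log 2)
    (C1 : 1 ≤ C) (hC : log (3 * C) ≤ ε * (n * log 2)) (θ0 : 0 < θ) (hθ1 : log θ ≤ 0)
    (hθ2 : s / 2 * log θ ≤ log (κ / (3 * C))) (hθ3 : -log θ ≤ n * log 2)
    (h2 : 2 ≤ ε * (n * log 2)) (hk : log (2 * (2 * k : ℕ) + 3) ≤ ε * (n * log 2))
    (core : ∀ (Ω : Type) [Fintype Ω] (p x y : Ω → ℝ),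
      PHyp p x y s κ (n * log 2) (c + 1) θ κ → H p x ≤ (s + κ) * (n * log 2) → H p y ≤ (s + κ) * (n * log 2) →
      H p (fun ω => x ω + y ω) ≤ (s + κ) * (n * log 2) →
      Hf p (fun ω => (a₁ * x ω ^ 2 + a₂ * (x ω * y ω) + a₃ * y ω ^ 2) / exp (n * log 2)) ≤ (s + κ) * (n * log 2) → False) :
    False := by
  have eL : exp (n * log 2) = 2 ^ n := by
    rw [mul_comm, exp_mul, exp_log (by norm_num)]; exact rpow_natCast _ _
  have L1 : (1 : ℝ) ≤ 2 ^ n := one_le_pow₀ (by norm_num)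
  have L0 : (0 : ℝ) < 2 ^ n := by positivity
  have l2 : 0 < log 2 := log_pos (by norm_num)
  obtain ⟨Z, hZ⟩ : ∃ Z : Ω → ℝ, Z = fun ω => X ω + Y ω := ⟨_, rfl⟩
  obtain ⟨W, hW⟩ : ∃ W : Ω → ℝ, W = fun ω => a₁ * X ω ^ 2 + a₂ * (X ω * Y ω) + a₃ * Y ω ^ 2 := ⟨_, rfl⟩
  rw [← hZ] at Hm
  rw [← hW] at Hff
  have bX : ∀ ω, |X ω| ≤ c := fun ω => abs_le.2 (hb ω).1
  have bY : ∀ ω, |Y ω| ≤ c := fun ω => abs_le.2 (hb ω).2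
  have bZ : ∀ ω, |Z ω| ≤ c + c := fun ω => by
    rw [hZ]; exact (abs_add_le _ _).trans (add_le_add (bX ω) (bY ω))
  have bW : ∀ ω, |W ω| ≤ |a₁| * c ^ 2 + |a₂| * (c * c) + |a₃| * c ^ 2 := fun ω => by
    rw [hW]
    refine (abs_add_le _ _).trans (add_le_add ((abs_add_le _ _).trans (add_le_add ?_ ?_)) ?_)
    · rw [abs_mul, abs_pow]
      exact mul_le_mul_of_nonneg_left (pow_le_pow_left₀ (abs_nonneg _) (bX ω) 2) (abs_nonneg _)
    · rw [abs_mul, abs_mul]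
      exact mul_le_mul_of_nonneg_left (mul_le_mul (bX ω) (bY ω) (abs_nonneg _) c0.le) (abs_nonneg _)
    · rw [abs_mul, abs_pow]
      exact mul_le_mul_of_nonneg_left (pow_le_pow_left₀ (abs_nonneg _) (bY ω) 2) (abs_nonneg _)
  have mZ : Measurable Z := by rw [hZ]; exact hX.add hY
  have mW : Measurable W := by
    rw [hW]
    exact (((hX.pow_const 2).const_mul a₁).add ((hX.mul hY).const_mul a₂)).add ((hY.pow_const 2).const_mul a₃)
  have hT := meas_TT n hX hY mZ mW
  set T := TT n X Y Z W with hTT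
  obtain ⟨F, hFe⟩ : ∃ F : Finset (ℤ × ℤ × ℤ × ℤ), F = II n c ×ˢ (II n c ×ˢ (II n (c + c) ×ˢ
    II n (|a₁| * c ^ 2 + |a₂| * (c * c) + |a₃| * c ^ 2))) := ⟨_, rfl⟩
  have hF : ∀ ω, T ω ∈ F := by
    intro ω
    rw [hFe]
    exact Finset.mem_product.2 ⟨mem_II (bX ω), Finset.mem_product.2 ⟨mem_II (bY ω), Finset.mem_product.2 ⟨mem_II (bZ ω), mem_II (bW ω)⟩⟩⟩
  have hp := law_isP (P := P) T hT F hF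
  have ex : ∀ j : {v // v ∈ F}, law P T F j ≠ 0 → ∃ ω, T ω = j.1 := by
    intro j hj
    by_contra h
    push Not at h
    apply hj
    have : T ⁻¹' {j.1} = ∅ := by
      ext ω
      simpa using h ω
    unfold law
    rw [this]; simp
  have fl : ∀ t : ℝ, |t| ≤ c → |((⌊(2 : ℝ) ^ n * t⌋ : ℤ) : ℝ)| ≤ (c + 1) * 2 ^ n := by
    intro t ht
    have ht := abs_le.1 ht
    have h1 := Int.floor_le ((2 : ℝ) ^ n * t)
    have h2 := Int.lt_floor_add_one ((2 : ℝ) ^ n * t)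
    have h3 := mul_le_mul_of_nonneg_left ht.1 L0.le
    have h4 := mul_le_mul_of_nonneg_left ht.2 L0.le
    rw [abs_le]
    constructor <;> linarith
  have key := fin_step (p := law P T F) (x := fun j => (j.1.1 : ℝ)) (y := fun j => (j.1.2.1 : ℝ))
    (g := fun j => (a₁ * (j.1.1 : ℝ) ^ 2 + a₂ * ((j.1.1 : ℝ) * (j.1.2.1 : ℝ)) + a₃ * (j.1.2.1 : ℝ) ^ 2) / exp (n * log 2))
    (m := fun j => j.1.2.2.1) (f := fun j => j.1.2.2.2) (s := s) (ε := ε) (κ := κ) (ℓ := n * log 2) (C := C) (θ := θ)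
    (s₁ := s₁) (s₂ := s₂) (c := c + 1) (k := k) hp (fun j => ⟨_, rfl⟩) (fun j => ⟨_, rfl⟩)
    (by
      intro j hj
      obtain ⟨ω, hω⟩ := ex j hj
      rw [eL]
      change |((j.1.1 : ℤ) : ℝ)| ≤ _
      rw [← hω]
      exact fl _ (bX ω))
    (by
      intro j hj
      obtain ⟨ω, hω⟩ := ex j hj
      rw [eL]
      change |((j.1.2.1 : ℤ) : ℝ)| ≤ _
      rw [← hω]
      exact fl _ (bY ω))
    (by
      intro z ρ j hρ
      have e1 := law_Pb (P := P) T hT F hF (fun v => |(v.1 : ℝ) - z| ≤ ρ ∧ (v.2.1 : ℝ) = j)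
      have e2 := law_Pb (P := P) T hT F hF (fun v => (v.2.1 : ℝ) = j)
      rw [e1, e2]
      exact frost_disc FX s10 s11 hC1 (by linarith) n z ρ j hρ)
    (by
      intro z ρ j hρ
      have e1 := law_Pb (P := P) T hT F hF (fun v => |(v.2.1 : ℝ) - z| ≤ ρ ∧ (v.1 : ℝ) = j)
      have e2 := law_Pb (P := P) T hT F hF (fun v => (v.1 : ℝ) = j)
      rw [e1, e2]
      exact frost_disc FY s20 s21 hC2 (by linarith) n z ρ j hρ)
    (by
      intro j hj
      obtain ⟨ω, hω⟩ := ex j hj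
      change |((j.1.1 : ℤ) : ℝ) + ((j.1.2.1 : ℤ) : ℝ) - ((j.1.2.2.1 : ℤ) : ℝ)| ≤ 1
      rw [← hω]
      change |((⌊(2 : ℝ) ^ n * X ω⌋ : ℤ) : ℝ) + ((⌊(2 : ℝ) ^ n * Y ω⌋ : ℤ) : ℝ) - ((⌊(2 : ℝ) ^ n * Z ω⌋ : ℤ) : ℝ)| ≤ 1
      have e : (2 : ℝ) ^ n * Z ω = 2 ^ n * X ω + 2 ^ n * Y ω := by rw [hZ]; ring
      rw [e]
      have h1 := Int.le_floor_add (2 ^ n * X ω) (2 ^ n * Y ω)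
      have h2 := Int.le_floor_add_floor (2 ^ n * X ω) (2 ^ n * Y ω)
      have h1' : ((⌊(2 : ℝ) ^ n * X ω⌋ : ℤ) : ℝ) + ((⌊(2 : ℝ) ^ n * Y ω⌋ : ℤ) : ℝ) ≤ (⌊(2 : ℝ) ^ n * X ω + 2 ^ n * Y ω⌋ : ℤ) := by
        exact_mod_cast h1
      have h2' : ((⌊(2 : ℝ) ^ n * X ω + 2 ^ n * Y ω⌋ : ℤ) : ℝ) - 1 ≤ ((⌊(2 : ℝ) ^ n * X ω⌋ : ℤ) : ℝ) + ((⌊(2 : ℝ) ^ n * Y ω⌋ : ℤ) : ℝ) := by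
        exact_mod_cast h2
      rw [abs_le]
      constructor <;> linarith)
    (by
      intro j hj
      obtain ⟨ω, hω⟩ := ex j hj
      rw [eL]
      refine le_trans (form_round (X := X ω) (Y := Y ω) (c := c + 1) L1 (by linarith) ?_ ?_ ?_ ?_ ?_) hk1
      · rw [← hω]; rfl
      · rw [← hω]; rfl
      · rw [← hω, hTT]; simp only [TT, hW]
      · rw [← hω]; exact fl _ (bX ω)
      · rw [← hω]; exact fl _ (bY ω))
    (by
      have e : Hn2 P n X Y = H (law P T F) (fun j => (((j.1.1 : ℝ)) / 2 ^ n, ((j.1.2.1 : ℝ)) / 2 ^ n)) / log 2 :=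
        law_ent (P := P) T hT F hF (fun v => ((v.1 : ℝ) / 2 ^ n, (v.2.1 : ℝ) / 2 ^ n))
      have e2 : H (law P T F) (fun j => (((j.1.1 : ℝ)) / 2 ^ n, ((j.1.2.1 : ℝ)) / 2 ^ n)) =
          H (law P T F) (fun j => (((j.1.1 : ℝ)), ((j.1.2.1 : ℝ)))) :=
        H_eq_of_iff hp _ _ (fun a b _ _ => by
          simp only [Prod.mk.injEq, div_left_inj' L0.ne'])
      rw [e, e2, div_div, div_lt_iff₀ (by positivity)] at Hxy
      linarith)
    (by
      have e : Hn P n Z = H (law P T F) (fun j => (j.1.2.2.1 : ℝ) / 2 ^ n) / log 2 :=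
        law_ent (P := P) T hT F hF (fun v => (v.2.2.1 : ℝ) / 2 ^ n)
      have e2 : H (law P T F) (fun j => (j.1.2.2.1 : ℝ) / 2 ^ n) = H (law P T F) (fun j => j.1.2.2.1) :=
        H_eq_of_iff hp _ _ (fun a b _ _ => by
          simp only [div_left_inj' L0.ne', Int.cast_inj])
      rw [e, e2, div_lt_iff₀ (by positivity)] at Hm
      linarith)
    (by
      have e : Hn P n W = H (law P T F) (fun j => (j.1.2.2.2 : ℝ) / 2 ^ n) / log 2 :=
        law_ent (P := P) T hT F hF (fun v => (v.2.2.2 : ℝ) / 2 ^ n)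
      have e2 : H (law P T F) (fun j => (j.1.2.2.2 : ℝ) / 2 ^ n) = H (law P T F) (fun j => j.1.2.2.2) :=
        H_eq_of_iff hp _ _ (fun a b _ _ => by
          simp only [div_left_inj' L0.ne', Int.cast_inj])
      rw [e, e2, div_lt_iff₀ (by positivity)] at Hff
      linarith)
    hs12 hs ε0 hκ hεs hℓ C1 hC θ0 hθ1 hθ2 hθ3 h2 hk
  obtain ⟨k1, k2, k3, k4, k5⟩ := key
  exact core _ _ _ _ k1 k2 k3 k4 k5

end fin2
end CF

/-- Theorem (Conditionally Frostman, general nondegenerate rational quadratic forms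
`φ(x,y) = a₁x² + a₂xy + a₃y²`, `a₂² - 4a₁a₃ ≠ 0`): for `0 < s < 1` there is `εd = εd(s) > 0`
such that for every nondegenerate form there is `ε = ε(φ,s) > 0`, equal to `εd` when the form
is diagonal (`a₂ = 0`), such that for all `C₁, C₂, c > 0` there is `N` with:
for every conditionally `(s₁,C₁;s₂,C₂)`-Frostman `(X,Y)` with range in `[-c,c]²`,
`0 ≤ s₁,s₂ ≤ 1` and `s₁+s₂ ≥ 2s`,
`max{½Hₙ(X,Y), Hₙ(X+Y), Hₙ(φ(X,Y))} ≥ n(s+ε)` for all `n > N`. -/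
theorem conditionally_frostman_entropy (s : ℝ) (hs0 : 0 < s) (hs1 : s < 1) :
    ∃ εd : ℝ, 0 < εd ∧
      ∀ (a₁ a₂ a₃ : ℚ), a₂ ^ 2 - 4 * a₁ * a₃ ≠ 0 →
        ∃ ε : ℝ, 0 < ε ∧ (a₂ = 0 → ε = εd) ∧
          ∀ (C₁ C₂ c : ℝ), 0 < C₁ → 0 < C₂ → 0 < c →
            ∃ N : ℕ,
              ∀ (Ω : Type) (mΩ : MeasurableSpace Ω) (P : Measure Ω),
                IsProbabilityMeasure P →
                ∀ (X Y : Ω → ℝ), Measurable X → Measurable Y →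
                  (∀ ω, X ω ∈ Set.Icc (-c) c ∧ Y ω ∈ Set.Icc (-c) c) →
                  ∀ (s₁ s₂ : ℝ), 0 ≤ s₁ → s₁ ≤ 1 → 0 ≤ s₂ → s₂ ≤ 1 → 2 * s ≤ s₁ + s₂ →
                    FrostmanGiven P X Y s₁ C₁ → FrostmanGiven P Y X s₂ C₂ →
                    ∀ n : ℕ, N < n →
                      (n : ℝ) * (s + ε) ≤
                        max (max (Hn2 P n X Y / 2) (Hn P n (fun ω => X ω + Y ω)))
                          (Hn P n (fun ω =>
                            (a₁ : ℝ) * X ω ^ 2 + (a₂ : ℝ) * (X ω * Y ω) + (a₃ : ℝ) * Y ω ^ 2)) := by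
  obtain ⟨κd, κd0, hcore⟩ := CF.core s hs0 hs1
  refine ⟨min (κd / 8) (s / 8), lt_min (by linarith) (by linarith), ?_⟩
  intro a₁ a₂ a₃ hdet
  obtain ⟨κ, κ0, hκd, hcore⟩ := hcore a₁ a₂ a₃ hdet
  have hε0 : 0 < min (κ / 8) (s / 8) := lt_min (by linarith) (by linarith)
  refine ⟨min (κ / 8) (s / 8), hε0, fun h => by rw [hκd h], ?_⟩
  have hε1 : 8 * min (κ / 8) (s / 8) ≤ κ := by linarith [min_le_left (κ / 8) (s / 8)]
  have hε2 : 8 * min (κ / 8) (s / 8) ≤ s := by linarith [min_le_right (κ / 8) (s / 8)]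
  generalize min (κ / 8) (s / 8) = ε at hε0 hε1 hε2
  intro C₁ C₂ c _ _ c0
  obtain ⟨C, hC1, hC2, C1⟩ : ∃ C : ℝ, C₁ ≤ C ∧ C₂ ≤ C ∧ 1 ≤ C :=
    ⟨max (max C₁ C₂) 1, (le_max_left _ _).trans (le_max_left _ _),
      (le_max_right _ _).trans (le_max_left _ _), le_max_right _ _⟩
  obtain ⟨θ, θ0, hθ1, hθ2⟩ : ∃ θ : ℝ, 0 < θ ∧ log θ ≤ 0 ∧ s / 2 * log θ ≤ log (κ / (3 * C)) := by
    refine ⟨exp (min 0 (2 / s * log (κ / (3 * C)))), exp_pos _, ?_, ?_⟩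
    · rw [log_exp]; exact min_le_left _ _
    · rw [log_exp]
      have := mul_le_mul_of_nonneg_left (min_le_right 0 (2 / s * log (κ / (3 * C)))) (show 0 ≤ s / 2 by linarith)
      refine this.trans (le_of_eq ?_)
      field_simp
  obtain ⟨k, hk⟩ := exists_nat_ge ((|(a₁ : ℝ)| + |(a₂ : ℝ)| + |(a₃ : ℝ)|) * (2 * (c + 1) + 1) + 1)
  obtain ⟨ℓ0, hℓ0⟩ := hcore (c + 1) θ (by linarith) θ0
  have l2 : 0 < log 2 := log_pos (by norm_num)
  obtain ⟨N, hN⟩ := exists_nat_ge ((|ℓ0| + |log θ| + (|log (3 * C)| + |log (2 * (2 * k : ℕ) + 3)| + 2) / ε + 1) / log 2)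
  refine ⟨N, ?_⟩
  intro Ω mΩ P hP X Y hX hY hb s₁ s₂ s10 s11 s20 s21 hs12 FX FY n hn
  by_contra hcon
  rw [not_le, max_lt_iff, max_lt_iff] at hcon
  obtain ⟨⟨h1, h2⟩, h3⟩ := hcon
  have hNn : (N : ℝ) ≤ n := by exact_mod_cast hn.le
  have hbig := (div_le_iff₀ l2).1 (hN.trans hNn)
  have q0 := abs_nonneg ℓ0
  have q1 := abs_nonneg (log θ)
  have q2 := abs_nonneg (log (3 * C))
  have q3 := abs_nonneg (log (2 * (2 * k : ℕ) + 3))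
  have q4 : 0 ≤ (|log (3 * C)| + |log (2 * (2 * k : ℕ) + 3)| + 2) / ε := by positivity
  have q5 : (|log (3 * C)| + |log (2 * (2 * k : ℕ) + 3)| + 2) / ε ≤ n * log 2 := by linarith
  rw [div_le_iff₀ hε0] at q5
  refine CF.main_model P hX hY (k := k) n c0 hb s10 s11 s20 s21 FX FY hC1 hC2 hk h1 h2 h3 hs12 hs0 hε0 hε1 hε2
    (by linarith) C1 (by linarith [le_abs_self (log (3 * C))]) θ0 hθ1 hθ2 (by linarith [neg_abs_le (log θ)]) (by linarith)
    (by linarith [le_abs_self (log (2 * (2 * k : ℕ) + 3))]) ?_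
  intro Ω' _ p x y
  exact hℓ0 _ (by linarith [le_abs_self ℓ0]) Ω' p x y
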